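/- Assume the blow-up framework with T_i → ∞: for each i ∈ ℕ, K_i satisfies (K1) with constant C₀, (K2) with constant Λ and (K3), with K_i(x_i) → n(n−2); c_i : ∂'B₁⁺ → ℝ with |c_i| ≤ Λ; u_i is a positive solution of the boundary Yamabe system on B₁⁺ with coefficients (K_i, c_i); x_i ∈ cl(ℝⁿ₊) ∩ B(0,1/2) is a selected local maximum point, i.e. M_i := u_i(x_i), Γ_i := M_i^{2/(n−2)}, there is σ_i → 0 with u_i(x_i) ≥ u_i on B(x_i,σ_i) ∩ ℝⁿ₊ and Γ_i·σ_i → ∞, and u_i(x_i) · (min over cl(B_{2/3}⁺) of u_i) > i; moreover T_i := x_{i,n}·Γ_i → ∞ and the rescalings v̄_i(y) = M_i^{−1}·u_i(x_i + Γ_i^{−1}y) converge in C²_loc(ℝⁿ) to U(y) = (1+|y|²)^{−(n−2)/2}. Then there exists a constant C > 0 such that ‖∇K_i(x_i)‖ · Γ_i^{n−3} ≤ C for all i. -/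

import Mathlib

open Metric Set MeasureTheory Filter Topology

noncomputable section

abbrev Euc (n : ℕ) := EuclideanSpace ℝ (Fin n)

/-- Index of the last coordinate. -/
def lastIdx (n : ℕ) (h0 : 0 < n) : Fin n := ⟨n - 1, by omega⟩

/-- The open upper half-space `ℝⁿ₊ = {x : xₙ > 0}`. -/
def upperHalf (n : ℕ) (h0 : 0 < n) : Set (Euc n) := {x | 0 < x (lastIdx n h0)}

/-- The upper half-ball `B_r⁺ = B(0,r) ∩ ℝⁿ₊`. -/
def halfBall (n : ℕ) (h0 : 0 < n) (r : ℝ) : Set (Euc n) :=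
  Metric.ball (0 : Euc n) r ∩ upperHalf n h0

/-- The flat boundary portion `∂'B_r⁺ = B(0,r) ∩ {xₙ = 0}`. -/
def flatBdry (n : ℕ) (h0 : 0 < n) (r : ℝ) : Set (Euc n) :=
  Metric.ball (0 : Euc n) r ∩ {x | x (lastIdx n h0) = 0}

/-- Laplacian (within a set `s`) as the sum of pure second partial derivatives. -/
def lapWithin (n : ℕ) (s : Set (Euc n)) (u : Euc n → ℝ) (x : Euc n) : ℝ :=
  ∑ i : Fin n, iteratedFDerivWithin ℝ 2 u s x
    ![EuclideanSpace.single i (1 : ℝ), EuclideanSpace.single i (1 : ℝ)]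

/-- Normal derivative `∂u/∂xₙ` (within a set `s`). -/
def normalDerivWithin (n : ℕ) (h0 : 0 < n) (s : Set (Euc n)) (u : Euc n → ℝ) (x : Euc n) : ℝ :=
  fderivWithin ℝ u s x (EuclideanSpace.single (lastIdx n h0) (1 : ℝ))

/-- Positive solution of the boundary Yamabe system on `B₁⁺` with coefficients `(K, c)`. -/
def IsYamabeSol (n : ℕ) (h0 : 0 < n) (K c u : Euc n → ℝ) : Prop :=
  ContDiffOn ℝ 2 u (closure (halfBall n h0 1)) ∧
  (∀ x ∈ closure (halfBall n h0 1), 0 < u x) ∧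
  (∀ x ∈ halfBall n h0 1,
    lapWithin n (closure (halfBall n h0 1)) u x
      + K x * u x ^ (((n : ℝ) + 2) / ((n : ℝ) - 2)) = 0) ∧
  (∀ x ∈ flatBdry n h0 1,
    normalDerivWithin n h0 (closure (halfBall n h0 1)) u x
      = c x * u x ^ ((n : ℝ) / ((n : ℝ) - 2)))

/-- Condition (K1) with constant `C₀`. -/
def CondK1 (n : ℕ) (h0 : 0 < n) (C₀ : ℝ) (K : Euc n → ℝ) : Prop :=
  ContDiffOn ℝ (n - 2 : ℕ) K (closure (halfBall n h0 1)) ∧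
  ∀ x ∈ closure (halfBall n h0 1), ∀ j : ℕ, 1 ≤ j → j ≤ n - 2 →
    ‖iteratedFDerivWithin ℝ j K (closure (halfBall n h0 1)) x‖ ≤
      C₀ * ‖iteratedFDerivWithin ℝ 1 K (closure (halfBall n h0 1)) x‖ ^
        (((n : ℝ) - 2 - (j : ℝ)) / ((n : ℝ) - 3))

/-- Condition (K2) with constant `Λ`. -/
def CondK2 (n : ℕ) (h0 : 0 < n) (Λ : ℝ) (K : Euc n → ℝ) : Prop :=
  ∀ x ∈ closure (halfBall n h0 1),
    1 / Λ ≤ K x ∧ ∀ j : ℕ, 1 ≤ j → j ≤ n - 2 →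
      ‖iteratedFDerivWithin ℝ j K (closure (halfBall n h0 1)) x‖ ≤ Λ

/-- Condition (K3): `K` depends only on the first `n - 1` coordinates. -/
def CondK3 (n : ℕ) (h0 : 0 < n) (K : Euc n → ℝ) : Prop :=
  ∀ x ∈ closure (halfBall n h0 1), ∀ y ∈ closure (halfBall n h0 1),
    (∀ i : Fin n, i ≠ lastIdx n h0 → x i = y i) → K x = K y

/-- `C²_loc` convergence of `v i` to `U` on the region `D`: uniform convergence of the
functions and their first and second derivatives on every compact subset of `D`. -/
def TendstoC2LocOn (n : ℕ) (v : ℕ → Euc n → ℝ) (U : Euc n → ℝ) (D : Set (Euc n)) : Prop :=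
  ∀ s : Set (Euc n), IsCompact s → s ⊆ D →
    TendstoUniformlyOn (fun i => v i) U Filter.atTop s ∧
    TendstoUniformlyOn (fun i y => fderivWithin ℝ (v i) D y)
      (fun y => fderivWithin ℝ U D y) Filter.atTop s ∧
    TendstoUniformlyOn (fun i y => iteratedFDerivWithin ℝ 2 (v i) D y)
      (fun y => iteratedFDerivWithin ℝ 2 U D y) Filter.atTop s

/-- `f` is differentiable near `y`, with gradient `g` at `y`; the gradient field is differentiable
at `y`, and its trace there (the Laplacian of `f`) is `L`. -/
def HasLap {n : ℕ} (f : Euc n → ℝ) (y g : Euc n) (L : ℝ) : Prop :=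
  ∃ (F : Euc n → Euc n) (H : Euc n →L[ℝ] Euc n),
    (∀ᶠ z in 𝓝 y, HasFDerivAt f (innerSL ℝ (F z)) z) ∧ F y = g ∧ HasFDerivAt F H y ∧
      LinearMap.trace ℝ (Euc n) (H : Euc n →ₗ[ℝ] Euc n) = L

lemma trace_smulRight_clm {n : ℕ} (φ : Euc n →L[ℝ] ℝ) (b : Euc n) :
    LinearMap.trace ℝ (Euc n) ((φ.smulRight b : Euc n →L[ℝ] Euc n) : Euc n →ₗ[ℝ] Euc n) = φ b :=
  LinearMap.trace_smulRight (φ : Euc n →ₗ[ℝ] ℝ) b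

namespace HasLap

variable {n : ℕ} {f h : Euc n → ℝ} {y g g' : Euc n} {L L' : ℝ}

lemma hasFDerivAt (hf : HasLap f y g L) : HasFDerivAt f (innerSL ℝ g) y := by
  obtain ⟨F, H, h1, rfl, -, -⟩ := hf
  exact h1.self_of_nhds

lemma continuousAt (hf : HasLap f y g L) : ContinuousAt f y := hf.hasFDerivAt.continuousAt

lemma congr (hf : HasLap f y g L) (hfh : h =ᶠ[𝓝 y] f) : HasLap h y g L := by
  obtain ⟨F, H, h1, h2, h3, h4⟩ := hf
  refine ⟨F, H, ?_, h2, h3, h4⟩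
  filter_upwards [h1, hfh.eventuallyEq_nhds] with z hz hz'
  exact hz.congr_of_eventuallyEq hz'

lemma const (a : ℝ) (y : Euc n) : HasLap (fun _ => a) y 0 0 := by
  refine ⟨fun _ => 0, 0, ?_, rfl, hasFDerivAt_const _ _, by simp⟩
  refine Eventually.of_forall fun z => ?_
  simpa using hasFDerivAt_const a z

lemma add (hf : HasLap f y g L) (hh : HasLap h y g' L') :
    HasLap (fun z => f z + h z) y (g + g') (L + L') := by
  obtain ⟨F, H, h1, rfl, h3, rfl⟩ := hf
  obtain ⟨F', H', h1', rfl, h3', rfl⟩ := hh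
  refine ⟨fun z => F z + F' z, H + H', ?_, rfl, h3.add h3', by simp⟩
  filter_upwards [h1, h1'] with z hz hz'
  have := hz.add hz'
  rw [← map_add] at this
  exact this

lemma mul (hf : HasLap f y g L) (hh : HasLap h y g' L') :
    HasLap (fun z => f z * h z) y (f y • g' + h y • g)
      (f y * L' + h y * L + 2 * inner ℝ g g') := by
  obtain ⟨F, H, h1, rfl, h3, rfl⟩ := hf
  obtain ⟨F', H', h1', rfl, h3', rfl⟩ := hh
  refine ⟨fun z => f z • F' z + h z • F z, _, ?_, rfl,
    (h1.self_of_nhds.smul h3').add (h1'.self_of_nhds.smul h3), ?_⟩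
  · filter_upwards [h1, h1'] with z hz hz'
    have := hz.mul hz'
    rw [← map_smul, ← map_smul, ← map_add] at this
    exact this
  · simp only [ContinuousLinearMap.toLinearMap_add, ContinuousLinearMap.toLinearMap_smul,
      map_add, map_smul, trace_smulRight_clm, innerSL_apply_apply, smul_eq_mul]
    rw [real_inner_comm (F y) (F' y)]
    ring

lemma const_mul (a : ℝ) (hf : HasLap f y g L) : HasLap (fun z => a * f z) y (a • g) (a * L) := by
  have := (const a y).mul hf
  simpa using this

lemma sub (hf : HasLap f y g L) (hh : HasLap h y g' L') :
    HasLap (fun z => f z - h z) y (g - g') (L - L') := by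
  have := hf.add (hh.const_mul (-1))
  simpa [sub_eq_add_neg] using this

lemma comp_real {φ φ' : ℝ → ℝ} {d : ℝ} (hf : HasLap f y g L)
    (h1 : ∀ᶠ t in 𝓝 (f y), HasDerivAt φ (φ' t) t) (h2 : HasDerivAt φ' d (f y)) :
    HasLap (fun z => φ (f z)) y (φ' (f y) • g) (φ' (f y) * L + d * ‖g‖ ^ 2) := by
  have hc := hf.continuousAt
  obtain ⟨F, H, h1', rfl, h3, rfl⟩ := hf
  refine ⟨fun z => φ' (f z) • F z, _, ?_, rfl,
    (h2.comp_hasFDerivAt y h1'.self_of_nhds).smul h3, ?_⟩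
  · filter_upwards [h1', hc.eventually h1] with z hz hz'
    have := hz'.comp_hasFDerivAt z hz
    rw [← map_smul] at this
    exact this
  · have e2 : (d • innerSL ℝ (F y)).smulRight (F y) = d • (innerSL ℝ (F y)).smulRight (F y) := by
      ext; simp [mul_smul]
    rw [e2]
    simp only [ContinuousLinearMap.toLinearMap_add, ContinuousLinearMap.toLinearMap_smul,
      map_add, map_smul, trace_smulRight_clm, innerSL_apply_apply, smul_eq_mul,
      real_inner_self_eq_norm_sq, Function.comp]

lemma rpow (hf : HasLap f y g L) (p : ℝ) (hy : 0 < f y) :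
    HasLap (fun z => f z ^ p) y ((p * f y ^ (p - 1)) • g)
      (p * f y ^ (p - 1) * L + p * (p - 1) * f y ^ (p - 2) * ‖g‖ ^ 2) := by
  have := hf.comp_real (φ := fun t => t ^ p) (φ' := fun t => p * t ^ (p - 1))
    (d := p * ((p - 1) * f y ^ (p - 1 - 1))) ?_ ?_
  · convert this using 2
    rw [show p - 1 - 1 = p - 2 by ring]; ring
  · filter_upwards [lt_mem_nhds hy] with t ht
    exact Real.hasDerivAt_rpow_const (Or.inl ht.ne')
  · exact (Real.hasDerivAt_rpow_const (Or.inl hy.ne')).const_mul p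

lemma linear (a : Euc n) (y : Euc n) : HasLap (fun z => inner ℝ a z) y a 0 := by
  refine ⟨fun _ => a, 0, ?_, rfl, hasFDerivAt_const _ _, by simp⟩
  exact Eventually.of_forall fun z => (innerSL ℝ a).hasFDerivAt

lemma norm_sq (y : Euc n) : HasLap (fun z => ‖z‖ ^ 2) y ((2 : ℝ) • y) (2 * n) := by
  refine ⟨fun z => (2 : ℝ) • z, (2 : ℝ) • ContinuousLinearMap.id ℝ _, ?_, rfl,
    (hasFDerivAt_id y).const_smul (2 : ℝ), by simp⟩
  refine Eventually.of_forall fun z => ?_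
  have := (hasStrictFDerivAt_norm_sq z).hasFDerivAt
  have e : innerSL ℝ ((2 : ℝ) • z) = 2 • (innerSL ℝ) z := by
    ext v; simp [two_mul]
  rw [← e] at this
  exact this

lemma of_contDiffAt (hf : ContDiffAt ℝ 2 f y) :
    ∃ g L, HasLap f y g L := by
  have h1 : ∀ᶠ z in 𝓝 y, DifferentiableAt ℝ f z := by
    have := hf.eventually (by simp)
    filter_upwards [this] with z hz
    exact hz.differentiableAt (by simp)
  have h2 : DifferentiableAt ℝ (fderiv ℝ f) y :=
    (hf.fderiv_right (m := 1) (by norm_num [one_add_one_eq_two])).differentiableAt (by simp)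
  refine ⟨_, _, fun z => (InnerProductSpace.toDual ℝ (Euc n)).symm (fderiv ℝ f z), _, ?_, rfl,
    ((InnerProductSpace.toDual ℝ (Euc n)).symm.toContinuousLinearEquiv.hasFDerivAt.comp y
      h2.hasFDerivAt), rfl⟩
  filter_upwards [h1] with z hz
  have : (innerSL ℝ ((InnerProductSpace.toDual ℝ (Euc n)).symm (fderiv ℝ f z))) = fderiv ℝ f z := by
    ext v; simp
  rw [this]
  exact hz.hasFDerivAt

lemma lap_eq_sum (hf : HasLap f y g L) :
    L = ∑ i : Fin n, fderiv ℝ (fderiv ℝ f) y (EuclideanSpace.single i (1 : ℝ))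
      (EuclideanSpace.single i (1 : ℝ)) := by
  obtain ⟨F, H, h1, rfl, h3, rfl⟩ := hf
  have h4 : fderiv ℝ f =ᶠ[𝓝 y] fun z => innerSL ℝ (F z) := by
    filter_upwards [h1] with z hz using hz.fderiv
  have h5 : HasFDerivAt (fun z => innerSL ℝ (F z)) ((innerSL ℝ).comp H) y := by
    have := (innerSL ℝ (E := Euc n)).hasFDerivAt (x := F y)
    exact this.comp y h3
  rw [h4.fderiv_eq, h5.fderiv, LinearMap.trace_eq_sum_inner _ (EuclideanSpace.basisFun (Fin n) ℝ)]
  refine Finset.sum_congr rfl fun i _ => ?_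
  simp [real_inner_comm]

/-- At a local minimum the gradient vanishes and the Laplacian is nonnegative. -/
lemma nonneg_of_isLocalMin (hf : HasLap f y g L) (hm : IsLocalMin f y) : g = 0 ∧ 0 ≤ L := by
  obtain ⟨F, H, h1, rfl, h3, rfl⟩ := hf
  have hg : F y = 0 := by
    have := hm.hasFDerivAt_eq_zero h1.self_of_nhds
    have h := congrArg (fun φ => φ (F y)) this
    simpa using h
  refine ⟨hg, ?_⟩
  rw [LinearMap.trace_eq_sum_inner _ (EuclideanSpace.basisFun (Fin n) ℝ)]
  refine Finset.sum_nonneg fun i _ => ?_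
  set w : Euc n := EuclideanSpace.basisFun (Fin n) ℝ i with hw
  by_contra hneg
  push Not at hneg
  set q : ℝ → ℝ := fun t => f (y + t • w) with hq
  have hline : ∀ t : ℝ, HasDerivAt (fun t : ℝ => y + t • w) w t := by
    intro t
    simpa using ((hasDerivAt_id t).smul_const w).const_add y
  have hcont : ContinuousAt (fun t : ℝ => y + t • w) 0 := (hline 0).continuousAt
  have hev : ∀ᶠ t in 𝓝 (0 : ℝ), HasDerivAt q (inner ℝ (F (y + t • w)) w) t := by
    have : ∀ᶠ z in 𝓝 (y + (0 : ℝ) • w), HasFDerivAt f (innerSL ℝ (F z)) z := by simpa using h1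
    filter_upwards [hcont.eventually this] with t ht
    have := ht.comp_hasDerivAt t (hline t)
    exact this
  have hq2 : HasDerivAt (fun t : ℝ => (inner ℝ (F (y + t • w)) w : ℝ)) (inner ℝ (H w) w) 0 := by
    have h3' : HasFDerivAt F H (y + (0 : ℝ) • w) := by simpa using h3
    have := (h3'.comp_hasDerivAt (0 : ℝ) (hline 0))
    simpa using this.inner ℝ (hasDerivAt_const (0 : ℝ) w)
  have hdq : deriv q =ᶠ[𝓝 0] fun t : ℝ => (inner ℝ (F (y + t • w)) w : ℝ) := by
    filter_upwards [hev] with t ht using ht.deriv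
  have hq0 : deriv q 0 = 0 := by
    rw [hdq.self_of_nhds]; simp [hg]
  have hdd : deriv (deriv q) 0 < 0 := by
    rw [hdq.deriv_eq, hq2.deriv]
    rw [real_inner_comm]
    simpa using hneg
  -- strict local maximum along the line
  have hsgn := eventually_nhdsWithin_sign_eq_of_deriv_neg hdd hq0
  have hmq : IsLocalMin q 0 := by
    have : ∀ᶠ z in 𝓝 (y + (0 : ℝ) • w), f y ≤ f z := by
      rw [zero_smul, add_zero]; exact hm
    filter_upwards [hcont.eventually this] with t ht
    simpa only [hq, zero_smul, add_zero] using ht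
  obtain ⟨ε, hε, hball⟩ := Metric.eventually_nhds_iff.1 ((hev.and hmq).and hsgn)
  have hanti : StrictAntiOn q (Icc 0 (ε / 2)) := by
    refine strictAntiOn_of_deriv_neg (convex_Icc _ _) (fun t ht => ?_) fun t ht => ?_
    · have := (hball (y := t) (by
        rw [Real.dist_eq, sub_zero, abs_of_nonneg ht.1]; linarith [ht.2])).1.1
      exact this.continuousAt.continuousWithinAt
    · rw [interior_Icc] at ht
      have := (hball (y := t) (by
        rw [Real.dist_eq, sub_zero, abs_of_pos ht.1]; linarith [ht.2])).2
      rw [sign_neg (by linarith [ht.1] : (0 : ℝ) - t < 0)] at this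
      exact sign_eq_neg_one_iff.1 this
  have h5 := hanti (left_mem_Icc.2 (by positivity)) (right_mem_Icc.2 (by positivity))
    (by positivity : (0 : ℝ) < ε / 2)
  have h6 := (hball (y := ε / 2) (by
    rw [Real.dist_eq, sub_zero, abs_of_pos (by positivity)]; linarith)).1.2
  exact absurd h5 (not_lt.2 h6)

end HasLap

lemma hasFDerivAt_const_div_norm_sq {n : ℕ} {z : Euc n} (hz : z ≠ 0) (c : ℝ) :
    HasFDerivAt (fun z : Euc n => c / ‖z‖ ^ 2) (-(2 * c / (‖z‖ ^ 2) ^ 2) • innerSL ℝ z) z := by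
  have hs : ‖z‖ ^ 2 ≠ 0 := by positivity
  have h1 := (HasLap.norm_sq z).hasFDerivAt
  have h2 : HasDerivAt (fun t : ℝ => c / t) (-c / (‖z‖ ^ 2) ^ 2) (‖z‖ ^ 2) := by
    simpa using (hasDerivAt_const (‖z‖ ^ 2) c).fun_div (hasDerivAt_id (‖z‖ ^ 2)) hs
  have := h2.comp_hasFDerivAt z h1
  refine this.congr_fderiv ?_
  ext v; simp; ring

lemma hasFDerivAt_inv_smul {n : ℕ} {z : Euc n} (hz : z ≠ 0) (l : ℝ) :
    HasFDerivAt (fun z : Euc n => (l ^ 2 / ‖z‖ ^ 2) • z)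
      ((l ^ 2 / ‖z‖ ^ 2) • ContinuousLinearMap.id ℝ (Euc n)
        - (2 * l ^ 2 / (‖z‖ ^ 2) ^ 2) • (innerSL ℝ z).smulRight z) z := by
  have := (hasFDerivAt_const_div_norm_sq hz (l ^ 2)).smul (hasFDerivAt_id z)
  refine this.congr_fderiv ?_
  ext v; simp; ring

namespace HasLap

variable {n : ℕ} {f : Euc n → ℝ} {y g : Euc n} {L : ℝ}

lemma comp_inversion (l : ℝ) (hl : 0 < l) (hy : y ≠ 0)
    (hf : HasLap f ((l ^ 2 / ‖y‖ ^ 2) • y) g L) :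
    HasLap (fun z => f ((l ^ 2 / ‖z‖ ^ 2) • z)) y
      ((l ^ 2 / ‖y‖ ^ 2) • g - (2 * l ^ 2 / (‖y‖ ^ 2) ^ 2 * inner ℝ y g) • y)
      ((l ^ 2 / ‖y‖ ^ 2) ^ 2 * L
        - 2 * (n - 2) * (l ^ 2 / ‖y‖ ^ 2) * (inner ℝ y g / ‖y‖ ^ 2)) := by
  obtain ⟨F, H, h1, rfl, h3, rfl⟩ := hf
  have hs : ‖y‖ ^ 2 ≠ 0 := by positivity
  have hΦ := hasFDerivAt_inv_smul hy l
  set D := ((l ^ 2 / ‖y‖ ^ 2) • ContinuousLinearMap.id ℝ (Euc n)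
        - (2 * l ^ 2 / (‖y‖ ^ 2) ^ 2) • (innerSL ℝ y).smulRight y) with hD
  set G : Euc n → Euc n := fun z => F ((l ^ 2 / ‖z‖ ^ 2) • z) with hG
  have hGd : HasFDerivAt G (H.comp D) y := HasFDerivAt.comp y h3 hΦ
  set w := F ((l ^ 2 / ‖y‖ ^ 2) • y) with hw
  set s := ‖y‖ ^ 2 with hsdef
  have hin : HasFDerivAt (fun z => (inner ℝ z (G z) : ℝ))
      (innerSL ℝ w + (innerSL ℝ y).comp (H.comp D)) y := by
    have := (hasFDerivAt_id y).inner ℝ hGd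
    refine this.congr_fderiv ?_
    ext v
    simp [real_inner_comm w v, hG, ← hw, ← hsdef]
    ring
  have hb : HasFDerivAt (fun z : Euc n => 2 * l ^ 2 / (‖z‖ ^ 2) ^ 2)
      (-(8 * l ^ 2 / s ^ 3) • innerSL ℝ y) y := by
    have h1 := (HasLap.norm_sq y).hasFDerivAt
    have h2 : HasDerivAt (fun t : ℝ => 2 * l ^ 2 / t ^ 2) (-(4 * l ^ 2) / s ^ 3) s := by
      have := (hasDerivAt_const s (2 * l ^ 2)).fun_div (hasDerivAt_pow 2 s) (pow_ne_zero 2 hs)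
      refine this.congr_deriv ?_
      field_simp
      norm_num
      ring
    have := h2.comp_hasFDerivAt y h1
    refine this.congr_fderiv ?_
    ext v; simp; ring
  have hW := ((hasFDerivAt_const_div_norm_sq hy (l ^ 2)).smul hGd).sub
    ((hb.mul hin).smul (hasFDerivAt_id y))
  refine ⟨fun z => (l ^ 2 / ‖z‖ ^ 2) • G z - (2 * l ^ 2 / (‖z‖ ^ 2) ^ 2 * inner ℝ z (G z)) • z,
    (l ^ 2 / s) • H.comp D + (-(2 * l ^ 2 / s ^ 2) • innerSL ℝ y).smulRight w
      - (((2 * l ^ 2 / s ^ 2) • (innerSL ℝ w + (innerSL ℝ y).comp (H.comp D))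
        + (inner ℝ y w) • (-(8 * l ^ 2 / s ^ 3) • innerSL ℝ y)).smulRight y
        + (2 * l ^ 2 / s ^ 2 * inner ℝ y w) • ContinuousLinearMap.id ℝ (Euc n)), ?_, rfl, ?_, ?_⟩
  · have hev : ∀ᶠ z in 𝓝 y, z ≠ 0 := isOpen_ne.eventually_mem hy
    filter_upwards [hΦ.continuousAt.eventually h1, hev] with z hz hz0
    have := HasFDerivAt.comp (f := fun z : Euc n => (l ^ 2 / ‖z‖ ^ 2) • z) z hz
      (hasFDerivAt_inv_smul hz0 l)
    refine this.congr_fderiv ?_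
    ext v
    simp [hG, real_inner_comm z]
    ring
  · refine hW.congr_fderiv ?_
    ext v
    simp [hG, ← hw, ← hsdef]
    ring
  · have hyy : (inner ℝ y y : ℝ) = s := real_inner_self_eq_norm_sq y
    have hDy : D y = -(l ^ 2 / s) • y := by
      simp only [hD, _root_.sub_apply, _root_.smul_apply,
        ContinuousLinearMap.id_apply, ContinuousLinearMap.smulRight_apply, innerSL_apply_apply, hyy,
        smul_smul, ← sub_smul]
      congr 1; field_simp; ring
    have hHD : LinearMap.trace ℝ (Euc n) ((H.comp D : Euc n →L[ℝ] Euc n) : Euc n →ₗ[ℝ] Euc n)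
        = (l ^ 2 / s) * LinearMap.trace ℝ (Euc n) (H : Euc n →ₗ[ℝ] Euc n)
          - 2 * l ^ 2 / s ^ 2 * inner ℝ y (H y) := by
      have : H.comp D = (l ^ 2 / s) • H
          - (2 * l ^ 2 / s ^ 2) • (innerSL ℝ y).smulRight (H y) := by
        ext v
        simp [hD]
      rw [this]
      simp only [ContinuousLinearMap.toLinearMap_sub, ContinuousLinearMap.toLinearMap_smul,
        map_sub, map_smul, trace_smulRight_clm, smul_eq_mul, innerSL_apply_apply]
    simp only [ContinuousLinearMap.toLinearMap_sub, ContinuousLinearMap.toLinearMap_add,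
      ContinuousLinearMap.toLinearMap_smul, map_sub, map_add, map_smul, trace_smulRight_clm,
      smul_eq_mul, hHD, _root_.add_apply, _root_.smul_apply,
      ContinuousLinearMap.comp_apply, innerSL_apply_apply, hDy, hyy, ContinuousLinearMap.coe_id,
      LinearMap.trace_id, finrank_euclideanSpace, Fintype.card_fin, real_inner_comm y w]
    field_simp
    ring

end HasLap

/-- The Kelvin transform with respect to the sphere of radius `l`. -/
def kelvin {n : ℕ} (l : ℝ) (V : Euc n → ℝ) (y : Euc n) : ℝ :=
  (l ^ 2 / ‖y‖ ^ 2) ^ (((n : ℝ) - 2) / 2) * V ((l ^ 2 / ‖y‖ ^ 2) • y)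

lemma HasLap.kelvin {n : ℕ} {f : Euc n → ℝ} {y g : Euc n} {L : ℝ} (l : ℝ) (hl : 0 < l)
    (hy : y ≠ 0) (hf : HasLap f ((l ^ 2 / ‖y‖ ^ 2) • y) g L) :
    HasLap (kelvin l f) y
      ((l ^ 2 / ‖y‖ ^ 2) ^ (((n : ℝ) - 2) / 2) •
        ((l ^ 2 / ‖y‖ ^ 2) • g - (2 * l ^ 2 / (‖y‖ ^ 2) ^ 2 * inner ℝ y g) • y
        - ((n - 2) / ‖y‖ ^ 2 * f ((l ^ 2 / ‖y‖ ^ 2) • y)) • y))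
      ((l ^ 2 / ‖y‖ ^ 2) ^ (((n : ℝ) + 2) / 2) * L) := by
  have hs : 0 < ‖y‖ ^ 2 := by positivity
  have h1 := hf.comp_inversion l hl hy
  have h2 : HasLap (fun z : Euc n => l ^ 2 / ‖z‖ ^ 2) y (-(2 * l ^ 2 / (‖y‖ ^ 2) ^ 2) • y)
      ((8 - 2 * n) * l ^ 2 / (‖y‖ ^ 2) ^ 2) := by
    have := ((HasLap.norm_sq y).rpow (-1) hs).const_mul (l ^ 2)
    have hr : ∀ z : Euc n, l ^ 2 * (‖z‖ ^ 2) ^ (-1 : ℝ) = l ^ 2 / ‖z‖ ^ 2 := by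
      intro z; rw [Real.rpow_neg_one]; rfl
    simp only [hr] at this
    have e2 : (‖y‖ ^ 2) ^ (-1 - 1 : ℝ) = 1 / (‖y‖ ^ 2) ^ 2 := by
      rw [show (-1 - 1 : ℝ) = -(2 : ℕ) by norm_num, Real.rpow_neg hs.le, Real.rpow_natCast, one_div]
    have e3 : (‖y‖ ^ 2) ^ (-1 - 2 : ℝ) = 1 / (‖y‖ ^ 2) ^ 3 := by
      rw [show (-1 - 2 : ℝ) = -(3 : ℕ) by norm_num, Real.rpow_neg hs.le, Real.rpow_natCast, one_div]
    convert this using 1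
    · rw [e2, smul_smul, smul_smul]; congr 1; ring
    · rw [e2, e3, norm_smul, mul_pow]; field_simp; norm_num; ring
  have ha : 0 < l ^ 2 / ‖y‖ ^ 2 := by positivity
  have h3 := (h2.rpow (((n : ℝ) - 2) / 2) ha).mul h1
  have hP1 : (l ^ 2 / ‖y‖ ^ 2) ^ (((n : ℝ) - 2) / 2 - 1)
      = (l ^ 2 / ‖y‖ ^ 2) ^ (((n : ℝ) - 2) / 2) / (l ^ 2 / ‖y‖ ^ 2) := Real.rpow_sub_one ha.ne' _
  have hP2 : (l ^ 2 / ‖y‖ ^ 2) ^ (((n : ℝ) - 2) / 2 - 2)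
      = (l ^ 2 / ‖y‖ ^ 2) ^ (((n : ℝ) - 2) / 2) / (l ^ 2 / ‖y‖ ^ 2) ^ 2 := by
    rw [Real.rpow_sub ha, Real.rpow_two]
  have hP3 : (l ^ 2 / ‖y‖ ^ 2) ^ (((n : ℝ) + 2) / 2)
      = (l ^ 2 / ‖y‖ ^ 2) ^ (((n : ℝ) - 2) / 2) * (l ^ 2 / ‖y‖ ^ 2) ^ 2 := by
    rw [show ((n : ℝ) + 2) / 2 = ((n : ℝ) - 2) / 2 + 2 by ring, Real.rpow_add ha, Real.rpow_two]
  have hyy : (inner ℝ y y : ℝ) = ‖y‖ ^ 2 := real_inner_self_eq_norm_sq y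
  rw [hP1, hP2] at h3
  have hfun : _root_.kelvin l f
      = fun z => (l ^ 2 / ‖z‖ ^ 2) ^ (((n : ℝ) - 2) / 2) * f ((l ^ 2 / ‖z‖ ^ 2) • z) := rfl
  rw [hfun]
  convert h3 using 1
  · ext i
    simp
    field_simp
    ring
  · rw [hP3]
    simp only [inner_smul_left, inner_sub_right, inner_smul_right, hyy, norm_smul, mul_pow,
      Real.norm_eq_abs, sq_abs, conj_trivial]
    field_simp
    ring

def barD {n : ℕ} (l R : ℝ) (e y : Euc n) : ℝ := ‖y‖ ^ 2 + l ^ 2 - 2 * R * inner ℝ e y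

lemma barD_eq {n : ℕ} (l R : ℝ) {e : Euc n} (he : ‖e‖ = 1) (y : Euc n) :
    barD l R e y = ‖y - R • e‖ ^ 2 + (l ^ 2 - R ^ 2) := by
  rw [norm_sub_sq_real, inner_smul_right, norm_smul, he, real_inner_comm, barD]
  simp; ring

lemma HasLap.norm_sq_add {n : ℕ} (c : ℝ) (y : Euc n) :
    HasLap (fun z => ‖z‖ ^ 2 + c) y ((2 : ℝ) • y) (2 * n) := by
  simpa using (HasLap.norm_sq y).add (HasLap.const c y)

lemma hasLap_barD {n : ℕ} (l R : ℝ) (e y : Euc n) :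
    HasLap (barD l R e) y ((2 : ℝ) • y - (2 * R) • e) (2 * n) := by
  have := (HasLap.norm_sq_add (l ^ 2) y).sub ((HasLap.linear e y).const_mul (2 * R))
  rw [mul_zero, sub_zero] at this
  exact this

lemma hasLap_bar1 {n : ℕ} {l R : ℝ} (hl : 0 < l) {e : Euc n} (he : ‖e‖ = 1) (y : Euc n)
    (hD : 0 < barD l R e y) :
    ∃ L, HasLap (fun z => (‖z‖ ^ 2 - l ^ 2) * (barD l R e z ^ (-((n : ℝ) / 2)) *
        (2 - barD l R e z / (‖z‖ ^ 2 + l ^ 2)))) y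
      ((‖y‖ ^ 2 - l ^ 2) •
        (barD l R e y ^ (-((n : ℝ) / 2)) •
          ((barD l R e y / (‖y‖ ^ 2 + l ^ 2) ^ 2) • (2 : ℝ) • y
            - (1 / (‖y‖ ^ 2 + l ^ 2)) • ((2 : ℝ) • y - (2 * R) • e)) +
        (2 - barD l R e y / (‖y‖ ^ 2 + l ^ 2)) •
          (-((n : ℝ) / 2) * (barD l R e y ^ (-((n : ℝ) / 2)) / barD l R e y)) •
            ((2 : ℝ) • y - (2 * R) • e)) +
        (barD l R e y ^ (-((n : ℝ) / 2)) * (2 - barD l R e y / (‖y‖ ^ 2 + l ^ 2))) •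
          (2 : ℝ) • y) L ∧
      L + n * (n + 2) * (l ^ 2 - R ^ 2) / barD l R e y ^ 2 * ((‖y‖ ^ 2 - l ^ 2) *
        (barD l R e y ^ (-((n : ℝ) / 2)) * (2 - barD l R e y / (‖y‖ ^ 2 + l ^ 2))))
      = (‖y‖ ^ 2 - l ^ 2) * barD l R e y ^ (-((n : ℝ) / 2)) *
        (4 * (n - 2) * l ^ 2 / (‖y‖ ^ 2 + l ^ 2) ^ 2
          + 8 * l ^ 2 * barD l R e y / (‖y‖ ^ 2 + l ^ 2) ^ 3
          - 4 * n * (l ^ 2 - R ^ 2) / ((‖y‖ ^ 2 + l ^ 2) * barD l R e y)) := by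
  have hS : 0 < ‖y‖ ^ 2 + l ^ 2 := by positivity
  have h1 := hasLap_barD l R e y
  have hs2 := (HasLap.norm_sq_add (l ^ 2) y).rpow (-1) hS
  have h3 := (HasLap.const 2 y).sub (h1.mul hs2)
  have h4 := (h1.rpow (-((n : ℝ) / 2)) hD).mul h3
  have h0 : HasLap (fun z => ‖z‖ ^ 2 - l ^ 2) y ((2 : ℝ) • y) (2 * n) := by
    simpa [sub_eq_add_neg] using HasLap.norm_sq_add (-l ^ 2) y
  have h5 := h0.mul h4
  have hr : ∀ z : Euc n, barD l R e z * (‖z‖ ^ 2 + l ^ 2) ^ (-1 : ℝ)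
      = barD l R e z / (‖z‖ ^ 2 + l ^ 2) := by
    intro z; rw [Real.rpow_neg_one]; rfl
  have e2 : (‖y‖ ^ 2 + l ^ 2) ^ (-1 - 1 : ℝ) = 1 / (‖y‖ ^ 2 + l ^ 2) ^ 2 := by
    rw [show (-1 - 1 : ℝ) = -(2 : ℕ) by norm_num, Real.rpow_neg hS.le, Real.rpow_natCast, one_div]
  have e3 : (‖y‖ ^ 2 + l ^ 2) ^ (-1 - 2 : ℝ) = 1 / (‖y‖ ^ 2 + l ^ 2) ^ 3 := by
    rw [show (-1 - 2 : ℝ) = -(3 : ℕ) by norm_num, Real.rpow_neg hS.le, Real.rpow_natCast, one_div]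
  have e1 : (‖y‖ ^ 2 + l ^ 2) ^ (-1 : ℝ) = 1 / (‖y‖ ^ 2 + l ^ 2) := by
    rw [Real.rpow_neg_one, one_div]
  have d1 : barD l R e y ^ (-((n : ℝ) / 2) - 1) = barD l R e y ^ (-((n : ℝ) / 2)) / barD l R e y :=
    Real.rpow_sub_one hD.ne' _
  have d2 : barD l R e y ^ (-((n : ℝ) / 2) - 2)
      = barD l R e y ^ (-((n : ℝ) / 2)) / barD l R e y ^ 2 := by
    rw [Real.rpow_sub hD, Real.rpow_two]
  simp only [hr] at h5
  rw [e1, e2, e3, d1, d2] at h5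
  have hgrad : ∀ {g g' : Euc n} {h : Euc n → ℝ} {L : ℝ}, HasLap h y g L → g' = g →
      HasLap h y g' L := fun hh hg => hg ▸ hh
  refine ⟨_, hgrad h5 ?_, ?_⟩
  · ext i
    simp
    field_simp
    ring
  · have hnD : ‖(2 : ℝ) • y - (2 * R) • e‖ ^ 2 = 4 * (barD l R e y - (l ^ 2 - R ^ 2)) := by
      rw [barD_eq l R he, mul_smul, ← smul_sub, norm_smul, mul_pow]; norm_num
    have hyy : (inner ℝ y y : ℝ) = ‖y‖ ^ 2 := real_inner_self_eq_norm_sq y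
    have hye : 2 * R * (inner ℝ y e : ℝ) = ‖y‖ ^ 2 + l ^ 2 - barD l R e y := by
      rw [barD, real_inner_comm]; ring
    have hn2 : ‖(2 : ℝ) • y‖ ^ 2 = 4 * ‖y‖ ^ 2 := by rw [norm_smul, mul_pow]; norm_num
    have hyD : (inner ℝ y ((2 : ℝ) • y - (2 * R) • e) : ℝ) = ‖y‖ ^ 2 - l ^ 2 + barD l R e y := by
      rw [inner_sub_right, inner_smul_right, inner_smul_right, hyy, hye]; ring
    rw [hnD, hn2]
    set w := (2 : ℝ) • y - (2 * R) • e with hw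
    have hyD' : (inner ℝ w y : ℝ) = ‖y‖ ^ 2 - l ^ 2 + barD l R e y := by
      rw [real_inner_comm, hyD]
    have hww : (inner ℝ w w : ℝ) = 4 * (barD l R e y - (l ^ 2 - R ^ 2)) := by
      rw [real_inner_self_eq_norm_sq, hnD]
    simp only [inner_smul_left, inner_smul_right, inner_add_right, inner_sub_right,
      inner_zero_right, conj_trivial, hyD, hyD', hww, hyy]
    field_simp
    ring

lemma rpow_neg_half_le {n : ℕ} {a D : ℝ} (ha : 0 < a) (h : a ^ 2 ≤ D) :
    D ^ (-((n : ℝ) / 2)) ≤ (a ^ n)⁻¹ := by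
  have h1 : (a ^ n)⁻¹ = (a ^ 2) ^ (-((n : ℝ) / 2)) := by
    rw [← Real.rpow_natCast a 2, ← Real.rpow_mul ha.le, ← Real.rpow_natCast, ← Real.rpow_neg ha.le]
    congr 1; push_cast; ring
  rw [h1]
  exact Real.rpow_le_rpow_of_nonpos (by positivity) h (by simp; positivity)

lemma le_rpow_neg_half {n : ℕ} {a D : ℝ} (ha : 0 < a) (hD : 0 < D) (h : D ≤ a ^ 2) :
    (a ^ n)⁻¹ ≤ D ^ (-((n : ℝ) / 2)) := by
  have h1 : (a ^ n)⁻¹ = (a ^ 2) ^ (-((n : ℝ) / 2)) := by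
    rw [← Real.rpow_natCast a 2, ← Real.rpow_mul ha.le, ← Real.rpow_natCast, ← Real.rpow_neg ha.le]
    congr 1; push_cast; ring
  rw [h1]
  exact Real.rpow_le_rpow_of_nonpos hD h (by simp; positivity)

/-- The polynomial in `s = ‖y‖²` governing the Laplacian of `(‖y‖²-l²)(‖y‖² + 2 l²)^{-(n+1)/2}`. -/
def bar2Poly (n : ℕ) (l s : ℝ) : ℝ :=
  (n - 1) * s ^ 2 - (8 + (n + 1) * (2 * n + 3)) * l ^ 2 * s + (8 * n + 2 * n * (n + 1)) * l ^ 4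

lemma hasLap_bar2 {n : ℕ} {l : ℝ} (hl : 0 < l) (y : Euc n) :
    HasLap (fun z => (‖z‖ ^ 2 - l ^ 2) * (‖z‖ ^ 2 + 2 * l ^ 2) ^ (-(((n + 1 : ℕ) : ℝ) / 2))) y
      ((2 * (‖y‖ ^ 2 + 2 * l ^ 2) ^ (-(((n + 1 : ℕ) : ℝ) / 2)) *
        (1 - (n + 1) / 2 * (‖y‖ ^ 2 - l ^ 2) / (‖y‖ ^ 2 + 2 * l ^ 2))) • y)
      ((‖y‖ ^ 2 + 2 * l ^ 2) ^ (-(((n + 1 : ℕ) : ℝ) / 2)) / (‖y‖ ^ 2 + 2 * l ^ 2) ^ 2 *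
        bar2Poly n l (‖y‖ ^ 2)) := by
  have hE : 0 < ‖y‖ ^ 2 + 2 * l ^ 2 := by positivity
  have h0 : HasLap (fun z => ‖z‖ ^ 2 - l ^ 2) y ((2 : ℝ) • y) (2 * n) := by
    simpa [sub_eq_add_neg] using HasLap.norm_sq_add (-l ^ 2) y
  have h1 := h0.mul ((HasLap.norm_sq_add (2 * l ^ 2) y).rpow (-(((n + 1 : ℕ) : ℝ) / 2)) hE)
  rw [Real.rpow_sub_one hE.ne', Real.rpow_sub hE, Real.rpow_two] at h1
  have hn2 : ‖(2 : ℝ) • y‖ ^ 2 = 4 * ‖y‖ ^ 2 := by rw [norm_smul, mul_pow]; norm_num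
  have hyy : (inner ℝ y y : ℝ) = ‖y‖ ^ 2 := real_inner_self_eq_norm_sq y
  convert h1 using 1
  · ext i
    simp
    field_simp
    ring
  · rw [hn2]
    simp only [inner_smul_left, inner_smul_right, hyy, conj_trivial, bar2Poly]
    push_cast
    field_simp
    ring

lemma hasLap_bar3 {n : ℕ} (l : ℝ) {y : Euc n} (hy : y ≠ 0) :
    HasLap (fun z => 1 - l / ‖z‖) y ((l / ‖y‖ ^ 3) • y) (l * (n - 3) / ‖y‖ ^ 3) := by
  have hs : 0 < ‖y‖ ^ 2 := by positivity
  have h1 := (HasLap.const 1 y).sub (((HasLap.norm_sq y).rpow (-(1 / 2)) hs).const_mul l)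
  have hr : ∀ z : Euc n, l * (‖z‖ ^ 2) ^ (-(1 / 2) : ℝ) = l / ‖z‖ := by
    intro z
    rw [Real.rpow_neg (by positivity), ← Real.sqrt_eq_rpow, Real.sqrt_sq (norm_nonneg z)]; rfl
  have h2 : (‖y‖ ^ 2) ^ (-(1 / 2) : ℝ) = 1 / ‖y‖ := by
    rw [Real.rpow_neg (by positivity), ← Real.sqrt_eq_rpow, Real.sqrt_sq (norm_nonneg y), one_div]
  simp only [hr] at h1
  rw [Real.rpow_sub_one hs.ne', Real.rpow_sub hs, Real.rpow_two, h2] at h1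
  have hn2 : ‖(2 : ℝ) • y‖ ^ 2 = 4 * ‖y‖ ^ 2 := by rw [norm_smul, mul_pow]; norm_num
  have hy0 : ‖y‖ ≠ 0 := by positivity
  convert h1 using 1
  · ext i
    simp
    field_simp
  · rw [hn2]
    field_simp
    ring

def coreC (n : ℕ) : ℝ := 8 + (n + 1) * (2 * n + 3)

def coreA2 (n : ℕ) : ℝ := 2 ^ (n + 5) * (5 * 2 ^ n + 1)

set_option maxHeartbeats 800000 in
lemma core_ineq {n : ℕ} (hn : 4 ≤ n) {l R r X D P Q : ℝ} (hR : 2 ≤ R)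
    (hRC : 192 * coreC n ≤ R ^ 2) (hRA : 128 * 2 ^ n * coreA2 n * coreC n ≤ R ^ 2)
    (hm1 : 1 / 2 ≤ l ^ 2 - R ^ 2) (hm2 : l ^ 2 - R ^ 2 ≤ 2) (hl : 0 < l) (hlr : l ≤ r)
    (hX : |X| ≤ r) (hD : D = r ^ 2 + l ^ 2 - 2 * R * X) (hP : P = D ^ (-((n : ℝ) / 2)))
    (hQ : Q = (r ^ 2 + 2 * l ^ 2) ^ (-(((n + 1 : ℕ) : ℝ) / 2))) :
    (r ^ 2 - l ^ 2) * (2 ^ (n + 4) * r ^ (n + 3))⁻¹ ≤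
      R / (32 * n) * ((r ^ 2 - l ^ 2) * P *
        (4 * (n - 2) * l ^ 2 / (r ^ 2 + l ^ 2) ^ 2
          + 8 * l ^ 2 * D / (r ^ 2 + l ^ 2) ^ 3
          - 4 * n * (l ^ 2 - R ^ 2) / ((r ^ 2 + l ^ 2) * D)))
      + coreA2 n * (Q / (r ^ 2 + 2 * l ^ 2) ^ 2 * bar2Poly n l (r ^ 2)
        + n * (n + 2) * (l ^ 2 - R ^ 2) / D ^ 2 * ((r ^ 2 - l ^ 2) * Q))
      + (r ^ 2 - l ^ 2) / r ^ 2 * X * (P / D) := by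
  have hn' : (4 : ℝ) ≤ n := by exact_mod_cast hn
  have hr : 0 < r := hl.trans_le hlr
  have hRl : R ≤ l := by nlinarith
  have hRr : R ≤ r := hRl.trans hlr
  obtain ⟨hX1, hX2⟩ := abs_le.1 hX
  have hlr2 : l ^ 2 ≤ r ^ 2 := by gcongr
  have hDpos : 0 < D := by
    rw [hD]; nlinarith [sq_nonneg (r - R)]
  have hD4 : D ≤ (2 * r) ^ 2 := by rw [hD]; nlinarith
  have hPpos : 0 < P := by rw [hP]; positivity
  have hQpos : 0 < Q := by rw [hQ]; positivity
  have hPl : ((2 * r) ^ n)⁻¹ ≤ P := by rw [hP]; exact le_rpow_neg_half (by positivity) hDpos hD4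
  have hQl : ((2 * r) ^ (n + 1))⁻¹ ≤ Q := by
    rw [hQ]; exact le_rpow_neg_half (by positivity) (by positivity) (by nlinarith)
  have hQu : Q ≤ (r ^ (n + 1))⁻¹ := by
    rw [hQ]; exact rpow_neg_half_le (by positivity) (by nlinarith)
  have hA2 : 0 < coreA2 n := by unfold coreA2; positivity
  have hC : 1 ≤ coreC n := by unfold coreC; nlinarith
  set w := r ^ 2 - l ^ 2 with hw
  have hw0 : 0 ≤ w := by linarith
  set S := r ^ 2 + l ^ 2 with hS
  set E := r ^ 2 + 2 * l ^ 2 with hE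
  set m := l ^ 2 - R ^ 2 with hm
  have hSpos : 0 < S := by positivity
  have hEpos : 0 < E := by positivity
  set u := P / D with hu
  have hupos : 0 < u := by positivity
  have hPu : P = u * D := by rw [hu]; field_simp
  set h := P * (R * l ^ 2 / (32 * S ^ 2)) with hh
  -- the main positive term
  have hbr : 2 * h - u / (4 * r) ≤ R / (32 * n) * (P *
        (4 * (n - 2) * l ^ 2 / S ^ 2 + 8 * l ^ 2 * D / S ^ 3 - 4 * n * m / (S * D))) := by
    have e1 : R / (32 * n) * (P *
        (4 * (n - 2) * l ^ 2 / S ^ 2 + 8 * l ^ 2 * D / S ^ 3 - 4 * n * m / (S * D)))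
        = ((n - 2) / n * 2) * (2 * h) + R / (32 * n) * (P * (8 * l ^ 2 * D / S ^ 3))
          - u * (R * m / (8 * S)) := by
      rw [hh, hu]; field_simp; ring
    have e2 : 1 ≤ ((n : ℝ) - 2) / n * 2 := by
      rw [div_mul_eq_mul_div, le_div_iff₀ (by linarith)]; linarith
    have e3 : 0 ≤ R / (32 * n) * (P * (8 * l ^ 2 * D / S ^ 3)) := by positivity
    have e4 : R * m / (8 * S) ≤ 1 / (4 * r) := by
      rw [div_le_div_iff₀ (by positivity) (by positivity)]
      have t1 : R * r * m ≤ R * r * 2 := by gcongr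
      have t2 : R * r ≤ r * r := by gcongr
      have t3 : 0 ≤ l ^ 2 := by positivity
      rw [hS]; nlinarith
    have e5 : 0 < h := by positivity
    have e6 : u * (R * m / (8 * S)) ≤ u / (4 * r) := by
      calc _ ≤ u * (1 / (4 * r)) := by gcongr
        _ = _ := by ring
    rw [e1]
    have e7 := mul_le_mul_of_nonneg_right e2 (by linarith : 0 ≤ 2 * h)
    linarith
  have hu4 : (2 ^ (n + 4) * r ^ (n + 3))⁻¹ ≤ u / (4 * r) := by
    have e1 : (2 ^ (n + 4) * r ^ (n + 3))⁻¹ = ((2 * r) ^ n)⁻¹ / (2 * r) ^ 2 / (4 * r) := by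
      rw [mul_pow]; field_simp; ring
    rw [e1, hu]
    gcongr
  -- the term absorbing the negative part of the second barrier
  have habs : coreA2 n * (coreC n * l ^ 2 * (Q / E ^ 2)) ≤ h := by
    have e1 : Q / E ^ 2 ≤ (r ^ (n + 1))⁻¹ / (r ^ 2) ^ 2 := by
      gcongr; nlinarith
    have e2 : ((2 * r) ^ n)⁻¹ * (R * l ^ 2 / (32 * (2 * r ^ 2) ^ 2)) ≤ h := by
      rw [hh]; gcongr; linarith
    refine le_trans ?_ e2
    calc coreA2 n * (coreC n * l ^ 2 * (Q / E ^ 2))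
        ≤ coreA2 n * (coreC n * l ^ 2 * ((r ^ (n + 1))⁻¹ / (r ^ 2) ^ 2)) := by gcongr
      _ = (128 * 2 ^ n * coreA2 n * coreC n) * (l ^ 2 / (128 * 2 ^ n * r ^ (n + 5))) := by
          field_simp; ring
      _ ≤ (R * r) * (l ^ 2 / (128 * 2 ^ n * r ^ (n + 5))) := by
          refine mul_le_mul_of_nonneg_right (hRA.trans ?_) (by positivity)
          rw [pow_two]; gcongr
      _ = _ := by rw [mul_pow]; field_simp; ring
  have hpoly1 : -(coreC n * l ^ 2) * w ≤ bar2Poly n l (r ^ 2) := by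
    unfold bar2Poly
    have t1 : 0 ≤ (n - 1) * (r ^ 2) ^ 2 + (5 * n - 11) * l ^ 4 := by
      have : 0 ≤ (n : ℝ) - 1 := by linarith
      have : 0 ≤ 5 * (n : ℝ) - 11 := by linarith
      positivity
    unfold coreC
    rw [hw]
    linarith only [t1]
  have hXu : ∀ c : ℝ, c * r ≤ X → c * (u / r) ≤ X / r ^ 2 * u := by
    intro c hc
    have : c * (u / r) = (c * r) / r ^ 2 * u := by field_simp
    rw [this]; gcongr
  have hdrop : 0 ≤ coreA2 n * (n * (n + 2) * m / D ^ 2 * (w * Q)) := by positivity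
  -- it suffices to bound the coefficient of `w`
  have key : ∀ q : ℝ, q * w ≤ Q / E ^ 2 * bar2Poly n l (r ^ 2) →
      (2 ^ (n + 4) * r ^ (n + 3))⁻¹ ≤ 2 * h - u / (4 * r) + coreA2 n * q + X / r ^ 2 * u →
      w * (2 ^ (n + 4) * r ^ (n + 3))⁻¹ ≤
      R / (32 * n) * (w * P *
        (4 * (n - 2) * l ^ 2 / S ^ 2 + 8 * l ^ 2 * D / S ^ 3 - 4 * n * m / (S * D)))
      + coreA2 n * (Q / E ^ 2 * bar2Poly n l (r ^ 2) + n * (n + 2) * m / D ^ 2 * (w * Q))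
      + w / r ^ 2 * X * u := by
    intro q hq h1
    have h2 := mul_le_mul_of_nonneg_left h1 hw0
    have h3 := mul_le_mul_of_nonneg_left hbr hw0
    have h4 := mul_le_mul_of_nonneg_left hq hA2.le
    have e1 : w / r ^ 2 * X * u = w * (X / r ^ 2 * u) := by ring
    rw [e1]
    clear_value w h u
    generalize 4 * (n - 2) * l ^ 2 / S ^ 2 + 8 * l ^ 2 * D / S ^ 3 - 4 * n * m / (S * D) = Z at *
    generalize n * (n + 2) * m / D ^ 2 * (w * Q) = Y at *
    generalize Q / E ^ 2 * bar2Poly n l (r ^ 2) = B at *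
    linarith only [h2, h3, h4, hdrop]
  have hq1 : -(coreC n * l ^ 2 * (Q / E ^ 2)) * w ≤ Q / E ^ 2 * bar2Poly n l (r ^ 2) := by
    have t1 := mul_le_mul_of_nonneg_left hpoly1 (by positivity : 0 ≤ Q / E ^ 2)
    linarith only [t1]
  rcases le_or_gt (r / 2) X with hXr | hXr
  · refine key _ hq1 ?_
    have h1 := hXu (1 / 2) (by linarith)
    have e1 : 1 / 2 * (u / r) = 2 * (u / (4 * r)) := by field_simp; norm_num
    have : 0 < h := by positivity
    linarith only [this, e1, h1, habs, hu4]
  · have h1 := hXu (-1) (by linarith)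
    have e1 : -1 * (u / r) = -(4 * (u / (4 * r))) := by field_simp
    have hDS : S / 2 ≤ D := by
      have t1 : R * X ≤ R * (r / 2) := by gcongr
      have t2 : R * r ≤ l * r := by gcongr
      have t3 := sq_nonneg (r - l)
      rw [hD, hS]; linarith only [t1, t2, t3]
    rcases le_or_gt (192 * r) (R * l ^ 2) with hrr | hrr
    · refine key _ hq1 ?_
      have h2 : 6 * (u / (4 * r)) ≤ h := by
        rw [hh, hPu]
        calc 6 * (u / (4 * r)) = u * (192 * r / (64 * (2 * r ^ 2))) := by field_simp; norm_num
          _ ≤ u * (R * l ^ 2 / (64 * (2 * r ^ 2))) := by gcongr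
          _ ≤ u * (R * l ^ 2 / (64 * S)) := by gcongr; linarith
          _ = u * ((S / 2) * (R * l ^ 2 / (32 * S ^ 2))) := by field_simp; norm_num
          _ ≤ u * (D * (R * l ^ 2 / (32 * S ^ 2))) := by gcongr
          _ = _ := by ring
      linarith only [h1, h2, e1, habs, hu4]
    · have hrC : coreC n * l ≤ r := by
        have t1 : R ^ 2 * l ≤ R * l ^ 2 := by
          have := mul_le_mul_of_nonneg_left hRl (by positivity : 0 ≤ R * l)
          linarith only [this]
        have t2 := mul_le_mul_of_nonneg_right hRC hl.le
        linarith only [t1, t2, hrr]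
      have hpoly2 : r ^ 2 * w ≤ bar2Poly n l (r ^ 2) := by
        have e1 : coreC n * l ^ 2 ≤ r ^ 2 := by
          have t1 := mul_le_mul hrC hlr hl.le hr.le
          linarith only [t1]
        unfold bar2Poly
        have e2 : (8 + (n + 1) * (2 * n + 3)) * l ^ 2 * r ^ 2 ≤ r ^ 2 * r ^ 2 := by
          have := mul_le_mul_of_nonneg_right e1 (sq_nonneg r)
          unfold coreC at this; linarith only [this]
        have e3 : 0 ≤ (n - 3) * (r ^ 2) ^ 2 := by
          have : 0 ≤ (n : ℝ) - 3 := by linarith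
          positivity
        have e4 : 0 ≤ (8 * n + 2 * n * (n + 1)) * l ^ 4 := by positivity
        have e5 : 0 ≤ r ^ 2 * l ^ 2 := by positivity
        rw [hw]; linarith only [e2, e3, e4, e5]
      have hq2 : (r ^ 2 * (Q / E ^ 2)) * w ≤ Q / E ^ 2 * bar2Poly n l (r ^ 2) := by
        have t1 := mul_le_mul_of_nonneg_left hpoly2 (by positivity : 0 ≤ Q / E ^ 2)
        linarith only [t1]
      refine key _ hq2 ?_
      have hC192 : 2 * l ≤ r := by
        have t1 : 8 ≤ coreC n := by unfold coreC; nlinarith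
        have t2 := mul_le_mul_of_nonneg_right t1 hl.le
        linarith only [t2, hrC, hl]
      have hDr : (r / 2) ^ 2 ≤ D := by
        have t1 : R * X ≤ R * (r / 2) := by gcongr
        have t2 : R * (r / 2) ≤ r / 2 * (r / 2) := by gcongr; linarith only [hRl, hC192]
        have t3 : 0 ≤ l ^ 2 := by positivity
        have t4 := sq_nonneg r
        rw [hD, hS]; linarith only [t1, t2, t3, t4]
      have hPu' : P ≤ ((r / 2) ^ n)⁻¹ := by
        rw [hP]; exact rpow_neg_half_le (by positivity) hDr
      have e2 : 5 * (u / (4 * r)) ≤ 5 * 2 ^ n * (r ^ (n + 3))⁻¹ := by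
        calc 5 * (u / (4 * r)) ≤ 5 * (((r / 2) ^ n)⁻¹ / (r / 2) ^ 2 / (4 * r)) := by
              rw [hu]; gcongr
          _ = _ := by rw [div_pow]; field_simp; ring
      have e3 : (5 * 2 ^ n + 1) * (r ^ (n + 3))⁻¹ ≤ coreA2 n * (r ^ 2 * (Q / E ^ 2)) := by
        calc (5 * 2 ^ n + 1) * (r ^ (n + 3))⁻¹
            = coreA2 n * (r ^ 2 * (((2 * r) ^ (n + 1))⁻¹ / (4 * r ^ 2) ^ 2)) := by
              unfold coreA2; rw [mul_pow]; field_simp; ring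
          _ ≤ _ := by gcongr; nlinarith
      have e4 : (2 ^ (n + 4) * r ^ (n + 3))⁻¹ ≤ (r ^ (n + 3))⁻¹ := by
        apply inv_anti₀ (by positivity)
        have : (1 : ℝ) ≤ 2 ^ (n + 4) := one_le_pow₀ (by norm_num)
        exact le_mul_of_one_le_left (by positivity) this
      have : 0 < h := by positivity
      linarith only [this, e1, e2, e3, e4, h1]

/-- The part of the annulus `a ≤ ‖y‖ ≤ b` lying above the level `-T` of the `j`-th coordinate. -/
def annulusAbove {n : ℕ} (j : Fin n) (a b T : ℝ) : Set (Euc n) :=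
  {y | a ≤ ‖y‖ ∧ ‖y‖ ≤ b ∧ -T ≤ y j}

lemma abs_coord_le_norm {n : ℕ} (y : Euc n) (j : Fin n) : |y j| ≤ ‖y‖ := by
  simpa using PiLp.norm_apply_le y j

lemma isCompact_annulusAbove {n : ℕ} (j : Fin n) (a b T : ℝ) :
    IsCompact (annulusAbove j a b T) := by
  refine (isCompact_closedBall (0 : Euc n) b).of_isClosed_subset ?_ ?_
  · refine (isClosed_le continuous_const continuous_norm).inter
      ((isClosed_le continuous_norm continuous_const).inter
        (isClosed_le continuous_const (by fun_prop : Continuous fun y : Euc n => y j)))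
  · intro y hy; simpa using hy.2.1

/-- A minimum over `annulusAbove` cannot lie off the two spheres if the function is strictly
superharmonic there, resp. decreasing along the normal if the point is on the flat part. -/
lemma not_isMinOn_annulusAbove {n : ℕ} {j : Fin n} {a b T : ℝ} {Z : Euc n → ℝ} {y : Euc n}
    (hy : y ∈ annulusAbove j a b T) (ha : a < ‖y‖) (hb : ‖y‖ < b)
    (hmin : ∀ z ∈ annulusAbove j a b T, Z y ≤ Z z)
    (hlap : -T < y j → ∃ g L, HasLap Z y g L ∧ L < 0)
    (hbot : y j = -T → ∃ᶠ t in 𝓝[>] (0 : ℝ), Z (y + t • EuclideanSpace.single j 1) < Z y) :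
    False := by
  have h1 : ∀ᶠ z in 𝓝 y, a < ‖z‖ ∧ ‖z‖ < b :=
    (continuous_norm.continuousAt.eventually (lt_mem_nhds ha)).and
      (continuous_norm.continuousAt.eventually (gt_mem_nhds hb))
  rcases hy.2.2.lt_or_eq with hT | hT
  · obtain ⟨g, L, hL, hL0⟩ := hlap hT
    have h2 : ∀ᶠ z in 𝓝 y, -T < z j :=
      (show Continuous fun z : Euc n => z j by fun_prop).continuousAt.eventually (lt_mem_nhds hT)
    have : IsLocalMin Z y := by
      filter_upwards [h1, h2] with z hz hz'
      exact hmin z ⟨hz.1.le, hz.2.le, hz'.le⟩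
    exact absurd (hL.nonneg_of_isLocalMin this).2 (not_le.2 hL0)
  · have hc : Tendsto (fun t : ℝ => y + t • EuclideanSpace.single j (1 : ℝ)) (𝓝[>] 0) (𝓝 y) := by
      have : Continuous (fun t : ℝ => y + t • EuclideanSpace.single j (1 : ℝ)) := by fun_prop
      have h := this.tendsto 0
      rw [zero_smul, add_zero] at h
      exact h.mono_left nhdsWithin_le_nhds
    obtain ⟨t, ht, ht', ht0⟩ := ((hbot hT.symm).and_eventually
      ((hc.eventually h1).and self_mem_nhdsWithin)).exists
    refine absurd (hmin _ ⟨ht'.1.le, ht'.2.le, ?_⟩) (not_le.2 ht)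
    have : (0 : ℝ) < t := ht0
    simp [← hT, this.le]

lemma nonneg_on_annulusAbove {n : ℕ} {j : Fin n} {a b T : ℝ} {Z : Euc n → ℝ}
    (hZ : ContinuousOn Z (annulusAbove j a b T))
    (ha : ∀ y ∈ annulusAbove j a b T, ‖y‖ = a → 0 ≤ Z y)
    (hb : ∀ y ∈ annulusAbove j a b T, ‖y‖ = b → 0 ≤ Z y)
    (hlap : ∀ y, a < ‖y‖ → ‖y‖ < b → -T < y j → Z y < 0 → ∃ g L, HasLap Z y g L ∧ L < 0)
    (hbot : ∀ y, a < ‖y‖ → ‖y‖ < b → y j = -T → Z y < 0 →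
      ∃ᶠ t in 𝓝[>] (0 : ℝ), Z (y + t • EuclideanSpace.single j 1) < Z y) :
    ∀ y ∈ annulusAbove j a b T, 0 ≤ Z y := by
  intro y hy
  obtain ⟨z, hz, hmin⟩ := (isCompact_annulusAbove j a b T).exists_isMinOn ⟨y, hy⟩ hZ
  refine le_trans ?_ (hmin hy)
  by_contra! hneg
  have h1 : a < ‖z‖ := hz.1.lt_of_ne fun h => (ha z hz h.symm).not_gt hneg
  have h2 : ‖z‖ < b := hz.2.1.lt_of_ne fun h => (hb z hz h).not_gt hneg
  exact not_isMinOn_annulusAbove hz h1 h2 (fun w hw => hmin hw)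
    (fun h => hlap z h1 h2 h hneg) (fun h => hbot z h1 h2 h hneg)

lemma kelvin_eq_self {n : ℕ} {l : ℝ} (hl : 0 < l) (V : Euc n → ℝ) {y : Euc n} (hy : ‖y‖ = l) :
    kelvin l V y = V y := by
  have : l ^ 2 / ‖y‖ ^ 2 = 1 := by rw [hy]; field_simp
  simp [kelvin, this]

lemma norm_inv_smul {n : ℕ} {l : ℝ} {y : Euc n} (hy : y ≠ 0) :
    ‖(l ^ 2 / ‖y‖ ^ 2) • y‖ = l ^ 2 / ‖y‖ := by
  have : 0 < ‖y‖ := norm_pos_iff.2 hy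
  rw [norm_smul, Real.norm_of_nonneg (by positivity)]
  field_simp

/-- Mean value form of `V - V^λ` along a ray, in logarithmic polar coordinates. -/
lemma sub_kelvin_eq {n : ℕ} {l : ℝ} (hl : 0 < l) {V : Euc n → ℝ} {y : Euc n} (hy : l < ‖y‖)
    (hV : ∀ s ∈ Icc (l ^ 2 / ‖y‖ ^ 2) 1, DifferentiableAt ℝ V (s • y)) :
    ∃ s ∈ Ioo (l ^ 2 / ‖y‖ ^ 2) 1, V y - kelvin l V y = 2 * Real.log (‖y‖ / l) *
      (s ^ (((n : ℝ) - 2) / 2) *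
        (((n : ℝ) - 2) / 2 * V (s • y) + fderiv ℝ V (s • y) (s • y))) := by
  have hr : 0 < ‖y‖ := hl.trans hy
  set q := l ^ 2 / ‖y‖ ^ 2 with hq
  have hq0 : 0 < q := by positivity
  have hq1 : q < 1 := by rw [hq, div_lt_one (by positivity)]; gcongr
  have hlog : Real.log q = -(2 * Real.log (‖y‖ / l)) := by
    rw [hq, ← div_pow, Real.log_pow, Real.log_div hl.ne' hr.ne', Real.log_div hr.ne' hl.ne']
    push_cast; ring
  set α := ((n : ℝ) - 2) / 2 with hα
  set h : ℝ → ℝ := fun t => Real.exp t ^ α * V (Real.exp t • y) with hh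
  have hd : ∀ t ∈ Icc (Real.log q) 0, HasDerivAt h
      (Real.exp t ^ α * (α * V (Real.exp t • y) +
        fderiv ℝ V (Real.exp t • y) (Real.exp t • y))) t := by
    intro t ht
    have h1 : Real.exp t ∈ Icc q 1 := by
      refine ⟨?_, ?_⟩
      · rw [← Real.exp_log hq0]; exact Real.exp_le_exp.2 ht.1
      · rw [← Real.exp_zero]; exact Real.exp_le_exp.2 ht.2
    have h2 : HasDerivAt (fun t : ℝ => Real.exp t • y) (Real.exp t • y) t :=
      (Real.hasDerivAt_exp t).smul_const y
    have h3 : HasDerivAt (fun t => V (Real.exp t • y))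
        (fderiv ℝ V (Real.exp t • y) (Real.exp t • y)) t :=
      (hV _ h1).hasFDerivAt.comp_hasDerivAt t h2
    have h4 : HasDerivAt (fun t => Real.exp t ^ α)
        (Real.exp t * α * Real.exp t ^ (α - 1)) t :=
      (Real.hasDerivAt_exp t).rpow_const (Or.inl (Real.exp_pos t).ne')
    refine (h4.mul h3).congr_deriv ?_
    rw [Real.rpow_sub_one (Real.exp_pos t).ne']
    field_simp
  have hlt : Real.log q < 0 := Real.log_neg hq0 hq1
  obtain ⟨t, ht, he⟩ := exists_hasDerivAt_eq_slope h _ hlt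
    (fun t ht => (hd t ht).continuousAt.continuousWithinAt)
    (fun t ht => hd t (Ioo_subset_Icc_self ht))
  refine ⟨Real.exp t, ⟨?_, ?_⟩, ?_⟩
  · rw [← Real.exp_log hq0]; exact Real.exp_lt_exp.2 ht.1
  · rw [← Real.exp_zero]; exact Real.exp_lt_exp.2 ht.2
  · rw [he]
    have h0 : h 0 = V y := by simp [hh]
    have h1 : h (Real.log q) = kelvin l V y := by
      simp only [hh, Real.exp_log hq0]; rfl
    rw [h0, h1]
    have : 2 * Real.log (‖y‖ / l) = 0 - Real.log q := by rw [hlog]; ring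
    rw [this]
    have : 0 - Real.log q ≠ 0 := by linarith
    field_simp

/-- The derivative of `t ↦ t ^ ((n-2)/2) V(t y)` at `t = 1`. -/
def radialDeriv {n : ℕ} (V : Euc n → ℝ) (y : Euc n) : ℝ :=
  ((n : ℝ) - 2) / 2 * V y + fderiv ℝ V y y

lemma exists_tendsto_radialDeriv {n : ℕ} {V : Euc n → ℝ} {l₀ : ℝ} {y₀ : Euc n} {l : ℕ → ℝ}
    {y : ℕ → Euc n} (hl₀ : 0 < l₀) (hy₀ : ‖y₀‖ = l₀) (hl : Tendsto l atTop (𝓝 l₀))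
    (hy : Tendsto y atTop (𝓝 y₀)) (hly : ∀ k, l k < ‖y k‖) (hV : ContDiffAt ℝ 2 V y₀) :
    ∃ P : ℕ → ℝ, Tendsto P atTop (𝓝 (radialDeriv V y₀)) ∧
      ∀ᶠ k in atTop, V (y k) - kelvin (l k) V (y k) = 2 * Real.log (‖y k‖ / l k) * P k := by
  have hev : ∀ᶠ z in 𝓝 y₀, ContDiffAt ℝ 2 V z := hV.eventually (by simp)
  have hcont : ContinuousAt (fun z => radialDeriv V z) y₀ := by
    have h1 : ContinuousAt (fderiv ℝ V) y₀ :=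
      (hV.fderiv_right (m := 1) (by norm_num [one_add_one_eq_two])).continuousAt
    exact (continuousAt_const.mul hV.continuousAt).add (h1.clm_apply continuousAt_id)
  have hyn : Tendsto (fun k => ‖y k‖) atTop (𝓝 l₀) := by rw [← hy₀]; exact hy.norm
  have hq : Tendsto (fun k => l k ^ 2 / ‖y k‖ ^ 2) atTop (𝓝 1) := by
    have := (hl.pow 2).div (hyn.pow 2) (by positivity)
    rwa [div_self (by positivity)] at this
  -- all the intermediate points lie in a neighbourhood of `y₀`
  obtain ⟨ε, hε, hball⟩ := Metric.eventually_nhds_iff.1 hev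
  have hclose : ∀ᶠ k in atTop, ∀ s ∈ Icc (l k ^ 2 / ‖y k‖ ^ 2) 1, dist (s • y k) y₀ < ε := by
    have hsm : Tendsto (fun k => (1 - l k ^ 2 / ‖y k‖ ^ 2) * ‖y k‖ + dist (y k) y₀)
        atTop (𝓝 ((1 - 1) * l₀ + dist y₀ y₀)) :=
      ((tendsto_const_nhds.sub hq).mul hyn).add (hy.dist tendsto_const_nhds)
    simp only [sub_self, zero_mul, dist_self, add_zero] at hsm
    filter_upwards [hsm.eventually (gt_mem_nhds hε)] with k hk s hs
    refine lt_of_le_of_lt ?_ hk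
    refine (dist_triangle (s • y k) (y k) y₀).trans (add_le_add ?_ le_rfl)
    have : s • y k - y k = (s - 1) • y k := by rw [sub_smul, one_smul]
    rw [dist_eq_norm, this, norm_smul, Real.norm_eq_abs, abs_of_nonpos (by linarith [hs.2])]
    gcongr
    linarith [hs.1]
  have hpos : ∀ᶠ k in atTop, 0 < l k := hl.eventually (lt_mem_nhds hl₀)
  have hex : ∀ᶠ k in atTop, ∃ s ∈ Ioo (l k ^ 2 / ‖y k‖ ^ 2) 1,
      V (y k) - kelvin (l k) V (y k) = 2 * Real.log (‖y k‖ / l k) *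
        (s ^ (((n : ℝ) - 2) / 2) * radialDeriv V (s • y k)) := by
    filter_upwards [hclose, hpos] with k hk hk'
    exact sub_kelvin_eq hk' (hly k) fun s hs => (hball (hk s hs)).differentiableAt (by simp)
  choose! s hs hs' using fun k (h : ∃ s ∈ Ioo (l k ^ 2 / ‖y k‖ ^ 2) 1,
      V (y k) - kelvin (l k) V (y k) = 2 * Real.log (‖y k‖ / l k) *
        (s ^ (((n : ℝ) - 2) / 2) * radialDeriv V (s • y k))) => h
  have hslim : Tendsto s atTop (𝓝 1) :=
    tendsto_of_tendsto_of_tendsto_of_le_of_le' hq tendsto_const_nhds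
      (hex.mono fun k hk => (hs k hk).1.le) (hex.mono fun k hk => (hs k hk).2.le)
  refine ⟨fun k => s k ^ (((n : ℝ) - 2) / 2) * radialDeriv V (s k • y k), ?_, hex.mono hs'⟩
  have h1 : Tendsto (fun k => s k • y k) atTop (𝓝 y₀) := by
    have := hslim.smul hy
    rwa [one_smul] at this
  have h2 : Tendsto (fun k => s k ^ (((n : ℝ) - 2) / 2)) atTop (𝓝 1) := by
    have := hslim.rpow_const (p := ((n : ℝ) - 2) / 2) (Or.inl one_ne_zero)
    rwa [Real.one_rpow] at this
  have := h2.mul (hcont.tendsto.comp h1)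
  rwa [one_mul] at this

/-- The comparison function `V - V^l - (‖y‖² - l²) G_l` of the moving sphere method. -/
def sphereDiff {n : ℕ} (V : Euc n → ℝ) (G : ℝ → Euc n → ℝ) (l : ℝ) (y : Euc n) : ℝ :=
  V y - kelvin l V y - (‖y‖ ^ 2 - l ^ 2) * G l y

lemma sphereDiff_eq_zero {n : ℕ} {l : ℝ} (hl : 0 < l) (V : Euc n → ℝ) (G : ℝ → Euc n → ℝ)
    {y : Euc n} (hy : ‖y‖ = l) : sphereDiff V G l y = 0 := by
  simp [sphereDiff, kelvin_eq_self hl V hy, hy]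

section Sweep

variable {n : ℕ} {j : Fin n} {a₀ a₁ b T : ℝ} {V : Euc n → ℝ} {G : ℝ → Euc n → ℝ}

lemma continuousOn_sphereDiff (h0 : 0 < a₀) (h1b : a₁ < b) (h1T : a₁ < T)
    (hVc : ContinuousOn V {y | ‖y‖ ≤ b ∧ -T ≤ y j})
    (hG : ContinuousOn (fun p : ℝ × Euc n => G p.1 p.2) (Icc a₀ a₁ ×ˢ {y | a₀ ≤ ‖y‖})) :
    ContinuousOn (fun p : ℝ × Euc n => sphereDiff V G p.1 p.2)
      {p | p.1 ∈ Icc a₀ a₁ ∧ p.1 ≤ ‖p.2‖ ∧ ‖p.2‖ ≤ b ∧ -T ≤ p.2 j} := by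
  set P := {p : ℝ × Euc n | p.1 ∈ Icc a₀ a₁ ∧ p.1 ≤ ‖p.2‖ ∧ ‖p.2‖ ≤ b ∧ -T ≤ p.2 j} with hP
  have hq : ContinuousOn (fun p : ℝ × Euc n => p.1 ^ 2 / ‖p.2‖ ^ 2) P := by
    refine ContinuousOn.div (by fun_prop) (by fun_prop) ?_
    intro p hp
    have : 0 < ‖p.2‖ := h0.trans_le (hp.1.1.trans hp.2.1)
    positivity
  have hV1 : ContinuousOn (fun p : ℝ × Euc n => V p.2) P :=
    hVc.comp (by fun_prop) fun p hp => hp.2.2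
  have hV2 : ContinuousOn (fun p : ℝ × Euc n => V ((p.1 ^ 2 / ‖p.2‖ ^ 2) • p.2)) P := by
    refine hVc.comp (hq.smul (by fun_prop)) ?_
    intro p hp
    have h2 : 0 < p.1 := h0.trans_le hp.1.1
    have h3 : 0 < ‖p.2‖ := h2.trans_le hp.2.1
    have h4 : ‖(p.1 ^ 2 / ‖p.2‖ ^ 2) • p.2‖ ≤ a₁ := by
      rw [norm_inv_smul (norm_pos_iff.1 h3)]
      refine le_trans ?_ hp.1.2
      rw [div_le_iff₀ h3, pow_two]
      exact mul_le_mul_of_nonneg_left hp.2.1 h2.le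
    have h5 := (abs_le.1 (abs_coord_le_norm ((p.1 ^ 2 / ‖p.2‖ ^ 2) • p.2) j)).1
    exact ⟨h4.trans h1b.le, by linarith⟩
  have hG' : ContinuousOn (fun p : ℝ × Euc n => G p.1 p.2) P :=
    hG.mono fun p hp => ⟨hp.1, hp.1.1.trans hp.2.1⟩
  have hq' : ContinuousOn (fun p : ℝ × Euc n => (p.1 ^ 2 / ‖p.2‖ ^ 2) ^ (((n : ℝ) - 2) / 2)) P := by
    refine hq.rpow_const fun p hp => Or.inl ?_
    have h2 : 0 < p.1 := h0.trans_le hp.1.1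
    have h3 : 0 < ‖p.2‖ := h2.trans_le hp.2.1
    positivity
  exact (hV1.sub (hq'.mul hV2)).sub (ContinuousOn.mul (by fun_prop) hG')

lemma hopf_sphereDiff (hn : 4 ≤ n) {l : ℝ} (hl : 0 < l) (hlb : l < b) (hlT : l < T)
    (hZc : ContinuousOn (sphereDiff V G l) (annulusAbove j l b T))
    (hVd : ∀ y, ‖y‖ < b → -T < y j → ContDiffAt ℝ 2 V y)
    (hGc : ContinuousOn (G l) {y | l ≤ ‖y‖}) (hG0 : ∀ y, l ≤ ‖y‖ → 0 ≤ G l y)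
    (hlap : ∀ y, l < ‖y‖ → ‖y‖ < b → -T < y j → 0 ≤ sphereDiff V G l y →
      ∃ g L, HasLap (sphereDiff V G l) y g L ∧ L < 0)
    (hpos : ∀ y ∈ annulusAbove j l b T, l < ‖y‖ → 0 < sphereDiff V G l y)
    {y : Euc n} (hy : ‖y‖ = l) : l ^ 2 * G l y < radialDeriv V y := by
  obtain ⟨ρ, hρ1, hρ2⟩ := exists_between (lt_min hlb hlT)
  have hρb : ρ < b := hρ2.trans_le (min_le_left _ _)
  have hρT : ρ < T := hρ2.trans_le (min_le_right _ _)
  have hρ0 : 0 < ρ := hl.trans hρ1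
  have hup : ∀ z : Euc n, ‖z‖ ≤ ρ → -T < z j := fun z hz => by
    linarith [(abs_le.1 (abs_coord_le_norm z j)).1]
  have hsub : annulusAbove j l ρ T ⊆ annulusAbove j l b T := fun z hz =>
    ⟨hz.1, hz.2.1.trans hρb.le, hz.2.2⟩
  -- a positive lower bound on the outer sphere
  obtain ⟨ε, hε, hεb⟩ : ∃ ε > 0, ∀ z : Euc n, ‖z‖ = ρ → ε ≤ sphereDiff V G l z := by
    have hcs : IsCompact (sphere (0 : Euc n) ρ) := isCompact_sphere _ _
    have hmem : ∀ z ∈ sphere (0 : Euc n) ρ, z ∈ annulusAbove j l b T := by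
      intro z hz
      have hz' : ‖z‖ = ρ := by simpa using hz
      exact ⟨by linarith, by linarith, (hup z hz'.le).le⟩
    obtain ⟨z, hz, hmin⟩ := hcs.exists_isMinOn
      ⟨(ρ / l) • y, by simp [norm_smul, hy, abs_of_pos hρ0, abs_of_pos hl, hl.ne']⟩ (hZc.mono hmem)
    have hz' : ‖z‖ = ρ := by simpa using hz
    exact ⟨_, hpos z (hmem z hz) (by linarith), fun w hw => hmin (by simpa using hw)⟩
  have hcomp : ∀ z ∈ annulusAbove j l ρ T, 0 ≤ sphereDiff V G l z - ε * (1 - l / ‖z‖) := by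
    refine nonneg_on_annulusAbove ?_ ?_ ?_ ?_ ?_
    · refine (hZc.mono hsub).sub (continuousOn_const.mul (continuousOn_const.sub
        (continuousOn_const.div continuous_norm.continuousOn fun z hz => ?_)))
      exact (hl.trans_le hz.1).ne'
    · intro z hz hzl
      rw [sphereDiff_eq_zero hl V G hzl, hzl, div_self hl.ne']; simp
    · intro z hz hzρ
      have h1 := hεb z hzρ
      have h2 : 0 ≤ ε * (l / ‖z‖) := by positivity
      linarith
    · intro z hz1 hz2 hz3 _
      have hz0 : z ≠ 0 := norm_pos_iff.1 (hl.trans hz1)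
      obtain ⟨g, L, hL, hL0⟩ := hlap z hz1 (hz2.trans hρb) hz3
        (hpos z (hsub ⟨hz1.le, hz2.le, hz3.le⟩) hz1).le
      refine ⟨_, _, hL.sub ((hasLap_bar3 l hz0).const_mul ε), ?_⟩
      have hn' : (4 : ℝ) ≤ n := by exact_mod_cast hn
      have : 0 < ε * (l * (n - 3) / ‖z‖ ^ 3) := by
        have : (0 : ℝ) < n - 3 := by linarith
        have : 0 < ‖z‖ := hl.trans hz1
        positivity
      linarith
    · intro z _ hz2 hz3 _
      exact absurd hz3 (hup z hz2.le).ne'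
  -- approach the sphere along the ray through `y`
  set x : ℕ → Euc n := fun k => (1 + 1 / ((k : ℝ) + 1)) • y with hx
  have hxn : ∀ k, ‖x k‖ = (1 + 1 / ((k : ℝ) + 1)) * l := fun k => by
    rw [hx, norm_smul, hy, Real.norm_of_nonneg (by positivity)]
  have hxl : ∀ k, l < ‖x k‖ := fun k => by
    rw [hxn]
    have : 0 < 1 / ((k : ℝ) + 1) * l := by positivity
    linarith
  have hxlim : Tendsto x atTop (𝓝 y) := by
    have h1 : Tendsto (fun k : ℕ => 1 + 1 / ((k : ℝ) + 1)) atTop (𝓝 (1 + 0)) :=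
      tendsto_const_nhds.add tendsto_one_div_add_atTop_nhds_zero_nat
    have := h1.smul_const y
    rwa [add_zero, one_smul] at this
  have hxnlim : Tendsto (fun k => ‖x k‖) atTop (𝓝 l) := by rw [← hy]; exact hxlim.norm
  obtain ⟨P, hP, hPe⟩ := exists_tendsto_radialDeriv hl hy tendsto_const_nhds hxlim hxl
    (hVd y (by linarith) (hup y (by linarith)))
  have hGlim : Tendsto (fun k => G l (x k)) atTop (𝓝 (G l y)) := by
    refine (hGc y (by simp [hy])).tendsto.comp (tendsto_nhdsWithin_iff.2 ⟨hxlim, ?_⟩)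
    exact Eventually.of_forall fun k => (hxl k).le
  have hle : ∀ᶠ k in atTop, ε / ‖x k‖ + (‖x k‖ + l) * G l (x k) ≤ 2 / l * P k := by
    filter_upwards [hPe, hxnlim.eventually (gt_mem_nhds hρ1)] with k hk hk'
    have hxk : 0 < ‖x k‖ := hl.trans (hxl k)
    have h1 := hcomp (x k) ⟨(hxl k).le, hk'.le, (hup _ hk'.le).le⟩
    have hG1 := hG0 (x k) (hxl k).le
    have hd : 0 < ‖x k‖ - l := by linarith [hxl k]
    have h2 : (‖x k‖ - l) * (ε / ‖x k‖ + (‖x k‖ + l) * G l (x k))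
        ≤ 2 * Real.log (‖x k‖ / l) * P k := by
      rw [sphereDiff, hk] at h1
      have e : ε * (1 - l / ‖x k‖) = (‖x k‖ - l) * (ε / ‖x k‖) := by field_simp
      linarith only [h1, e]
    have hlog0 : 0 < Real.log (‖x k‖ / l) := Real.log_pos ((one_lt_div hl).2 (hxl k))
    have hP0 : 0 ≤ P k := by
      by_contra! hneg
      have h3 : 0 < (‖x k‖ - l) * (ε / ‖x k‖ + (‖x k‖ + l) * G l (x k)) := by positivity
      have h4 : 2 * Real.log (‖x k‖ / l) * P k < 0 := mul_neg_of_pos_of_neg (by positivity) hneg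
      linarith
    have hlog : Real.log (‖x k‖ / l) ≤ (‖x k‖ - l) / l := by
      have := Real.log_le_sub_one_of_pos (show 0 < ‖x k‖ / l by positivity)
      rwa [sub_div, div_self hl.ne']
    have h5 : 2 * Real.log (‖x k‖ / l) * P k ≤ (‖x k‖ - l) * (2 / l * P k) := by
      calc _ ≤ 2 * ((‖x k‖ - l) / l) * P k := by gcongr
        _ = _ := by ring
    exact le_of_mul_le_mul_left (h2.trans h5) hd
  have hlim := le_of_tendsto_of_tendsto
    ((tendsto_const_nhds.div hxnlim hl.ne').add ((hxnlim.add_const l).mul hGlim))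
    (hP.const_mul (2 / l)) hle
  have h6 : l * (ε / l + (l + l) * G l y) ≤ l * (2 / l * radialDeriv V y) := by gcongr
  have e1 : l * (ε / l + (l + l) * G l y) = ε + 2 * (l ^ 2 * G l y) := by field_simp; ring
  have e2 : l * (2 / l * radialDeriv V y) = 2 * radialDeriv V y := by field_simp
  linarith

/-- The moving sphere sweep: if the comparison functions are strict supersolutions wherever they
are nonnegative, nonnegativity propagates from the radius `a₀` to the radius `a₁`. -/
theorem sphereDiff_nonneg_of_start (hn : 4 ≤ n) (h0 : 0 < a₀) (h01 : a₀ ≤ a₁) (h1b : a₁ < b)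
    (h1T : a₁ < T)
    (hVc : ContinuousOn V {y | ‖y‖ ≤ b ∧ -T ≤ y j})
    (hVd : ∀ y, ‖y‖ < b → -T < y j → ContDiffAt ℝ 2 V y)
    (hG : ContinuousOn (fun p : ℝ × Euc n => G p.1 p.2) (Icc a₀ a₁ ×ˢ {y | a₀ ≤ ‖y‖}))
    (hG0 : ∀ l ∈ Icc a₀ a₁, ∀ y, l ≤ ‖y‖ → 0 ≤ G l y)
    (hlap : ∀ l ∈ Icc a₀ a₁, ∀ y, l < ‖y‖ → ‖y‖ < b → -T < y j → 0 ≤ sphereDiff V G l y →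
      ∃ g L, HasLap (sphereDiff V G l) y g L ∧ L < 0)
    (hbot : ∀ l ∈ Icc a₀ a₁, ∀ y, l < ‖y‖ → ‖y‖ < b → y j = -T → sphereDiff V G l y = 0 →
      ∃ᶠ t in 𝓝[>] (0 : ℝ), sphereDiff V G l (y + t • EuclideanSpace.single j 1) < 0)
    (hout : ∀ l ∈ Icc a₀ a₁, ∀ y, ‖y‖ = b → -T ≤ y j → 0 < sphereDiff V G l y)
    (hstart : ∀ y ∈ annulusAbove j a₀ b T, 0 ≤ sphereDiff V G a₀ y) :
    ∀ y ∈ annulusAbove j a₁ b T, 0 ≤ sphereDiff V G a₁ y := by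
  have hZ := continuousOn_sphereDiff h0 h1b h1T hVc hG
  have hZl : ∀ l ∈ Icc a₀ a₁, ContinuousOn (sphereDiff V G l) (annulusAbove j l b T) :=
    fun l hl => hZ.comp (f := fun y => (l, y)) (by fun_prop) fun y hy => ⟨hl, hy.1, hy.2.1, hy.2.2⟩
  set S : Set ℝ := {l | ∀ y ∈ annulusAbove j l b T, 0 ≤ sphereDiff V G l y} with hS
  -- positivity off the inner sphere
  have hpos : ∀ l ∈ Icc a₀ a₁, l ∈ S → ∀ y ∈ annulusAbove j l b T, l < ‖y‖ →
      0 < sphereDiff V G l y := by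
    intro l hl hlS y hy hly
    refine (hlS y hy).lt_of_ne fun h => ?_
    have hb : ‖y‖ < b := hy.2.1.lt_of_ne fun hb => (hout l hl y hb hy.2.2).ne h
    refine not_isMinOn_annulusAbove hy hly hb (fun z hz => h ▸ hlS z hz)
      (fun hT => hlap l hl y hly hb hT h.le) fun hT => ?_
    rw [← h]
    exact hbot l hl y hly hb hT h.symm
  have hmain : Icc a₀ a₁ ⊆ S := by
    refine IsClosed.Icc_subset_of_forall_exists_gt ?_ hstart ?_
    · refine isClosed_of_closure_subset fun l hl => ?_
      have hlI : l ∈ Icc a₀ a₁ := isClosed_Icc.closure_subset_iff.2 inter_subset_right hl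
      refine ⟨fun y hy => ?_, hlI⟩
      rcases hy.1.eq_or_lt with h | h
      · exact (sphereDiff_eq_zero (h0.trans_le hlI.1) V G h.symm).ge
      obtain ⟨x, hx, hxl⟩ := mem_closure_iff_seq_limit.1 hl
      have hev : ∀ᶠ k in atTop, x k < ‖y‖ := hxl.eventually (gt_mem_nhds h)
      have hc := hZ (l, y) ⟨hlI, hy.1, hy.2.1, hy.2.2⟩
      have h1 : Tendsto (fun k => sphereDiff V G (x k) y) atTop (𝓝 (sphereDiff V G l y)) := by
        refine hc.tendsto.comp (f := fun k => (x k, y)) (tendsto_nhdsWithin_iff.2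
          ⟨hxl.prodMk_nhds tendsto_const_nhds, ?_⟩)
        filter_upwards [hev] with k hk
        exact ⟨(hx k).2, hk.le, hy.2.1, hy.2.2⟩
      refine ge_of_tendsto h1 ?_
      filter_upwards [hev] with k hk
      exact (hx k).1 y ⟨hk.le, hy.2.1, hy.2.2⟩
    · rintro l ⟨hlS, hl0, hl1⟩ m hm
      have hlI : l ∈ Icc a₀ a₁ := ⟨hl0, hl1.le⟩
      have hlp : 0 < l := h0.trans_le hl0
      have hlm : l < min m a₁ := lt_min hm hl1
      by_contra hemp
      have hbad : ∀ k : ℕ, ∃ a : ℝ, ∃ y, a ∈ Ioc l (min m a₁) ∧ a ≤ l + 1 / ((k : ℝ) + 1) ∧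
          y ∈ annulusAbove j a b T ∧ sphereDiff V G a y < 0 := by
        intro k
        have h1 : l < min (min m a₁) (l + 1 / ((k : ℝ) + 1)) :=
          lt_min hlm (by have : (0 : ℝ) < 1 / ((k : ℝ) + 1) := by positivity
                         linarith)
        have h2 : min (min m a₁) (l + 1 / ((k : ℝ) + 1)) ∉ S := fun h =>
          hemp ⟨_, h, h1, (min_le_left _ _).trans (min_le_left _ _)⟩
        simp only [hS, mem_ofPred_eq, not_forall, not_le] at h2
        obtain ⟨y, hy, hy'⟩ := h2
        exact ⟨_, y, ⟨h1, min_le_left _ _⟩, min_le_right _ _, hy, hy'⟩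
      choose a x ha ha' hx hneg using hbad
      have haI : ∀ k, a k ∈ Icc a₀ a₁ := fun k =>
        ⟨hl0.trans (ha k).1.le, (ha k).2.trans (min_le_right _ _)⟩
      have halim : Tendsto a atTop (𝓝 l) := by
        refine tendsto_of_tendsto_of_tendsto_of_le_of_le tendsto_const_nhds ?_
          (fun k => (ha k).1.le) ha'
        simpa using tendsto_const_nhds (x := l) |>.add tendsto_one_div_add_atTop_nhds_zero_nat
      obtain ⟨y, hy, φ, hφ, hlim⟩ := (isCompact_annulusAbove j l b T).tendsto_subseq
        (x := x) fun k => ⟨(ha k).1.le.trans (hx k).1, (hx k).2.1, (hx k).2.2⟩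
      have halim' : Tendsto (a ∘ φ) atTop (𝓝 l) := halim.comp hφ.tendsto_atTop
      have hpair : Tendsto (fun k => ((a ∘ φ) k, (x ∘ φ) k)) atTop (𝓝 (l, y)) :=
        halim'.prodMk_nhds hlim
      have hle : sphereDiff V G l y ≤ 0 := by
        have hc := hZ (l, y) ⟨hlI, hy.1, hy.2.1, hy.2.2⟩
        refine le_of_tendsto (hc.tendsto.comp (tendsto_nhdsWithin_iff.2 ⟨hpair, ?_⟩)) ?_
        · exact Eventually.of_forall fun k => ⟨haI _, (hx _).1, (hx _).2.1, (hx _).2.2⟩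
        · exact Eventually.of_forall fun k => (hneg _).le
      have hyl : ‖y‖ = l := by
        by_contra h
        exact (hpos l hlI hlS y hy (lt_of_le_of_ne hy.1 (Ne.symm h))).not_ge hle
      have hGl : ContinuousOn (G l) {y | l ≤ ‖y‖} :=
        hG.comp (f := fun y => (l, y)) (by fun_prop) fun z hz => ⟨hlI, hl0.trans hz⟩
      have hup : -T < y j := by linarith [(abs_le.1 (abs_coord_le_norm y j)).1]
      have hopf := hopf_sphereDiff hn hlp (hl1.trans h1b) (hl1.trans h1T) (hZl l hlI) hVd hGl
        (hG0 l hlI) (hlap l hlI) (hpos l hlI hlS) hyl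
      have hlt : ∀ k, (a ∘ φ) k < ‖(x ∘ φ) k‖ := fun k => by
        refine (hx _).1.lt_of_ne fun h => ?_
        exact (hneg (φ k)).ne (sphereDiff_eq_zero (h0.trans_le (haI _).1) V G h.symm)
      obtain ⟨P, hP, hPe⟩ := exists_tendsto_radialDeriv hlp hyl halim' hlim hlt
        (hVd y (by linarith) hup)
      have hGlim : Tendsto (fun k => G ((a ∘ φ) k) ((x ∘ φ) k)) atTop (𝓝 (G l y)) := by
        have hc := hG (l, y) ⟨hlI, hl0.trans hy.1⟩
        refine hc.tendsto.comp (tendsto_nhdsWithin_iff.2 ⟨hpair, ?_⟩)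
        exact Eventually.of_forall fun k => ⟨haI _, (haI _).1.trans (hx _).1⟩
      have hnlim : Tendsto (fun k => ‖(x ∘ φ) k‖) atTop (𝓝 l) := by rw [← hyl]; exact hlim.norm
      have hPpos : 0 < radialDeriv V y :=
        (mul_nonneg (sq_nonneg l) (hG0 l hlI y hy.1)).trans_lt hopf
      have hev : ∀ᶠ k in atTop, P k ≤ ‖(x ∘ φ) k‖ ^ 2 * G ((a ∘ φ) k) ((x ∘ φ) k) := by
        filter_upwards [hPe, hP.eventually (lt_mem_nhds hPpos)] with k hk hPk
        have h1 := hneg (φ k)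
        have h2 := hlt k
        have hap : 0 < (a ∘ φ) k := h0.trans_le (haI _).1
        simp only [Function.comp_apply] at hk h2 hap ⊢
        generalize a (φ k) = q at *
        generalize x (φ k) = z at *
        have hz : 0 < ‖z‖ := hap.trans h2
        rw [sphereDiff, hk] at h1
        have hd : 0 < ‖z‖ ^ 2 - q ^ 2 := by
          have : q ^ 2 < ‖z‖ ^ 2 := by gcongr
          linarith
        have hlog : (‖z‖ ^ 2 - q ^ 2) / ‖z‖ ^ 2 ≤ 2 * Real.log (‖z‖ / q) := by
          have h3 := Real.one_sub_inv_le_log_of_pos (show 0 < (‖z‖ / q) ^ 2 by positivity)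
          rw [Real.log_pow] at h3
          refine le_trans (le_of_eq ?_) h3
          field_simp
        have h4 : (‖z‖ ^ 2 - q ^ 2) / ‖z‖ ^ 2 * P k ≤ 2 * Real.log (‖z‖ / q) * P k := by gcongr
        have h5 : (‖z‖ ^ 2 - q ^ 2) * (P k / ‖z‖ ^ 2) ≤ (‖z‖ ^ 2 - q ^ 2) * G q z := by
          refine le_trans (le_of_eq ?_) (h4.trans (by linarith))
          field_simp
        have h6 := le_of_mul_le_mul_left h5 hd
        rwa [div_le_iff₀ (by positivity), mul_comm] at h6
      have := le_of_tendsto_of_tendsto hP ((hnlim.pow 2).mul hGlim) hev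
      exact absurd this (not_le.2 hopf)
  exact hmain ⟨h01, le_rfl⟩

end Sweep

section HalfBall

variable {n : ℕ} {h0 : 0 < n}

lemma mem_closure_halfBall {r : ℝ} {z : Euc n} (hz : ‖z‖ < r) (hz0 : 0 ≤ z (lastIdx n h0)) :
    z ∈ closure (halfBall n h0 r) := by
  have hc : Tendsto (fun t : ℝ => z + t • EuclideanSpace.single (lastIdx n h0) (1 : ℝ))
      (𝓝[>] 0) (𝓝 z) := by
    have : Continuous (fun t : ℝ => z + t • EuclideanSpace.single (lastIdx n h0) (1 : ℝ)) := by
      fun_prop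
    have h := this.tendsto 0
    rw [zero_smul, add_zero] at h
    exact h.mono_left nhdsWithin_le_nhds
  refine mem_closure_of_tendsto hc ?_
  filter_upwards [hc.eventually (continuous_norm.continuousAt.eventually (gt_mem_nhds hz)),
    self_mem_nhdsWithin] with t ht ht0
  have : (0 : ℝ) < t := ht0
  refine ⟨by simpa using ht, ?_⟩
  simp [upperHalf]
  linarith

lemma isOpen_halfBall (r : ℝ) : IsOpen (halfBall n h0 r) :=
  isOpen_ball.inter (isOpen_lt continuous_const
    (by fun_prop : Continuous fun y : Euc n => y (lastIdx n h0)))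

lemma convex_closure_halfBall (r : ℝ) : Convex ℝ (closure (halfBall n h0 r)) := by
  refine ((convex_ball 0 r).inter ?_).closure
  intro x hx y hy a b ha hb hab
  have hx' : 0 < x (lastIdx n h0) := hx
  have hy' : 0 < y (lastIdx n h0) := hy
  show 0 < (a • x + b • y) (lastIdx n h0)
  simp only [PiLp.add_apply, PiLp.smul_apply, smul_eq_mul]
  rcases ha.eq_or_lt with rfl | ha
  · have : b = 1 := by linarith
    simp [this, hy']
  · positivity

lemma uniqueDiffOn_closure_halfBall {r : ℝ} (hr : 0 < r) :
    UniqueDiffOn ℝ (closure (halfBall n h0 r)) := by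
  refine uniqueDiffOn_convex (convex_closure_halfBall r) ?_
  refine Nonempty.mono (interior_maximal subset_closure (isOpen_halfBall r)) ?_
  refine ⟨EuclideanSpace.single (lastIdx n h0) (r / 2), ?_, ?_⟩
  · simp [abs_of_pos hr, hr]
  · simp [upperHalf, hr]

end HalfBall

section Gradient

variable {E : Type*} [NormedAddCommGroup E] [NormedSpace ℝ E] {Ω : Set E} {K : E → ℝ} {N : ℕ}
  {C₀ : ℝ}

lemma norm_fderivWithin_two (hu : UniqueDiffOn ℝ Ω) {x : E} (hx : x ∈ Ω) :
    ‖fderivWithin ℝ (fderivWithin ℝ K Ω) Ω x‖ = ‖iteratedFDerivWithin ℝ 2 K Ω x‖ := by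
  rw [← norm_iteratedFDerivWithin_one _ (hu x hx), norm_iteratedFDerivWithin_fderivWithin hu hx]

/-- A differential inequality for the gradient limits its growth along segments. -/
lemma gradient_growth (hΩ : Convex ℝ Ω) (hN : 1 ≤ N) (hC : 0 < C₀)
    (hd : DifferentiableOn ℝ (fderivWithin ℝ K Ω) Ω)
    (hb : ∀ x ∈ Ω, ‖fderivWithin ℝ (fderivWithin ℝ K Ω) Ω x‖ ≤
      C₀ * ‖fderivWithin ℝ K Ω x‖ ^ (((N : ℝ) - 1) / N))
    {x z : E} (hx : x ∈ Ω) (hz : z ∈ Ω) {a : ℝ} (ha : 0 < a)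
    (hxa : ‖fderivWithin ℝ K Ω x‖ ≤ a ^ N) :
    ‖fderivWithin ℝ K Ω z - fderivWithin ℝ K Ω x‖ ≤
      C₀ * ‖z - x‖ * (a + 2 * C₀ * ‖z - x‖) ^ (N - 1) := by
  rcases eq_or_ne z x with rfl | hzx
  · simp
  set d := ‖z - x‖ with hdd
  have hd0 : 0 < d := norm_pos_iff.2 (sub_ne_zero.2 hzx)
  set γ : ℝ → E := fun t => x + t • (z - x) with hγ
  have hγΩ : ∀ t ∈ Icc (0 : ℝ) 1, γ t ∈ Ω := fun t ht => hΩ.add_smul_sub_mem hx hz ht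
  set f : ℝ → E →L[ℝ] ℝ := fun t => fderivWithin ℝ K Ω (γ t) with hf
  have hder : ∀ t ∈ Icc (0 : ℝ) 1, HasDerivWithinAt f
      (fderivWithin ℝ (fderivWithin ℝ K Ω) Ω (γ t) (z - x)) (Icc 0 1) t := by
    intro t ht
    have h1 : HasDerivWithinAt γ (z - x) (Icc 0 1) t := by
      have := ((hasDerivWithinAt_id t (Icc 0 1)).smul_const (z - x)).const_add x
      simpa [hγ] using this
    exact (hd (γ t) (hγΩ t ht)).hasFDerivWithinAt.comp_hasDerivWithinAt t h1 hγΩ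
  have hder' : ∀ t ∈ Ico (0 : ℝ) 1, HasDerivWithinAt f
      (fderivWithin ℝ (fderivWithin ℝ K Ω) Ω (γ t) (z - x)) (Ici t) t := fun t ht =>
    (hder t (Ico_subset_Icc_self ht)).mono_of_mem_nhdsWithin (Icc_mem_nhdsGE_of_mem ht)
  have hcont : ContinuousOn f (Icc 0 1) := fun t ht => (hder t ht).continuousWithinAt
  set B : ℝ → ℝ := fun t => (a + 2 * C₀ * d * t) ^ N with hB
  have hN0 : (N : ℝ) ≠ 0 := by positivity
  have hBd : ∀ t, HasDerivAt B (N * (a + 2 * C₀ * d * t) ^ (N - 1) * (2 * C₀ * d)) t := by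
    intro t
    have := (((hasDerivAt_id t).const_mul (2 * C₀ * d)).const_add a).pow N
    exact this.congr_deriv (by simp)
  have hfb : ∀ t ∈ Icc (0 : ℝ) 1, ∀ c : ℝ, 0 ≤ c → ‖f t‖ ≤ c ^ N →
      ‖fderivWithin ℝ (fderivWithin ℝ K Ω) Ω (γ t) (z - x)‖ ≤ C₀ * d * c ^ (N - 1) := by
    intro t ht c hc hft
    have h1 := (hb (γ t) (hγΩ t ht))
    have h2 : ‖f t‖ ^ (((N : ℝ) - 1) / N) ≤ c ^ (N - 1) := by
      have h3 : 0 ≤ ((N : ℝ) - 1) / N := by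
        have : (1 : ℝ) ≤ N := by exact_mod_cast hN
        exact div_nonneg (by linarith) (by linarith)
      refine (Real.rpow_le_rpow (norm_nonneg _) hft h3).trans_eq ?_
      rw [← Real.rpow_natCast c N, ← Real.rpow_mul hc, mul_div_cancel₀ _ hN0,
        ← Real.rpow_natCast c (N - 1), Nat.cast_sub hN, Nat.cast_one]
    calc _ ≤ ‖fderivWithin ℝ (fderivWithin ℝ K Ω) Ω (γ t)‖ * d :=
          ContinuousLinearMap.le_opNorm _ _
      _ ≤ (C₀ * c ^ (N - 1)) * d := by
          gcongr
          exact h1.trans (mul_le_mul_of_nonneg_left h2 hC.le)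
      _ = _ := by ring
  have hpos : ∀ t ∈ Icc (0 : ℝ) 1, 0 < a + 2 * C₀ * d * t := fun t ht => by
    have := ht.1
    positivity
  have hle : ∀ t ∈ Icc (0 : ℝ) 1, ‖f t‖ ≤ B t := by
    intro t ht
    refine image_norm_le_of_norm_deriv_right_lt_deriv_boundary' hcont hder' ?_
      (fun s _ => (hBd s).continuousAt.continuousWithinAt)
      (fun s _ => (hBd s).hasDerivWithinAt) ?_ ht
    · simpa [hf, hγ, hB] using hxa
    · intro s hs hfs
      have hs' := Ico_subset_Icc_self hs
      have hp := hpos s hs'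
      refine (hfb s hs' _ hp.le hfs.le).trans_lt ?_
      have h1 : (1 : ℝ) ≤ N := by exact_mod_cast hN
      have h2 : 0 < C₀ * d * (a + 2 * C₀ * d * s) ^ (N - 1) := by positivity
      have h3 := mul_le_mul_of_nonneg_right h1 h2.le
      linarith
  have hfin := norm_image_sub_le_of_norm_deriv_le_segment' (f := f)
    (C := C₀ * d * (a + 2 * C₀ * d) ^ (N - 1)) hder ?_ 1 (right_mem_Icc.2 zero_le_one)
  · simpa [hf, hγ] using hfin
  · intro t ht
    have ht' := Ico_subset_Icc_self ht
    refine (hfb t ht' _ (hpos t ht').le (hle t ht')).trans ?_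
    have h1 := (hpos t ht').le
    have h2 : 2 * C₀ * d * t ≤ 2 * C₀ * d * 1 := by
      have := ht.2.le
      gcongr
    have h3 : a + 2 * C₀ * d * t ≤ a + 2 * C₀ * d := by linarith
    gcongr

lemma exists_gradient_osc_bound (N : ℕ) (hN : 1 ≤ N) (hC : 0 < C₀) {ε : ℝ} (hε : 0 < ε) :
    ∃ C : ℝ, 0 < C ∧ ∀ (Ω : Set E) (K : E → ℝ), Convex ℝ Ω →
      DifferentiableOn ℝ (fderivWithin ℝ K Ω) Ω →
      (∀ x ∈ Ω, ‖fderivWithin ℝ (fderivWithin ℝ K Ω) Ω x‖ ≤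
        C₀ * ‖fderivWithin ℝ K Ω x‖ ^ (((N : ℝ) - 1) / N)) →
      ∀ x ∈ Ω, ∀ z ∈ Ω, ‖fderivWithin ℝ K Ω z - fderivWithin ℝ K Ω x‖ ≤
        ε * ‖fderivWithin ℝ K Ω x‖ + C * ‖z - x‖ ^ N := by
  set q := (1 + 2 * C₀) ^ (N - 1) with hq
  have hq0 : 0 < q := by positivity
  set η := ε / (C₀ * q) with hη
  have hη0 : 0 < η := by positivity
  refine ⟨ε + C₀ * (η⁻¹ + 2 * C₀) ^ (N - 1), by positivity, ?_⟩
  intro Ω K hΩ hd hb x hx z hz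
  rcases eq_or_ne z x with rfl | hzx
  · simp; positivity
  set d := ‖z - x‖ with hdd
  have hd0 : 0 < d := norm_pos_iff.2 (sub_ne_zero.2 hzx)
  set δ := ‖fderivWithin ℝ K Ω x‖ with hδ
  have hδ0 : 0 ≤ δ := norm_nonneg _
  have hN0 : N ≠ 0 := by omega
  set a := (δ + d ^ N) ^ ((N : ℝ)⁻¹) with ha
  have ha0 : 0 < a := by positivity
  have haN : a ^ N = δ + d ^ N := Real.rpow_inv_natCast_pow (by positivity) hN0
  have hda : d ≤ a := by
    refine le_of_pow_le_pow_left₀ hN0 ha0.le ?_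
    rw [haN]; linarith
  have hmain := gradient_growth hΩ hN hC hd hb hx hz ha0
      (by rw [haN]; have := pow_pos hd0 N; linarith)
  refine hmain.trans ?_
  have hpow : ∀ t : ℝ, t ^ N = t * t ^ (N - 1) := fun t => by
    rw [← pow_succ', Nat.sub_add_cancel hN]
  rcases le_or_gt d (η * a) with h | h
  · calc C₀ * d * (a + 2 * C₀ * d) ^ (N - 1)
        ≤ C₀ * (η * a) * (a + 2 * C₀ * a) ^ (N - 1) := by gcongr
      _ = C₀ * η * q * a ^ N := by
          rw [show a + 2 * C₀ * a = (1 + 2 * C₀) * a by ring, mul_pow, hpow a]; ring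
      _ = ε * (δ + d ^ N) := by
          rw [haN, hη]; field_simp
      _ ≤ _ := by
          have : 0 ≤ C₀ * (η⁻¹ + 2 * C₀) ^ (N - 1) * d ^ N := by positivity
          linarith
  · have h1 : a ≤ η⁻¹ * d := by
      rw [inv_mul_eq_div, le_div_iff₀ hη0]; linarith
    calc C₀ * d * (a + 2 * C₀ * d) ^ (N - 1)
        ≤ C₀ * d * (η⁻¹ * d + 2 * C₀ * d) ^ (N - 1) := by gcongr
      _ = C₀ * (η⁻¹ + 2 * C₀) ^ (N - 1) * d ^ N := by
          rw [← add_mul, mul_pow, hpow d]; ring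
      _ ≤ _ := by
          have h2 : 0 ≤ ε * d ^ N := by positivity
          have h3 : 0 ≤ ε * δ := by positivity
          linarith

lemma sub_le_of_gradient_osc (hΩ : Convex ℝ Ω) (hK : DifferentiableOn ℝ K Ω) {x p q : E}
    {b c : ℝ} (hp : p ∈ Ω) (hq : q ∈ Ω) (hpb : ‖p - x‖ ≤ b) (hqb : ‖q - x‖ ≤ b)
    (hc : ∀ z ∈ Ω, ‖z - x‖ ≤ b → ‖fderivWithin ℝ K Ω z - fderivWithin ℝ K Ω x‖ ≤ c) :
    |K p - K q - fderivWithin ℝ K Ω x (p - q)| ≤ c * ‖p - q‖ := by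
  have hs : Convex ℝ (Ω ∩ closedBall x b) := hΩ.inter (convex_closedBall x b)
  refine hs.norm_image_sub_le_of_norm_hasFDerivWithin_le' (f' := fderivWithin ℝ K Ω)
    (fun z hz => (hK z hz.1).hasFDerivWithinAt.mono inter_subset_left)
    (fun z hz => hc z hz.1 (by simpa [dist_eq_norm] using hz.2))
    ⟨hq, by simpa [dist_eq_norm] using hqb⟩ ⟨hp, by simpa [dist_eq_norm] using hpb⟩

end Gradient

lemma add_rpow_ge {p W g : ℝ} (hp : 1 ≤ p) (hW : 0 < W) (hg : 0 ≤ g) :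
    W ^ p + p * W ^ (p - 1) * g ≤ (W + g) ^ p := by
  have h1 : -1 ≤ g / W := by have : 0 ≤ g / W := by positivity
                             linarith
  have h := one_add_mul_self_le_rpow_one_add h1 hp
  have h2 : W ^ p * (1 + p * (g / W)) ≤ W ^ p * (1 + g / W) ^ p := by gcongr
  have e1 : W ^ p * (1 + g / W) ^ p = (W + g) ^ p := by
    rw [← Real.mul_rpow hW.le (by positivity)]
    congr 1; field_simp
  have e2 : W ^ p * (1 + p * (g / W)) = W ^ p + p * W ^ (p - 1) * g := by
    rw [Real.rpow_sub_one hW.ne']; field_simp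
  rw [e1, e2] at h2
  exact h2

lemma barD_lower {l R r X : ℝ} (hl : 0 < l) (hR : 0 ≤ R) (hX : X ≤ r) :
    (l ^ 2 - R ^ 2) / l ^ 2 * r ^ 2 ≤ r ^ 2 + l ^ 2 - 2 * R * X := by
  have h1 : 2 * R * X ≤ 2 * R * r := by gcongr
  rw [div_mul_eq_mul_div, div_le_iff₀ (by positivity)]
  have h2 := mul_le_mul_of_nonneg_left h1 (sq_nonneg l)
  nlinarith [sq_nonneg (R * r - l ^ 2)]

lemma barD_lower' {l R r X : ℝ} (hR : 1 ≤ R) (hm1 : 1 / 2 ≤ l ^ 2 - R ^ 2)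
    (hm2 : l ^ 2 - R ^ 2 ≤ 2) (hl : 0 < l) (hX : X ≤ r) :
    (r / (4 * R)) ^ 2 ≤ r ^ 2 + l ^ 2 - 2 * R * X := by
  refine le_trans ?_ (barD_lower hl (by linarith) hX)
  rw [div_pow, div_mul_eq_mul_div, div_le_div_iff₀ (by positivity) (by positivity)]
  have h1 : l ^ 2 ≤ 8 * R ^ 2 := by nlinarith
  have h2 : (1 / 2) * (8 * R ^ 2) * 2 ≤ (l ^ 2 - R ^ 2) * (4 * R) ^ 2 := by nlinarith [sq_nonneg R]
  have h3 := mul_le_mul_of_nonneg_right h2 (sq_nonneg r)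
  have h4 := mul_le_mul_of_nonneg_left h1 (sq_nonneg r)
  linarith

set_option maxHeartbeats 1600000 in
/-- The sign of the Laplacian of the comparison function at points where it is nonnegative. -/
lemma interior_neg {n : ℕ} (hn : 4 ≤ n) {l R r X D ρ a Ky Kl κ γ A C ε g L Rad Cg B : ℝ}
    (hl : 1 ≤ l) (hlr : l < r) (hXr : |X| ≤ r) (hB : 1 ≤ B) (hD : (r / B) ^ 2 ≤ D)
    (hm2 : l ^ 2 - R ^ 2 ≤ 2) (hm3 : l ^ 2 - R ^ 2 ≤ 1 + ε)
    (hε : 0 < ε) (hε1 : ε ≤ 1) (hRad : 1 ≤ ε * Rad)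
    (hρ : 0 < ρ) (hρ1 : |ρ ^ (((n : ℝ) + 2) / (n - 2)) - 1| ≤ ε)
    (hρ2 : 1 - ε ≤ ρ ^ (((n : ℝ) + 2) / (n - 2) - 1))
    (hκ : 0 ≤ κ) (hγ : 0 < γ) (hA : 0 ≤ A) (hC : 0 ≤ C) 
    (hK0 : 0 ≤ Ky) (hKn : r ≤ Rad → n * (n - 2) * (1 - ε) ≤ Ky)
    (hosc : Kl - Ky ≤ κ * ((r ^ 2 - l ^ 2) / r ^ 2 * (-X + ε * r))
      + C * γ * ((r ^ 2 - l ^ 2) * r ^ (n - 4)))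
    (hg0 : 0 ≤ g) (hg1 : g ≤ Cg * ((r ^ 2 - l ^ 2) * (r ^ n)⁻¹))
    (hcore : (r ^ 2 - l ^ 2) * (2 ^ (n + 4) * r ^ (n + 3))⁻¹ ≤
      L + n * (n + 2) * (l ^ 2 - R ^ 2) / D ^ 2 * g
        + (r ^ 2 - l ^ 2) / r ^ 2 * X * (D ^ (-((n : ℝ) / 2)) / D))
    (hsmall : ε * (3 * n * (n + 2) * B ^ 4 * Cg + 3 * B ^ (n + 2)) ≤ (2 ^ (n + 4))⁻¹)
    (hAC : 2 * C * B ^ (n + 2) < A)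
    (ha : ρ * D ^ (-(((n : ℝ) - 2) / 2)) + (κ * g + A * γ * (1 - l / r)) ≤ a) :
    -(Ky * a ^ (((n : ℝ) + 2) / (n - 2)))
      + Kl * (ρ * D ^ (-(((n : ℝ) - 2) / 2))) ^ (((n : ℝ) + 2) / (n - 2))
      - (κ * L + A * γ * (l * (n - 3) / r ^ 3)) < 0 := by
  have hn' : (4 : ℝ) ≤ n := by exact_mod_cast hn
  have hr : 1 < r := hl.trans_lt hlr
  have hr0 : 0 < r := by linarith
  have hB0 : 0 < B := by linarith
  have hDpos : 0 < D := lt_of_lt_of_le (by positivity) hD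
  set p := ((n : ℝ) + 2) / (n - 2) with hp
  have hp1 : 1 ≤ p := by rw [hp, one_le_div (by linarith)]; linarith
  set W := ρ * D ^ (-(((n : ℝ) - 2) / 2)) with hW
  have hW0 : 0 < W := by positivity
  set P := D ^ (-((n : ℝ) / 2)) with hP
  have hP0 : 0 < P := by positivity
  have hWp : W ^ p = ρ ^ p * (P / D) := by
    rw [hW, Real.mul_rpow hρ.le (by positivity), ← Real.rpow_mul hDpos.le, hP,
      ← Real.rpow_sub_one hDpos.ne']
    congr 2
    rw [hp]; field_simp [show (n : ℝ) - 2 ≠ 0 by linarith]; ring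
  have hWp1 : W ^ (p - 1) = ρ ^ (p - 1) * (1 / D ^ 2) := by
    rw [hW, Real.mul_rpow hρ.le (by positivity), ← Real.rpow_mul hDpos.le]
    congr 1
    rw [one_div, ← Real.rpow_natCast, ← Real.rpow_neg hDpos.le]
    congr 1
    rw [hp]; push_cast; field_simp [show (n : ℝ) - 2 ≠ 0 by linarith]; ring
  set w := r ^ 2 - l ^ 2 with hw
  have hw0 : 0 < w := by
    have : l ^ 2 < r ^ 2 := by gcongr
    linarith only [this, hw]
  have hwr : w ≤ r ^ 2 := by linarith only [hw, sq_nonneg l]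
  set m := l ^ 2 - R ^ 2 with hm
  have hPB : P ≤ B ^ n * (r ^ n)⁻¹ := by
    refine (rpow_neg_half_le (by positivity) hD).trans_eq ?_
    rw [div_pow]; field_simp
  have hDB : 1 / D ≤ B ^ 2 / r ^ 2 := by
    rw [div_le_div_iff₀ hDpos (by positivity)]
    rw [div_pow, div_le_iff₀ (by positivity)] at hD
    linarith
  have hD2 : 1 / D ^ 2 ≤ B ^ 4 * (1 / r * (1 / r ^ 3)) := by
    calc 1 / D ^ 2 = (1 / D) ^ 2 := by rw [div_pow, one_pow]
      _ ≤ (B ^ 2 / r ^ 2) ^ 2 := by gcongr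
      _ = _ := by field_simp
  have hPD : P / D ≤ B ^ (n + 2) * (r ^ (n + 2))⁻¹ := by
    calc P / D = P * (1 / D) := by ring
      _ ≤ (B ^ n * (r ^ n)⁻¹) * (B ^ 2 / r ^ 2) := by gcongr
      _ = _ := by field_simp; ring
  have hPD0 : 0 < P / D := by positivity
  have hr1 : 1 / r ≤ 1 := by rw [div_le_one hr0]; exact hr.le
  -- convexity of the power nonlinearity
  have hlr' : 0 ≤ 1 - l / r := by
    rw [sub_nonneg, div_le_one hr0]; exact hlr.le
  have h1 : W ^ p + p * W ^ (p - 1) * (κ * g) ≤ a ^ p := by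
    refine (add_rpow_ge hp1 hW0 (mul_nonneg hκ hg0)).trans ?_
    refine Real.rpow_le_rpow (by positivity) (le_trans ?_ ha) (by linarith)
    have : 0 ≤ A * γ * (1 - l / r) := by positivity
    linarith
  -- the zeroth order coefficient
  have h2 : n * (n + 2) * m / D ^ 2 - 3 * ε * n * (n + 2) * B ^ 4 * (1 / r ^ 3)
      ≤ Ky * (p * W ^ (p - 1)) := by
    have hnn : 0 ≤ (n : ℝ) * (n + 2) := by positivity
    have hD2' : 0 < 1 / D ^ 2 := by positivity
    rcases le_or_gt r Rad with hrR | hrR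
    · have h3 : (n * (n - 2) * (1 - ε)) * (p * ((1 - ε) * (1 / D ^ 2))) ≤
          Ky * (p * W ^ (p - 1)) := by
        rw [hWp1]
        have : 0 ≤ 1 - ε := by linarith
        have := hKn hrR
        gcongr
      refine le_trans ?_ h3
      have e1 : (n * (n - 2) * (1 - ε)) * (p * ((1 - ε) * (1 / D ^ 2))) =
          n * (n + 2) * (1 - ε) ^ 2 * (1 / D ^ 2) := by
        rw [hp]; field_simp [show (n : ℝ) - 2 ≠ 0 by linarith]
      have h4 : m - (1 - ε) ^ 2 ≤ 3 * ε := by nlinarith only [hm3, sq_nonneg ε]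
      have h5 : (m - (1 - ε) ^ 2) * (1 / D ^ 2) ≤ 3 * ε * (B ^ 4 * (1 / r ^ 3)) := by
        calc _ ≤ 3 * ε * (1 / D ^ 2) := by gcongr
          _ ≤ 3 * ε * (B ^ 4 * (1 / r * (1 / r ^ 3))) := by gcongr
          _ ≤ 3 * ε * (B ^ 4 * (1 * (1 / r ^ 3))) := by gcongr
          _ = _ := by ring
      have h6 := mul_le_mul_of_nonneg_left h5 hnn
      have e2 : n * (n + 2) * m / D ^ 2 = n * (n + 2) * (m * (1 / D ^ 2)) := by ring
      rw [e1, e2]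
      linarith only [h6]
    · have h3 : 0 ≤ Ky * (p * W ^ (p - 1)) := by positivity
      have h4 : 1 / r ≤ ε := by
        rw [div_le_iff₀ hr0]
        exact hRad.trans (by gcongr)
      have h5 : m * (1 / D ^ 2) ≤ 3 * ε * (B ^ 4 * (1 / r ^ 3)) := by
        calc m * (1 / D ^ 2) ≤ 2 * (1 / D ^ 2) := by gcongr
          _ ≤ 2 * (B ^ 4 * (1 / r * (1 / r ^ 3))) := by gcongr
          _ ≤ 3 * (B ^ 4 * (ε * (1 / r ^ 3))) := by gcongr; norm_num
          _ = _ := by ring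
      have h6 := mul_le_mul_of_nonneg_left h5 hnn
      have e2 : n * (n + 2) * m / D ^ 2 = n * (n + 2) * (m * (1 / D ^ 2)) := by ring
      rw [e2]
      linarith only [h6, h3]
  -- the difference of the coefficients
  obtain ⟨hρl, hρu⟩ := abs_le.1 hρ1
  obtain ⟨hX1, hX2⟩ := abs_le.1 hXr
  have h3 : (Kl - Ky) * W ^ p ≤ -(κ * (w / r ^ 2 * X * (P / D)))
      + κ * (3 * ε * B ^ (n + 2) * (w * (r ^ (n + 3))⁻¹))
      + γ * (2 * C * B ^ (n + 2) * (1 / r ^ 3)) := by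
    have hWp0 : 0 ≤ W ^ p := by positivity
    refine (mul_le_mul_of_nonneg_right hosc hWp0).trans ?_
    have e1 : κ * (w / r ^ 2 * (-X + ε * r)) * W ^ p ≤ -(κ * (w / r ^ 2 * X * (P / D)))
        + κ * (3 * ε * B ^ (n + 2) * (w * (r ^ (n + 3))⁻¹)) := by
      have t1 : (-X + ε * r) * ρ ^ p ≤ -X + 3 * ε * r := by
        have s1 : -X * (ρ ^ p - 1) ≤ r * ε := by
          calc -X * (ρ ^ p - 1) ≤ |-X * (ρ ^ p - 1)| := le_abs_self _
            _ = |X| * |ρ ^ p - 1| := by rw [abs_mul, abs_neg]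
            _ ≤ r * ε := by gcongr
        have s2 : ε * r * ρ ^ p ≤ ε * r * 2 := by gcongr; linarith only [hρu, hε1]
        linarith only [s1, s2]
      have t2 : κ * (w / r ^ 2) * (P / D) * ((-X + ε * r) * ρ ^ p)
          ≤ κ * (w / r ^ 2) * (P / D) * (-X + 3 * ε * r) := by gcongr
      have t3 : κ * (w / r ^ 2) * (3 * ε * r) * (P / D)
          ≤ κ * (w / r ^ 2) * (3 * ε * r) * (B ^ (n + 2) * (r ^ (n + 2))⁻¹) := by gcongr
      have t4 : κ * (w / r ^ 2) * (3 * ε * r) * (B ^ (n + 2) * (r ^ (n + 2))⁻¹) =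
          κ * (3 * ε * B ^ (n + 2) * (w * (r ^ (n + 3))⁻¹)) := by
        field_simp
        ring
      rw [hWp]
      linarith only [t2, t3, t4]
    have e2 : C * γ * (w * r ^ (n - 4)) * W ^ p ≤ γ * (2 * C * B ^ (n + 2) * (1 / r ^ 3)) := by
      have t1 : W ^ p ≤ 2 * (B ^ (n + 2) * (r ^ (n + 2))⁻¹) := by
        rw [hWp]
        have : ρ ^ p ≤ 2 := by linarith only [hρu, hε1]
        gcongr
      obtain ⟨k, rfl⟩ := Nat.exists_eq_add_of_le hn
      rw [show 4 + k - 4 = k by omega]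
      calc C * γ * (w * r ^ k) * W ^ p
          ≤ C * γ * (r ^ 2 * r ^ k) * (2 * (B ^ (4 + k + 2) * (r ^ (4 + k + 2))⁻¹)) := by gcongr
        _ = γ * (2 * C * B ^ (4 + k + 2) * (1 / r ^ 3 * (1 / r))) := by field_simp; ring
        _ ≤ γ * (2 * C * B ^ (4 + k + 2) * (1 / r ^ 3 * 1)) := by gcongr
        _ = _ := by rw [mul_one]
    linarith only [e1, e2]
  have h4 : Ky * (W ^ p + p * W ^ (p - 1) * (κ * g)) ≤ Ky * a ^ p := by gcongr
  have h5 := mul_le_mul_of_nonneg_right h2 (mul_nonneg hκ hg0)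
  have h6 : κ * g * (3 * ε * n * (n + 2) * B ^ 4 * (1 / r ^ 3)) ≤
      κ * (Cg * (w * (r ^ n)⁻¹)) * (3 * ε * n * (n + 2) * B ^ 4 * (1 / r ^ 3)) := by gcongr
  have e6 : κ * (Cg * (w * (r ^ n)⁻¹)) * (3 * ε * n * (n + 2) * B ^ 4 * (1 / r ^ 3)) =
      κ * (w * (r ^ (n + 3))⁻¹) * (ε * (3 * n * (n + 2) * B ^ 4 * Cg)) := by
    field_simp
    ring
  have h7 := mul_le_mul_of_nonneg_left hcore hκ
  have h8 := mul_le_mul_of_nonneg_left hsmall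
    (by positivity : 0 ≤ κ * (w * (r ^ (n + 3))⁻¹))
  have e8 : κ * (w * (r ^ (n + 3))⁻¹) * (2 ^ (n + 4))⁻¹
      = κ * (w * (2 ^ (n + 4) * r ^ (n + 3))⁻¹) := by
    rw [mul_inv]; ring
  have h9 : γ * (2 * C * B ^ (n + 2) * (1 / r ^ 3)) < A * γ * (l * (n - 3) / r ^ 3) := by
    have t1 : 1 ≤ l * ((n : ℝ) - 3) := one_le_mul_of_one_le_of_one_le hl (by linarith only [hn'])
    have t2 : 0 < γ * (1 / r ^ 3) := by positivity
    calc γ * (2 * C * B ^ (n + 2) * (1 / r ^ 3)) = γ * (1 / r ^ 3) * (2 * C * B ^ (n + 2)) := by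
          ring
      _ < γ * (1 / r ^ 3) * A := by gcongr
      _ ≤ γ * (1 / r ^ 3) * A * (l * (n - 3)) := by
          exact le_mul_of_one_le_right (by positivity) t1
      _ = _ := by ring
  have e10 : n * (n + 2) * m / D ^ 2 * (κ * g) = κ * (n * (n + 2) * m / D ^ 2 * g) := by ring
  linarith only [h3, h4, h5, h6, e6, h7, h8, e8, h9, e10]

section Bubble

variable {n : ℕ} {l l' R : ℝ} {e y : Euc n}

lemma abs_inner_le_norm_of_unit (he : ‖e‖ = 1) (y : Euc n) : |(inner ℝ e y : ℝ)| ≤ ‖y‖ := by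
  simpa [he] using abs_real_inner_le_norm e y

lemma barD_inversion (hl : 0 < l) (hy : y ≠ 0) :
    barD l' R e ((l ^ 2 / ‖y‖ ^ 2) • y) =
      l ^ 2 / ‖y‖ ^ 2 * (barD l R e y + (l' ^ 2 / l ^ 2 - 1) * ‖y‖ ^ 2) := by
  have hy' : ‖y‖ ≠ 0 := norm_ne_zero_iff.2 hy
  rw [barD, barD, norm_inv_smul hy, inner_smul_right]
  field_simp
  ring

lemma kelvin_bubble (hl : 0 < l) (hy : y ≠ 0) (hD : 0 < barD l' R e ((l ^ 2 / ‖y‖ ^ 2) • y)) :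
    0 < barD l R e y + (l' ^ 2 / l ^ 2 - 1) * ‖y‖ ^ 2 ∧
    kelvin l (fun z => barD l' R e z ^ (-(((n : ℝ) - 2) / 2))) y =
      (barD l R e y + (l' ^ 2 / l ^ 2 - 1) * ‖y‖ ^ 2) ^ (-(((n : ℝ) - 2) / 2)) := by
  have hy' : 0 < ‖y‖ := norm_pos_iff.2 hy
  have hθ : 0 < l ^ 2 / ‖y‖ ^ 2 := by positivity
  rw [barD_inversion hl hy] at hD
  have h1 := pos_of_mul_pos_right hD hθ.le
  refine ⟨h1, ?_⟩
  rw [kelvin, barD_inversion hl hy, Real.mul_rpow hθ.le h1.le, ← mul_assoc, ← Real.rpow_add hθ]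
  simp

lemma exists_tol (α p : ℝ) {ε : ℝ} (hε : 0 < ε) :
    ∃ η > 0, η < 1 ∧ ∀ v θ : ℝ, |v - 1| ≤ η → |θ - 1| ≤ η →
      0 < v * θ ^ (-α) ∧ v * θ ^ (-α) ≤ 2 ∧ |v * θ ^ (-α) - 1| ≤ ε ∧
      |(v * θ ^ (-α)) ^ p - 1| ≤ ε ∧ 1 - ε ≤ (v * θ ^ (-α)) ^ (p - 1) := by
  have hc : ContinuousAt (fun q : ℝ × ℝ => q.1 * q.2 ^ (-α)) (1, 1) :=
    continuousAt_fst.mul (continuousAt_snd.rpow_const (Or.inl one_ne_zero))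
  have h1 : ((1, 1) : ℝ × ℝ).1 * ((1, 1) : ℝ × ℝ).2 ^ (-α) = 1 := by simp
  have hcp : ∀ s : ℝ, ContinuousAt (fun q : ℝ × ℝ => (q.1 * q.2 ^ (-α)) ^ s) (1, 1) := fun s =>
    hc.rpow_const (Or.inl (by rw [h1]; exact one_ne_zero))
  have ev : ∀ s : ℝ, ∀ δ > 0, ∀ᶠ q : ℝ × ℝ in 𝓝 (1, 1), |(q.1 * q.2 ^ (-α)) ^ s - 1| < δ := by
    intro s δ hδ
    have := (hcp s).eventually (Metric.ball_mem_nhds _ hδ)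
    simpa [Real.dist_eq] using this
  have ev1 : ∀ δ > 0, ∀ᶠ q : ℝ × ℝ in 𝓝 (1, 1), |q.1 * q.2 ^ (-α) - 1| < δ := by
    intro δ hδ
    simpa using ev 1 δ hδ
  have hall := (ev1 (1 / 2) (by norm_num)).and ((ev1 ε hε).and ((ev p ε hε).and (ev (p - 1) ε hε)))
  obtain ⟨η, hη, h⟩ := Metric.eventually_nhds_iff_ball.1 hall
  refine ⟨min (η / 2) (1 / 2), by positivity, by
    have := min_le_right (η / 2) (1 / 2 : ℝ); linarith, fun v θ hv hθ => ?_⟩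
  have hm := min_le_left (η / 2) (1 / 2 : ℝ)
  obtain ⟨a1, a2, a3, a4⟩ := h (v, θ) (by
    rw [mem_ball, Prod.dist_eq, Real.dist_eq, Real.dist_eq]
    exact max_lt (by linarith) (by linarith))
  simp only at a1 a2 a3 a4
  obtain ⟨b1, b2⟩ := abs_lt.1 a1
  obtain ⟨b3, b4⟩ := abs_lt.1 a4
  exact ⟨by linarith, by linarith, a2.le, a3.le, by linarith⟩

/-- The density of the gradient part of the comparison function. -/
def barG (n : ℕ) (l R : ℝ) (e y : Euc n) : ℝ :=
  R / (32 * n) * (barD l R e y ^ (-((n : ℝ) / 2)) * (2 - barD l R e y / (‖y‖ ^ 2 + l ^ 2)))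
    + coreA2 n * (‖y‖ ^ 2 + 2 * l ^ 2) ^ (-(((n + 1 : ℕ) : ℝ) / 2))

lemma barD_div_le (hl : 0 < l) (hR : 0 ≤ R) (hRl : R ≤ l) (he : ‖e‖ = 1) (y : Euc n) :
    barD l R e y / (‖y‖ ^ 2 + l ^ 2) ≤ 2 := by
  rw [div_le_iff₀ (by positivity), barD]
  have h1 := (abs_le.1 (abs_inner_le_norm_of_unit he y)).1
  have h2 : R * (-‖y‖) ≤ R * inner ℝ e y := by gcongr
  have h3 : R * ‖y‖ ≤ l * ‖y‖ := by gcongr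
  nlinarith only [h2, h3, sq_nonneg (‖y‖ - l)]

lemma barD_ge_sq (he : ‖e‖ = 1) (hR : 1 ≤ R) (hl : 0 < l)
    (hm1 : 1 / 2 ≤ l ^ 2 - R ^ 2) (hm2 : l ^ 2 - R ^ 2 ≤ 2) :
    (‖y‖ / (4 * R)) ^ 2 ≤ barD l R e y :=
  barD_lower' hR hm1 hm2 hl (abs_le.1 (abs_inner_le_norm_of_unit he y)).2

lemma barD_pos (he : ‖e‖ = 1) (hm : 0 < l ^ 2 - R ^ 2) : 0 < barD l R e y := by
  rw [barD_eq l R he]; positivity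

def coreG (n : ℕ) (R : ℝ) : ℝ := R * (4 * R) ^ n + coreA2 n

lemma barG_bounds (hn : 4 ≤ n) (he : ‖e‖ = 1) (hR : 1 ≤ R) (hl : 1 ≤ l)
    (hm1 : 1 / 2 ≤ l ^ 2 - R ^ 2) (hm2 : l ^ 2 - R ^ 2 ≤ 2) (hy : l ≤ ‖y‖) :
    0 ≤ barG n l R e y ∧ barG n l R e y ≤ coreG n R * (‖y‖ ^ n)⁻¹ := by
  have hn' : (4 : ℝ) ≤ n := by exact_mod_cast hn
  have hl0 : 0 < l := by linarith
  have hr : 1 ≤ ‖y‖ := hl.trans hy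
  have hr0 : 0 < ‖y‖ := by linarith
  have hRl : R ≤ l := by nlinarith
  have hD : 0 < barD l R e y := barD_pos he (by linarith)
  have h2 := barD_div_le hl0 (by linarith) hRl he y
  have h0 : 0 ≤ barD l R e y / (‖y‖ ^ 2 + l ^ 2) := by positivity
  have hA : 0 < coreA2 n := by unfold coreA2; positivity
  have hP : barD l R e y ^ (-((n : ℝ) / 2)) ≤ (4 * R) ^ n * (‖y‖ ^ n)⁻¹ := by
    refine (rpow_neg_half_le (by positivity) (barD_ge_sq he hR hl0 hm1 hm2)).trans_eq ?_
    rw [div_pow]; field_simp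
  have hQ : (‖y‖ ^ 2 + 2 * l ^ 2) ^ (-(((n + 1 : ℕ) : ℝ) / 2)) ≤ (‖y‖ ^ n)⁻¹ := by
    refine (rpow_neg_half_le hr0 (by nlinarith)).trans ?_
    gcongr
    omega
  have hP0 : 0 < barD l R e y ^ (-((n : ℝ) / 2)) := by positivity
  have hRn : 0 ≤ R / (32 * n) := by positivity
  refine ⟨?_, ?_⟩
  · have : 0 ≤ 2 - barD l R e y / (‖y‖ ^ 2 + l ^ 2) := by linarith
    unfold barG
    positivity
  · have h3 : R / (32 * n) * 2 ≤ R := by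
      rw [div_mul_eq_mul_div, div_le_iff₀ (by positivity)]
      nlinarith
    calc barG n l R e y ≤ R / (32 * n) * (((4 * R) ^ n * (‖y‖ ^ n)⁻¹) * 2)
          + coreA2 n * (‖y‖ ^ n)⁻¹ := by
          unfold barG
          gcongr
          linarith
      _ = R / (32 * n) * 2 * ((4 * R) ^ n * (‖y‖ ^ n)⁻¹) + coreA2 n * (‖y‖ ^ n)⁻¹ := by ring
      _ ≤ R * ((4 * R) ^ n * (‖y‖ ^ n)⁻¹) + coreA2 n * (‖y‖ ^ n)⁻¹ := by gcongr
      _ = _ := by unfold coreG; ring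

def coreGrad (n : ℕ) (R : ℝ) : ℝ :=
  R * (12 * (4 * R) ^ n + 4 * n * (4 * R) ^ (n + 2)) + coreA2 n * (n + 3)

lemma hasLap_barG (hn : 4 ≤ n) (he : ‖e‖ = 1) (hR : 2 ≤ R) (hRC : 192 * coreC n ≤ R ^ 2)
    (hRA : 128 * 2 ^ n * coreA2 n * coreC n ≤ R ^ 2) (hl : 1 ≤ l)
    (hm1 : 1 / 2 ≤ l ^ 2 - R ^ 2) (hm2 : l ^ 2 - R ^ 2 ≤ 2) (hy : l ≤ ‖y‖) :
    ∃ g L, HasLap (fun z => (‖z‖ ^ 2 - l ^ 2) * barG n l R e z) y g L ∧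
      ‖g‖ ≤ coreGrad n R * (‖y‖ * (‖y‖ ^ n)⁻¹) ∧
      (‖y‖ ^ 2 - l ^ 2) * (2 ^ (n + 4) * ‖y‖ ^ (n + 3))⁻¹ ≤
        L + n * (n + 2) * (l ^ 2 - R ^ 2) / barD l R e y ^ 2 *
          ((‖y‖ ^ 2 - l ^ 2) * barG n l R e y)
          + (‖y‖ ^ 2 - l ^ 2) / ‖y‖ ^ 2 * inner ℝ e y *
            (barD l R e y ^ (-((n : ℝ) / 2)) / barD l R e y) := by
  have hn' : (4 : ℝ) ≤ n := by exact_mod_cast hn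
  have hl0 : 0 < l := by linarith
  have hr : 1 ≤ ‖y‖ := hl.trans hy
  have hr0 : 0 < ‖y‖ := by linarith
  have hRl : R ≤ l := by nlinarith
  have hD : 0 < barD l R e y := barD_pos he (by linarith)
  obtain ⟨L1, h1, h1'⟩ := hasLap_bar1 hl0 he y hD
  have h2 := hasLap_bar2 hl0 y
  have hc := core_ineq hn hR hRC hRA hm1 hm2 hl0 hy (abs_inner_le_norm_of_unit he y)
    (D := barD l R e y) rfl rfl rfl
  have hsum := (h1.const_mul (R / (32 * n))).add (h2.const_mul (coreA2 n))
  refine ⟨_, _, hsum.congr (Eventually.of_forall fun z => ?_), ?_, ?_⟩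
  · simp only [barG]; ring
  · set D := barD l R e y with hDdef
    set P := D ^ (-((n : ℝ) / 2)) with hPdef
    set Q := (‖y‖ ^ 2 + 2 * l ^ 2) ^ (-(((n + 1 : ℕ) : ℝ) / 2)) with hQdef
    set r := ‖y‖ with hrdef
    have hP0 : 0 < P := by positivity
    have hQ0 : 0 < Q := by positivity
    have hA : 0 < coreA2 n := by unfold coreA2; positivity
    have hDsq : (r / (4 * R)) ^ 2 ≤ D := barD_ge_sq he (by linarith) hl0 hm1 hm2
    have hP : P ≤ (4 * R) ^ n * (r ^ n)⁻¹ := by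
      refine (rpow_neg_half_le (by positivity) hDsq).trans_eq ?_
      rw [div_pow]; field_simp
    have hQ : Q ≤ (r ^ n)⁻¹ := by
      refine (rpow_neg_half_le hr0 (by nlinarith only [sq_nonneg l])).trans ?_
      gcongr
      omega
    have hDi : 1 / D ≤ (4 * R) ^ 2 / r ^ 2 := by
      rw [div_pow, div_le_iff₀ (by positivity)] at hDsq
      rw [div_le_div_iff₀ hD (by positivity)]
      linarith
    have hPD : P / D ≤ (4 * R) ^ (n + 2) * ((r ^ n)⁻¹ / r ^ 2) := by
      calc P / D = P * (1 / D) := by ring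
        _ ≤ ((4 * R) ^ n * (r ^ n)⁻¹) * ((4 * R) ^ 2 / r ^ 2) := by gcongr
        _ = _ := by ring
    have hw0 : 0 ≤ r ^ 2 - l ^ 2 := by
      have : l ^ 2 ≤ r ^ 2 := by gcongr
      linarith
    have hwr : r ^ 2 - l ^ 2 ≤ r ^ 2 := by linarith only [sq_nonneg l]
    have hS : r ^ 2 ≤ r ^ 2 + l ^ 2 := by linarith only [sq_nonneg l]
    have hDS : D / (r ^ 2 + l ^ 2) ≤ 2 := barD_div_le hl0 (by linarith) hRl he y
    have hDS0 : 0 ≤ D / (r ^ 2 + l ^ 2) := by positivity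
    have n1 : ‖(2 : ℝ) • y‖ = 2 * r := by rw [norm_smul, Real.norm_two]
    have n2 : ‖(2 : ℝ) • y - (2 * R) • e‖ ≤ 4 * r := by
      refine (norm_sub_le _ _).trans ?_
      rw [n1, norm_smul, he, Real.norm_eq_abs, abs_of_nonneg (by linarith)]
      linarith
    set w := (2 : ℝ) • y - (2 * R) • e with hwdef
    have hDS2 : D / (r ^ 2 + l ^ 2) ^ 2 ≤ 2 / r ^ 2 := by
      calc D / (r ^ 2 + l ^ 2) ^ 2 = D / (r ^ 2 + l ^ 2) * (1 / (r ^ 2 + l ^ 2)) := by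
            field_simp
        _ ≤ 2 * (1 / r ^ 2) := by gcongr
        _ = _ := by ring
    have t1 : ‖(D / (r ^ 2 + l ^ 2) ^ 2) • (2 : ℝ) • y - (1 / (r ^ 2 + l ^ 2)) • w‖ ≤ 8 / r := by
      refine (norm_sub_le _ _).trans ?_
      rw [norm_smul, n1, norm_smul, Real.norm_of_nonneg (by positivity),
        Real.norm_of_nonneg (by positivity)]
      calc _ ≤ 2 / r ^ 2 * (2 * r) + 1 / r ^ 2 * (4 * r) := by gcongr
        _ = _ := by field_simp; norm_num
    have t2 : ‖(2 - D / (r ^ 2 + l ^ 2)) • (-((n : ℝ) / 2) * (P / D)) • w‖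
        ≤ 4 * n * (P / D) * r := by
      rw [norm_smul, norm_smul, norm_mul, norm_neg, Real.norm_of_nonneg (by linarith),
        Real.norm_of_nonneg (by positivity : (0 : ℝ) ≤ n / 2),
        Real.norm_of_nonneg (by positivity : 0 ≤ P / D)]
      calc _ ≤ 2 * ((n : ℝ) / 2 * (P / D) * (4 * r)) := by gcongr; linarith
        _ = _ := by ring
    have t3 : ‖(P * (2 - D / (r ^ 2 + l ^ 2))) • (2 : ℝ) • y‖ ≤ 4 * P * r := by
      rw [norm_smul, n1, norm_mul, Real.norm_of_nonneg hP0.le, Real.norm_of_nonneg (by linarith)]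
      calc _ ≤ P * 2 * (2 * r) := by gcongr; linarith
        _ = _ := by ring
    have hE : 0 < r ^ 2 + 2 * l ^ 2 := by positivity
    have t4 : ‖(2 * Q * (1 - ((n : ℝ) + 1) / 2 * (r ^ 2 - l ^ 2) / (r ^ 2 + 2 * l ^ 2))) • y‖
        ≤ (n + 3) * Q * r := by
      have q0 : 0 ≤ ((n : ℝ) + 1) / 2 * (r ^ 2 - l ^ 2) / (r ^ 2 + 2 * l ^ 2) := by positivity
      have q1 : ((n : ℝ) + 1) / 2 * (r ^ 2 - l ^ 2) / (r ^ 2 + 2 * l ^ 2) ≤ (n + 1) / 2 := by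
        rw [div_le_iff₀ hE]
        gcongr
        linarith only [sq_nonneg l]
      have q2 : |1 - ((n : ℝ) + 1) / 2 * (r ^ 2 - l ^ 2) / (r ^ 2 + 2 * l ^ 2)| ≤
          ((n : ℝ) + 3) / 2 := by
        rw [abs_le]; constructor <;> linarith
      rw [norm_smul, norm_mul, norm_mul, Real.norm_of_nonneg hQ0.le, Real.norm_eq_abs (1 - _)]
      calc _ ≤ ‖(2 : ℝ)‖ * Q * ((n + 3) / 2) * r := by gcongr
        _ = _ := by rw [Real.norm_two]; ring
    have hR32 : R / (32 * n) ≤ R := div_le_self (by linarith) (by linarith)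
    refine (norm_add_le _ _).trans ?_
    rw [norm_smul (R / (32 * n)), norm_smul (coreA2 n), Real.norm_of_nonneg hA.le,
      Real.norm_of_nonneg (by positivity : 0 ≤ R / (32 * n))]
    have t5 : ‖(r ^ 2 - l ^ 2) • (P • ((D / (r ^ 2 + l ^ 2) ^ 2) • (2 : ℝ) • y
          - (1 / (r ^ 2 + l ^ 2)) • w) + (2 - D / (r ^ 2 + l ^ 2)) •
          (-((n : ℝ) / 2) * (P / D)) • w) + (P * (2 - D / (r ^ 2 + l ^ 2))) • (2 : ℝ) • y‖ ≤
        (12 * (4 * R) ^ n + 4 * n * (4 * R) ^ (n + 2)) * (r * (r ^ n)⁻¹) := by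
      refine (norm_add_le _ _).trans ?_
      rw [norm_smul, Real.norm_of_nonneg hw0]
      calc _ ≤ r ^ 2 * (P * (8 / r) + 4 * n * (P / D) * r) + 4 * P * r := by
            gcongr
            refine (norm_add_le _ _).trans ?_
            rw [norm_smul P, Real.norm_of_nonneg hP0.le]
            gcongr
        _ ≤ r ^ 2 * (((4 * R) ^ n * (r ^ n)⁻¹) * (8 / r) +
              4 * n * ((4 * R) ^ (n + 2) * ((r ^ n)⁻¹ / r ^ 2)) * r) +
              4 * ((4 * R) ^ n * (r ^ n)⁻¹) * r := by gcongr
        _ = _ := by field_simp; ring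
    calc _ ≤ R * ((12 * (4 * R) ^ n + 4 * n * (4 * R) ^ (n + 2)) * (r * (r ^ n)⁻¹))
          + coreA2 n * ((n + 3) * (r ^ n)⁻¹ * r) := by
          gcongr
          refine t4.trans ?_
          gcongr
      _ = _ := by unfold coreGrad; ring
  · refine hc.trans_eq ?_
    rw [← h1', barG]
    ring

lemma continuousOn_barG {a₀ a₁ : ℝ} (ha : 1 ≤ a₀) (he : ‖e‖ = 1)
    (hm1 : 1 / 2 ≤ a₀ ^ 2 - R ^ 2) :
    ContinuousOn (fun p : ℝ × Euc n => barG n p.1 R e p.2) (Icc a₀ a₁ ×ˢ univ) := by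
  have hDc : Continuous fun p : ℝ × Euc n => barD p.1 R e p.2 := by unfold barD; fun_prop
  have hD : ∀ p ∈ Icc a₀ a₁ ×ˢ (univ : Set (Euc n)), barD p.1 R e p.2 ≠ 0 := by
    rintro p ⟨hp, -⟩
    have : a₀ ^ 2 ≤ p.1 ^ 2 := by have := hp.1; gcongr
    exact (barD_pos he (by linarith)).ne'
  have hp0 : ∀ p ∈ Icc a₀ a₁ ×ˢ (univ : Set (Euc n)), 0 < p.1 := fun p hp => by
    have := hp.1.1; linarith
  unfold barG
  refine ContinuousOn.add (continuousOn_const.mul (ContinuousOn.mul ?_ ?_))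
    (continuousOn_const.mul ?_)
  · exact hDc.continuousOn.rpow_const fun p hp => Or.inl (hD p hp)
  · refine continuousOn_const.sub (hDc.continuousOn.div (by fun_prop) fun p hp => ?_)
    have := hp0 p hp; positivity
  · refine ContinuousOn.rpow_const (by fun_prop) fun p hp => Or.inl ?_
    have := hp0 p hp; positivity

end Bubble

/-- The standard bubble centred at `R • e`. -/
def bubble (n : ℕ) (R : ℝ) (e y : Euc n) : ℝ :=
  barD (√(1 + R ^ 2)) R e y ^ (-(((n : ℝ) - 2) / 2))

/-- The density of the comparison function of the moving sphere method. -/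
def cmpG (n : ℕ) (R : ℝ) (e : Euc n) (κ s l : ℝ) (y : Euc n) : ℝ :=
  κ * barG n l R e y + s / (‖y‖ * (‖y‖ + l))

/-- A sequence of rescaled solutions, seen from the points at distance `R` of the blow-up points
in the direction opposite to the gradient of the coefficient. -/
structure BlowUp (n : ℕ) (j : Fin n) (R Λ : ℝ) (e : ℕ → Euc n) (κ Γ T : ℕ → ℝ)
    (V 𝒦 : ℕ → Euc n → ℝ) : Prop where
  norm_e : ∀ i, ‖e i‖ = 1
  κ_nonneg : ∀ i, 0 ≤ κ i
  κ_lim : Tendsto κ atTop (𝓝 0)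
  κΓ_le : ∀ i, κ i * Γ i ≤ Λ
  Γ_lim : Tendsto Γ atTop atTop
  T_lim : Tendsto T atTop atTop
  cont : ∀ᶠ i in atTop, ContinuousOn (V i) {y | ‖y‖ ≤ Γ i / 8 ∧ -T i ≤ y j}
  diff : ∀ᶠ i in atTop, ∀ y, ‖y‖ < Γ i / 8 → -T i < y j → ContDiffAt ℝ 2 (V i) y
  low : ∀ Q : ℝ, ∀ᶠ i in atTop, ∀ y, ‖y‖ ≤ Γ i / 8 → -T i ≤ y j →
    0 < V i y ∧ Q * (Γ i ^ (n - 2))⁻¹ ≤ V i y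
  pde : ∀ᶠ i in atTop, ∀ y, ‖y‖ < Γ i / 8 → -T i < y j →
    ∃ g, HasLap (V i) y g (-(𝒦 i y * V i y ^ (((n : ℝ) + 2) / (n - 2))))
  bdry : ∀ᶠ i in atTop, ∀ y, ‖y‖ < Γ i / 8 → y j = -T i →
    ∃ d, d ≤ Λ * V i y ^ ((n : ℝ) / (n - 2)) ∧
      HasDerivWithinAt (fun t : ℝ => V i (y + t • EuclideanSpace.single j 1)) d (Ici 0) 0
  conv : ∀ ρ η : ℝ, 0 < η → ∀ᶠ i in atTop, ∀ y, ‖y‖ ≤ ρ →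
    |V i y - bubble n R (e i) y| ≤ η ∧
      ‖fderiv ℝ (V i) y - fderiv ℝ (bubble n R (e i)) y‖ ≤ η
  K_pos : ∀ᶠ i in atTop, ∀ y, ‖y‖ ≤ Γ i / 8 → -T i ≤ y j → 0 < 𝒦 i y
  K_lim : ∀ ρ ε : ℝ, 0 < ε → ∀ᶠ i in atTop, ∀ y, ‖y‖ ≤ ρ → n * (n - 2) * (1 - ε) ≤ 𝒦 i y
  osc : ∀ ε : ℝ, 0 < ε → ∃ C : ℝ, 0 < C ∧ ∀ᶠ i in atTop, ∀ (l : ℝ) (y : Euc n), 1 ≤ l →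
    l ≤ T i → l ≤ ‖y‖ → ‖y‖ ≤ Γ i / 8 → -T i ≤ y j →
    𝒦 i ((l ^ 2 / ‖y‖ ^ 2) • y) - 𝒦 i y ≤
      κ i * ((‖y‖ ^ 2 - l ^ 2) / ‖y‖ ^ 2 * (-inner ℝ (e i) y + ε * ‖y‖)) +
        C * (Γ i ^ (n - 2))⁻¹ * ((‖y‖ ^ 2 - l ^ 2) * ‖y‖ ^ (n - 4))

section

variable {n : ℕ} {j : Fin n} {R Λ : ℝ} {e : ℕ → Euc n} {κ Γ T : ℕ → ℝ} {V 𝒦 : ℕ → Euc n → ℝ}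

lemma sqrt_one_add_sq (R : ℝ) : √(1 + R ^ 2) ^ 2 = 1 + R ^ 2 := Real.sq_sqrt (by positivity)

lemma barD_sqrt (R : ℝ) {e : Euc n} (he : ‖e‖ = 1) (y : Euc n) :
    barD (√(1 + R ^ 2)) R e y = ‖y - R • e‖ ^ 2 + 1 := by
  rw [barD_eq _ _ he, sqrt_one_add_sq]; ring

lemma barD_sqrt_le {R ρ : ℝ} (hR : 0 ≤ R) {e : Euc n} (he : ‖e‖ = 1) {y : Euc n} (hy : ‖y‖ ≤ ρ) :
    barD (√(1 + R ^ 2)) R e y ≤ (ρ + R) ^ 2 + 1 := by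
  rw [barD_sqrt R he]
  have : ‖y - R • e‖ ≤ ρ + R := by
    refine (norm_sub_le _ _).trans ?_
    rw [norm_smul, he, Real.norm_of_nonneg hR]; linarith
  gcongr

lemma bubble_ge (hn : 4 ≤ n) {R ρ : ℝ} (hR : 0 ≤ R) {e : Euc n} (he : ‖e‖ = 1) {y : Euc n}
    (hy : ‖y‖ ≤ ρ) : ((ρ + R) ^ 2 + 1) ^ (-(((n : ℝ) - 2) / 2)) ≤ bubble n R e y := by
  have hn' : (4 : ℝ) ≤ n := by exact_mod_cast hn
  refine Real.rpow_le_rpow_of_nonpos ?_ (barD_sqrt_le hR he hy) (by linarith)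
  rw [barD_sqrt R he]; positivity

lemma radius_bounds {R l : ℝ} (hR : 1 ≤ R) (hl : 0 < l) (h : |l ^ 2 - (1 + R ^ 2)| ≤ 1 / 4) :
    1 ≤ l ∧ R ≤ l ∧ l ≤ R + 1 ∧ 1 / 2 ≤ l ^ 2 - R ^ 2 ∧ l ^ 2 - R ^ 2 ≤ 2 := by
  obtain ⟨h1, h2⟩ := abs_le.1 h
  have hRl : R ≤ l := by nlinarith
  exact ⟨by linarith, hRl, by nlinarith, by linarith, by linarith⟩

/-- Near the critical radius, the Kelvin transform of the solution is close to a bubble. -/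
lemma BlowUp.kelvin_close (h : BlowUp n j R Λ e κ Γ T V 𝒦) (hn : 4 ≤ n) (hR : 1 ≤ R) (p : ℝ)
    {ε : ℝ} (hε : 0 < ε) :
    ∃ τ > 0, τ ≤ 1 / 4 ∧ ∀ᶠ i in atTop, ∀ l, 0 < l → |l ^ 2 - (1 + R ^ 2)| ≤ τ →
      ∀ y, l ≤ ‖y‖ → ∃ ρ, 0 < ρ ∧ ρ ≤ 2 ∧ |ρ - 1| ≤ ε ∧ |ρ ^ p - 1| ≤ ε ∧ 1 - ε ≤ ρ ^ (p - 1) ∧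
        kelvin l (V i) y = ρ * barD l R (e i) y ^ (-(((n : ℝ) - 2) / 2)) := by
  obtain ⟨η, hη, hη1, htol⟩ := exists_tol (((n : ℝ) - 2) / 2) p hε
  set u0 := ((R + 1 + R) ^ 2 + 1) ^ (-(((n : ℝ) - 2) / 2)) with hu0
  have hu0p : 0 < u0 := by positivity
  refine ⟨min (η / 2) (1 / 4), by positivity, min_le_right _ _, ?_⟩
  filter_upwards [h.conv (R + 1) (η * u0) (by positivity)] with i hi l hl hlR y hy
  have he := h.norm_e i
  obtain ⟨hl1, hRl, hlR1, hm1, hm2⟩ := radius_bounds hR hl (hlR.trans (min_le_right _ _))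
  have hr0 : 0 < ‖y‖ := by linarith
  have hy0 : y ≠ 0 := norm_pos_iff.1 hr0
  have hz : ‖(l ^ 2 / ‖y‖ ^ 2) • y‖ ≤ R + 1 := by
    rw [norm_inv_smul hy0, div_le_iff₀ hr0]; nlinarith
  set z := (l ^ 2 / ‖y‖ ^ 2) • y with hzdef
  have hbz : u0 ≤ bubble n R (e i) z := bubble_ge hn (by linarith) he hz
  have hbz0 : 0 < bubble n R (e i) z := hu0p.trans_le hbz
  have hDz : 0 < barD (√(1 + R ^ 2)) R (e i) z := by rw [barD_sqrt R he]; positivity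
  obtain ⟨hD'0, hkb⟩ := kelvin_bubble (n := n) (R := R) (e := e i) hl hy0 hDz
  set D := barD l R (e i) y with hD
  have hD0 : 0 < D := barD_pos he (by linarith)
  set D' := D + (√(1 + R ^ 2) ^ 2 / l ^ 2 - 1) * ‖y‖ ^ 2 with hD'
  have hθ : |D' / D - 1| ≤ η := by
    have hm0 : 0 < l ^ 2 - R ^ 2 := by linarith
    have h1 := barD_lower (R := R) hl (by linarith) (abs_le.1 (abs_inner_le_norm_of_unit he y)).2
    have h2 : D' / D - 1 = (1 + R ^ 2 - l ^ 2) / l ^ 2 * ‖y‖ ^ 2 / D := by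
      rw [hD', sqrt_one_add_sq]; field_simp; ring
    have h3 : |l ^ 2 - (1 + R ^ 2)| ≤ η / 2 := hlR.trans (min_le_left _ _)
    rw [h2, abs_div, abs_mul, abs_div, abs_of_pos hD0, abs_of_nonneg (sq_nonneg l),
      abs_of_nonneg (sq_nonneg ‖y‖), div_le_iff₀ hD0, abs_sub_comm]
    calc |l ^ 2 - (1 + R ^ 2)| / l ^ 2 * ‖y‖ ^ 2
        ≤ (η * (l ^ 2 - R ^ 2)) / l ^ 2 * ‖y‖ ^ 2 := by
          gcongr
          refine h3.trans ?_
          rw [div_eq_mul_one_div]; gcongr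
      _ = η * ((l ^ 2 - R ^ 2) / l ^ 2 * ‖y‖ ^ 2) := by ring
      _ ≤ η * D := by gcongr; exact h1
  have hv : |V i z / bubble n R (e i) z - 1| ≤ η := by
    have h1 : V i z / bubble n R (e i) z - 1 =
        (V i z - bubble n R (e i) z) / bubble n R (e i) z := by field_simp
    rw [h1, abs_div, abs_of_pos hbz0, div_le_iff₀ hbz0]
    exact (hi z hz).1.trans (by gcongr)
  obtain ⟨t1, t2, t3, t4, t5⟩ := htol _ _ hv hθ
  refine ⟨_, t1, t2, t3, t4, t5, ?_⟩
  have e1 : kelvin l (V i) y = V i z / bubble n R (e i) z * kelvin l (bubble n R (e i)) y := by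
    rw [kelvin, kelvin, ← hzdef]; field_simp
  have e2 : D' = D' / D * D := by field_simp
  have e3 : kelvin l (bubble n R (e i)) y = D' ^ (-(((n : ℝ) - 2) / 2)) := hkb
  rw [e1, e3]
  nth_rewrite 1 [e2]
  rw [Real.mul_rpow (by positivity) hD0.le]
  ring

lemma sub_sq_mul_cmpG {e : Euc n} {κ s l : ℝ} {y : Euc n} (hl : 0 < l) (hy : y ≠ 0) :
    (‖y‖ ^ 2 - l ^ 2) * cmpG n R e κ s l y =
      κ * ((‖y‖ ^ 2 - l ^ 2) * barG n l R e y) + s * (1 - l / ‖y‖) := by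
  have hr0 : 0 < ‖y‖ := norm_pos_iff.2 hy
  rw [cmpG]; field_simp; ring

lemma exists_core_radius (n : ℕ) : ∃ R : ℝ, 2 ≤ R ∧ 192 * coreC n ≤ R ^ 2 ∧
    128 * 2 ^ n * coreA2 n * coreC n ≤ R ^ 2 := by
  have h1 := (tendsto_pow_atTop (α := ℝ) two_ne_zero)
  exact ((eventually_ge_atTop 2).and ((h1.eventually_ge_atTop _).and
    (h1.eventually_ge_atTop _))).exists

lemma kelvin_rpow (hn : 4 ≤ n) {l : ℝ} (f : Euc n → ℝ) (y : Euc n)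
    (hf : 0 ≤ f ((l ^ 2 / ‖y‖ ^ 2) • y)) :
    kelvin l f y ^ (((n : ℝ) + 2) / (n - 2)) = (l ^ 2 / ‖y‖ ^ 2) ^ (((n : ℝ) + 2) / 2) *
      f ((l ^ 2 / ‖y‖ ^ 2) • y) ^ (((n : ℝ) + 2) / (n - 2)) := by
  have hn' : (4 : ℝ) ≤ n := by exact_mod_cast hn
  rw [kelvin, Real.mul_rpow (by positivity) hf, ← Real.rpow_mul (by positivity)]
  congr 2
  field_simp [show (n : ℝ) - 2 ≠ 0 by linarith]

lemma reflected_mem {l b T : ℝ} {y : Euc n} (hl : 0 < l) (hlb : l < b) (hlT : l < T)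
    (hy : l ≤ ‖y‖) : ‖(l ^ 2 / ‖y‖ ^ 2) • y‖ ≤ l ∧ ‖(l ^ 2 / ‖y‖ ^ 2) • y‖ < b ∧
      -T < ((l ^ 2 / ‖y‖ ^ 2) • y) j := by
  have hr0 : 0 < ‖y‖ := by linarith
  have hz : ‖(l ^ 2 / ‖y‖ ^ 2) • y‖ ≤ l := by
    rw [norm_inv_smul (norm_pos_iff.1 hr0), div_le_iff₀ hr0]; nlinarith
  refine ⟨hz, by linarith, ?_⟩
  have := (abs_le.1 (abs_coord_le_norm ((l ^ 2 / ‖y‖ ^ 2) • y) j)).1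
  linarith

lemma BlowUp.interior (h : BlowUp n j R Λ e κ Γ T V 𝒦) (hn : 4 ≤ n) (hR : 2 ≤ R)
    (hRC : 192 * coreC n ≤ R ^ 2) (hRA : 128 * 2 ^ n * coreA2 n * coreC n ≤ R ^ 2) :
    ∃ A > 0, ∃ τ > 0, ∀ᶠ i in atTop, ∀ l, 0 < l → |l ^ 2 - (1 + R ^ 2)| ≤ τ →
      ∀ y, l < ‖y‖ → ‖y‖ < Γ i / 8 → -T i < y j →
      0 ≤ sphereDiff (V i) (cmpG n R (e i) (κ i) (A * (Γ i ^ (n - 2))⁻¹)) l y →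
      ∃ g L, HasLap (sphereDiff (V i) (cmpG n R (e i) (κ i) (A * (Γ i ^ (n - 2))⁻¹)) l) y g L ∧
        L < 0 := by
  have hn' : (4 : ℝ) ≤ n := by exact_mod_cast hn
  have hA2 : 0 < coreA2 n := by unfold coreA2; positivity
  have hG0 : 0 < coreG n R := by unfold coreG; positivity
  set S := 3 * n * (n + 2) * (4 * R) ^ 4 * coreG n R + 3 * (4 * R) ^ (n + 2) with hS
  have hS0 : 0 < S := by positivity
  set ε := min (1 / 4) ((2 ^ (n + 4))⁻¹ / S) with hεdef
  have hε : 0 < ε := by positivity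
  have hε4 : ε ≤ 1 / 4 := min_le_left _ _
  have hεS : ε * S ≤ (2 ^ (n + 4))⁻¹ := by
    rw [← le_div_iff₀ hS0]; exact min_le_right _ _
  obtain ⟨τ, hτ, hτ4, hk⟩ := h.kelvin_close hn (by linarith) (((n : ℝ) + 2) / (n - 2)) hε
  obtain ⟨C, hC, hosc⟩ := h.osc ε hε
  refine ⟨2 * C * (4 * R) ^ (n + 2) + 1, by positivity, min τ ε, by positivity, ?_⟩
  set A := 2 * C * (4 * R) ^ (n + 2) + 1 with hA
  filter_upwards [hk, hosc, h.pde, h.low 0, h.K_pos, h.K_lim ε⁻¹ ε hε,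
    h.Γ_lim.eventually_gt_atTop (8 * (R + 1)), h.T_lim.eventually_gt_atTop (R + 1)]
    with i hk hosc hpde hlow hKpos hKlim hΓ hT l hl hlR y hly hyb hyT hZ
  have he := h.norm_e i
  have hlτ := hlR.trans (min_le_left _ _)
  obtain ⟨hl1, hRl, hlR1, hm1, hm2⟩ := radius_bounds (by linarith) hl (hlτ.trans hτ4)
  have hm3 : l ^ 2 - R ^ 2 ≤ 1 + ε := by
    have := (abs_le.1 (hlR.trans (min_le_right _ _))).2
    linarith
  have hr0 : 0 < ‖y‖ := by linarith
  have hy0 : y ≠ 0 := norm_pos_iff.1 hr0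
  have hΓ0 : 0 < Γ i := by linarith
  obtain ⟨hzl, hzb, hzT⟩ := reflected_mem (j := j) hl (by linarith : l < Γ i / 8)
    (by linarith : l < T i) hly.le
  obtain ⟨ρ, hρ0, hρ2, -, hρp, hρp1, hW⟩ := hk l hl hlτ y hly.le
  obtain ⟨g1, hg1⟩ := hpde y hyb hyT
  obtain ⟨g2, hg2⟩ := hpde _ hzb hzT
  obtain ⟨g3, L3, hg3, -, hcore⟩ := hasLap_barG hn he hR hRC hRA hl1 hm1 hm2 hly.le
  have hg4 := hasLap_bar3 l hy0
  have hsum := (hg1.sub (hg2.kelvin l hl hy0)).sub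
    ((hg3.const_mul (κ i)).add (hg4.const_mul (A * (Γ i ^ (n - 2))⁻¹)))
  have hG := barG_bounds hn he (by linarith) hl1 hm1 hm2 hly.le
  have hw0 : 0 ≤ ‖y‖ ^ 2 - l ^ 2 := by
    have : l ^ 2 ≤ ‖y‖ ^ 2 := by gcongr
    linarith
  refine ⟨_, _, hsum.congr ?_, ?_⟩
  · filter_upwards [eventually_ne_nhds hy0] with z hz
    rw [sphereDiff, sub_sq_mul_cmpG hl hz]
  · have hVz := (hlow _ hzb.le hzT.le).1
    have key := interior_neg hn (Kl := 𝒦 i ((l ^ 2 / ‖y‖ ^ 2) • y)) (Ky := 𝒦 i y) (a := V i y)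
      (γ := (Γ i ^ (n - 2))⁻¹) (A := A) (κ := κ i) (Rad := ε⁻¹)
      (Cg := coreG n R) (g := (‖y‖ ^ 2 - l ^ 2) * barG n l R (e i) y) hl1 hly
      (abs_inner_le_norm_of_unit he y) (by linarith)
      (barD_ge_sq he (by linarith) hl hm1 hm2) hm2 hm3 hε (by linarith)
      (by rw [mul_inv_cancel₀ hε.ne']) hρ0 hρp hρp1 (h.κ_nonneg i) (by positivity) (by positivity)
      hC.le (hKpos y hyb.le hyT.le).le (fun hr => hKlim y hr)
      (hosc l y hl1 (by linarith) hly.le hyb.le hyT.le)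
      (mul_nonneg hw0 hG.1) (by
        calc _ ≤ (‖y‖ ^ 2 - l ^ 2) * (coreG n R * (‖y‖ ^ n)⁻¹) := by
              gcongr; exact hG.2
          _ = _ := by ring)
      hcore hεS (by rw [hA]; linarith) (by
        rw [sphereDiff, sub_sq_mul_cmpG hl hy0, hW] at hZ
        linarith)
    refine lt_of_eq_of_lt ?_ key
    rw [← hW, kelvin_rpow hn _ _ hVz.le]
    ring

end

lemma HasLap.hasDerivAt_line {n : ℕ} {f : Euc n → ℝ} {y g : Euc n} {L : ℝ} (h : HasLap f y g L)
    (j : Fin n) :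
    HasDerivAt (fun t : ℝ => f (y + t • EuclideanSpace.single j 1)) (g j) 0 := by
  have h1 : HasFDerivAt f (innerSL ℝ g) (y + (0 : ℝ) • EuclideanSpace.single j (1 : ℝ)) := by
    simpa using h.hasFDerivAt
  have h2 : HasDerivAt (fun t : ℝ => y + t • EuclideanSpace.single j (1 : ℝ))
      ((1 : ℝ) • EuclideanSpace.single j (1 : ℝ)) 0 :=
    ((hasDerivAt_id (0 : ℝ)).smul_const _).const_add y
  refine (h1.comp_hasDerivAt (0 : ℝ) h2).congr_deriv ?_
  simp [EuclideanSpace.inner_single_right]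

lemma HasLap.norm_fderiv {n : ℕ} {f : Euc n → ℝ} {y g : Euc n} {L : ℝ} (h : HasLap f y g L) :
    ‖fderiv ℝ f y‖ = ‖g‖ := by
  rw [h.hasFDerivAt.fderiv]; exact innerSL_apply_norm ℝ g

section

variable {n : ℕ} {j : Fin n} {R Λ : ℝ} {e : ℕ → Euc n} {κ Γ T : ℕ → ℝ} {V 𝒦 : ℕ → Euc n → ℝ}

lemma hasLap_bubble (n : ℕ) (R : ℝ) {e : Euc n} (he : ‖e‖ = 1) (y : Euc n) :
    ∃ L, HasLap (bubble n R e) y ((-(((n : ℝ) - 2) / 2) *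
      barD (√(1 + R ^ 2)) R e y ^ (-(((n : ℝ) - 2) / 2) - 1)) • ((2 : ℝ) • y - (2 * R) • e)) L :=
  ⟨_, (hasLap_barD (√(1 + R ^ 2)) R e y).rpow _ (by rw [barD_sqrt R he]; positivity)⟩

lemma norm_fderiv_bubble_le (hn : 4 ≤ n) (hR : 0 ≤ R) {e : Euc n} (he : ‖e‖ = 1) {y : Euc n}
    {ρ : ℝ} (hy : ‖y‖ ≤ ρ) : ‖fderiv ℝ (bubble n R e) y‖ ≤ n * (ρ + R) := by
  have hn' : (4 : ℝ) ≤ n := by exact_mod_cast hn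
  obtain ⟨L, hL⟩ := hasLap_bubble n R he y
  have hD : 1 ≤ barD (√(1 + R ^ 2)) R e y := by
    rw [barD_sqrt R he]; linarith [sq_nonneg ‖y - R • e‖]
  have h1 : barD (√(1 + R ^ 2)) R e y ^ (-(((n : ℝ) - 2) / 2) - 1) ≤ 1 :=
    Real.rpow_le_one_of_one_le_of_nonpos hD (by linarith)
  have h2 : ‖(2 : ℝ) • y - (2 * R) • e‖ ≤ 2 * (ρ + R) := by
    refine (norm_sub_le _ _).trans ?_
    rw [norm_smul, norm_smul, he, Real.norm_two, Real.norm_of_nonneg (by positivity)]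
    linarith
  have hρ : 0 ≤ ρ := (norm_nonneg y).trans hy
  rw [hL.norm_fderiv, norm_smul, norm_mul, norm_neg,
    Real.norm_of_nonneg (by linarith : 0 ≤ ((n : ℝ) - 2) / 2),
    Real.norm_of_nonneg (Real.rpow_nonneg (by linarith) _)]
  calc _ ≤ ((n : ℝ) - 2) / 2 * 1 * (2 * (ρ + R)) := by
        gcongr <;> linarith
    _ = (n - 2) * (ρ + R) := by ring
    _ ≤ _ := by gcongr; linarith

lemma barD_rpow_le (hn : 4 ≤ n) {l : ℝ} {e y : Euc n} (he : ‖e‖ = 1) (hR : 1 ≤ R) (hl : 0 < l)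
    (hm1 : 1 / 2 ≤ l ^ 2 - R ^ 2) (hm2 : l ^ 2 - R ^ 2 ≤ 2) (hy : 0 < ‖y‖) :
    barD l R e y ^ (-(((n : ℝ) - 2) / 2)) ≤ (4 * R) ^ (n - 2) * (‖y‖ ^ (n - 2))⁻¹ := by
  have h := rpow_neg_half_le (n := n - 2) (by positivity) (barD_ge_sq (y := y) he hR hl hm1 hm2)
  rw [Nat.cast_sub (by omega), Nat.cast_two] at h
  refine h.trans_eq ?_
  rw [div_pow]; field_simp

/-- An upper bound for the Kelvin transform plus the comparison function. -/
lemma cmp_le (hn : 4 ≤ n) {l ρ κ A Γ : ℝ} {e y : Euc n} (he : ‖e‖ = 1) (hR : 1 ≤ R) (hl : 1 ≤ l)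
    (hm1 : 1 / 2 ≤ l ^ 2 - R ^ 2) (hm2 : l ^ 2 - R ^ 2 ≤ 2) (hy : l ≤ ‖y‖) (hyΓ : ‖y‖ ≤ Γ)
    (hρ : ρ ≤ 2) (hκ : κ ≤ 1) (hA : 0 ≤ A) :
    ρ * barD l R e y ^ (-(((n : ℝ) - 2) / 2)) +
      (‖y‖ ^ 2 - l ^ 2) * cmpG n R e κ (A * (Γ ^ (n - 2))⁻¹) l y ≤
      (2 * (4 * R) ^ (n - 2) + coreG n R + A) * (‖y‖ ^ (n - 2))⁻¹ := by
  have hl0 : 0 < l := by linarith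
  have hr0 : 0 < ‖y‖ := by linarith
  have hG := barG_bounds hn he hR hl hm1 hm2 hy
  have hG0 : 0 < coreG n R := by unfold coreG coreA2; positivity
  have hD : 0 < barD l R e y := barD_pos he (by linarith)
  have hw0 : 0 ≤ ‖y‖ ^ 2 - l ^ 2 := by
    have : l ^ 2 ≤ ‖y‖ ^ 2 := by gcongr
    linarith
  rw [sub_sq_mul_cmpG hl0 (norm_pos_iff.1 hr0)]
  have h1 := barD_rpow_le hn he hR hl0 hm1 hm2 hr0
  have h2 : (‖y‖ ^ 2 - l ^ 2) * barG n l R e y ≤ coreG n R * (‖y‖ ^ (n - 2))⁻¹ := by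
    calc _ ≤ ‖y‖ ^ 2 * (coreG n R * (‖y‖ ^ n)⁻¹) := by
          gcongr
          · exact hG.1
          · linarith only [sq_nonneg l]
          · exact hG.2
      _ = _ := by
          rw [show ‖y‖ ^ n = ‖y‖ ^ (n - 2) * ‖y‖ ^ 2 by rw [← pow_add]; congr 1; omega]
          field_simp
  have h3 : (Γ ^ (n - 2))⁻¹ ≤ (‖y‖ ^ (n - 2))⁻¹ := by gcongr
  have h4 : 1 - l / ‖y‖ ≤ 1 := by
    have : 0 ≤ l / ‖y‖ := by positivity
    linarith
  have h5 : 0 ≤ 1 - l / ‖y‖ := by rw [sub_nonneg, div_le_one hr0]; exact hy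
  have hΓ : 0 < Γ := by linarith
  calc _ ≤ 2 * ((4 * R) ^ (n - 2) * (‖y‖ ^ (n - 2))⁻¹) + (1 * (coreG n R * (‖y‖ ^ (n - 2))⁻¹) +
        A * (‖y‖ ^ (n - 2))⁻¹ * 1) := by
        gcongr
        · exact mul_nonneg hw0 hG.1
    _ = _ := by ring

lemma div_sq_rpow (hn : 4 ≤ n) {l r : ℝ} (hl : 0 ≤ l) (hr : 0 < r) :
    (l ^ 2 / r ^ 2) ^ (((n : ℝ) - 2) / 2) = l ^ (n - 2) * (r ^ (n - 2))⁻¹ := by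
  rw [← div_pow, ← Real.rpow_natCast (l / r) 2, ← Real.rpow_mul (by positivity),
    show ((2 : ℕ) : ℝ) * (((n : ℝ) - 2) / 2) = ((n - 2 : ℕ) : ℝ) by
      rw [Nat.cast_sub (by omega)]; push_cast; ring, Real.rpow_natCast, div_pow]
  rfl

lemma inv_pow_rpow (hn : 4 ≤ n) {r : ℝ} (hr : 0 < r) :
    ((r ^ (n - 2))⁻¹) ^ ((n : ℝ) / (n - 2)) = (r ^ n)⁻¹ := by
  have hn' : (4 : ℝ) ≤ n := by exact_mod_cast hn
  rw [Real.inv_rpow (by positivity), ← Real.rpow_natCast r (n - 2), ← Real.rpow_mul hr.le,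
    Nat.cast_sub (by omega), Nat.cast_two, mul_div_cancel₀ _ (by linarith), Real.rpow_natCast]

lemma BlowUp.outer (h : BlowUp n j R Λ e κ Γ T V 𝒦) (hn : 4 ≤ n) (hR : 2 ≤ R) {A : ℝ}
    (hA : 0 ≤ A) :
    ∃ τ > 0, ∀ᶠ i in atTop, ∀ l, 0 < l → |l ^ 2 - (1 + R ^ 2)| ≤ τ →
      ∀ y, ‖y‖ = Γ i / 8 → -T i ≤ y j →
      0 < sphereDiff (V i) (cmpG n R (e i) (κ i) (A * (Γ i ^ (n - 2))⁻¹)) l y := by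
  obtain ⟨τ, hτ, hτ4, hk⟩ := h.kelvin_close hn (by linarith) 1 one_pos
  refine ⟨τ, hτ, ?_⟩
  filter_upwards [hk, h.κ_lim.eventually (ge_mem_nhds one_pos),
    h.low ((2 * (4 * R) ^ (n - 2) + coreG n R + A) * 8 ^ (n - 2) + 1),
    h.Γ_lim.eventually_gt_atTop (8 * (R + 1))] with i hk hκ hlow hΓ l hl hlR y hyb hyT
  have hΓ0 : 0 < Γ i := by linarith
  obtain ⟨hl1, hRl, hlR1, hm1, hm2⟩ := radius_bounds (by linarith) hl (hlR.trans hτ4)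
  have hly : l ≤ ‖y‖ := by rw [hyb]; linarith
  obtain ⟨ρ, hρ0, hρ2, -, -, -, hW⟩ := hk l hl hlR y hly
  have h1 := cmp_le hn (h.norm_e i) (by linarith) hl1 hm1 hm2 hly (by linarith : ‖y‖ ≤ Γ i)
    hρ2 hκ hA
  have h2 := (hlow y hyb.le hyT).2
  have h3 : (‖y‖ ^ (n - 2))⁻¹ = 8 ^ (n - 2) * (Γ i ^ (n - 2))⁻¹ := by
    rw [hyb, div_pow]; field_simp
  rw [h3] at h1
  have h4 : 0 < (Γ i ^ (n - 2))⁻¹ := by positivity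
  rw [sphereDiff, hW]
  linarith only [h1, h2, h4]

/-- The normal derivative of a Kelvin transform at the bottom of the domain is large. -/
lemma kelvin_gradient_bottom (hn : 4 ≤ n) {l u₀ C T f : ℝ} {y g : Euc n} (hl : 1 ≤ l) (hT : 0 < T)
    (hyT : y j = -T) (hf : u₀ / 2 ≤ f) (hu₀ : 0 < u₀) (hg : ‖g‖ ≤ C)
    (hCT : 12 * l ^ 2 * C ≤ u₀ * T) :
    (‖y‖ ^ n)⁻¹ * T * (u₀ / 2) ≤ ((l ^ 2 / ‖y‖ ^ 2) ^ (((n : ℝ) - 2) / 2) •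
      ((l ^ 2 / ‖y‖ ^ 2) • g - (2 * l ^ 2 / (‖y‖ ^ 2) ^ 2 * inner ℝ y g) • y -
        (((n : ℝ) - 2) / ‖y‖ ^ 2 * f) • y) : Euc n) j := by
  have hn' : (4 : ℝ) ≤ n := by exact_mod_cast hn
  have hTy : T ≤ ‖y‖ := by
    have := (abs_le.1 (abs_coord_le_norm y j)).1
    linarith
  have hr0 : 0 < ‖y‖ := by linarith
  have hgj := (abs_le.1 ((abs_coord_le_norm g j).trans hg)).1
  have hyg : -(‖y‖ * C) ≤ inner ℝ y g :=
    (abs_le.1 ((abs_real_inner_le_norm y g).trans (by gcongr))).1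
  set r := ‖y‖ with hr
  have hC0 : 0 ≤ C := (norm_nonneg g).trans hg
  have key : T / r ^ 2 * (u₀ / 2) ≤ l ^ 2 / r ^ 2 * g j + 2 * l ^ 2 / (r ^ 2) ^ 2 * inner ℝ y g * T
      + (n - 2) / r ^ 2 * f * T := by
    have a1 : l ^ 2 / r ^ 2 * (-C) ≤ l ^ 2 / r ^ 2 * g j := by gcongr
    have a2 : 2 * l ^ 2 / (r ^ 2) ^ 2 * (-(r * C)) * T ≤
        2 * l ^ 2 / (r ^ 2) ^ 2 * inner ℝ y g * T := by gcongr
    have a3 : 2 / r ^ 2 * (u₀ / 2) * T ≤ (n - 2) / r ^ 2 * f * T := by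
      have h1 : 2 / r ^ 2 ≤ ((n : ℝ) - 2) / r ^ 2 := by gcongr; linarith
      have h2 : 0 < 2 / r ^ 2 := by positivity
      exact mul_le_mul_of_nonneg_right (mul_le_mul h1 hf (by positivity) (h2.le.trans h1)) hT.le
    have a4 : 2 * l ^ 2 / (r ^ 2) ^ 2 * (r * C) * T ≤ 2 * l ^ 2 / r ^ 2 * C := by
      calc 2 * l ^ 2 / (r ^ 2) ^ 2 * (r * C) * T ≤ 2 * l ^ 2 / (r ^ 2) ^ 2 * (r * C) * r := by
            gcongr
        _ = _ := by field_simp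
    have a5 : 3 * l ^ 2 * C / r ^ 2 ≤ u₀ * T / 4 / r ^ 2 := by gcongr; linarith
    have e1 : 3 * l ^ 2 * C / r ^ 2 = l ^ 2 / r ^ 2 * C + 2 * l ^ 2 / r ^ 2 * C := by ring
    have e2 : u₀ * T / 4 / r ^ 2 = (T / r ^ 2 * u₀) / 4 := by ring
    have e3 : 2 / r ^ 2 * (u₀ / 2) * T = T / r ^ 2 * u₀ := by ring
    have e4 : 0 < T / r ^ 2 * u₀ := by positivity
    linarith only [a1, a2, a3, a4, a5, e1, e2, e3, e4]
  have e0 : ((l ^ 2 / r ^ 2) ^ (((n : ℝ) - 2) / 2) •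
      ((l ^ 2 / r ^ 2) • g - (2 * l ^ 2 / (r ^ 2) ^ 2 * inner ℝ y g) • y -
        (((n : ℝ) - 2) / r ^ 2 * f) • y) : Euc n) j = (l ^ 2 / r ^ 2) ^ (((n : ℝ) - 2) / 2) *
      (l ^ 2 / r ^ 2 * g j + 2 * l ^ 2 / (r ^ 2) ^ 2 * inner ℝ y g * T
      + (n - 2) / r ^ 2 * f * T) := by
    simp only [PiLp.smul_apply, PiLp.sub_apply, smul_eq_mul, hyT]
    ring
  rw [e0, div_sq_rpow hn (by linarith) hr0]
  calc (r ^ n)⁻¹ * T * (u₀ / 2) = 1 ^ (n - 2) * (r ^ (n - 2))⁻¹ * (T / r ^ 2 * (u₀ / 2)) := by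
        rw [show r ^ n = r ^ (n - 2) * r ^ 2 by rw [← pow_add]; congr 1; omega]
        field_simp
        simp
    _ ≤ _ := by gcongr

lemma BlowUp.bottom (h : BlowUp n j R Λ e κ Γ T V 𝒦) (hn : 4 ≤ n) (hR : 2 ≤ R)
    (hRC : 192 * coreC n ≤ R ^ 2) (hRA : 128 * 2 ^ n * coreA2 n * coreC n ≤ R ^ 2)
    (hΛ : 0 < Λ) {A : ℝ} (hA : 0 ≤ A) :
    ∃ τ > 0, ∀ᶠ i in atTop, ∀ l, 0 < l → |l ^ 2 - (1 + R ^ 2)| ≤ τ →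
      ∀ y, l < ‖y‖ → ‖y‖ < Γ i / 8 → y j = -T i →
      sphereDiff (V i) (cmpG n R (e i) (κ i) (A * (Γ i ^ (n - 2))⁻¹)) l y = 0 →
      ∃ᶠ t in 𝓝[>] (0 : ℝ), sphereDiff (V i) (cmpG n R (e i) (κ i) (A * (Γ i ^ (n - 2))⁻¹)) l
        (y + t • EuclideanSpace.single j 1) < 0 := by
  have hn' : (4 : ℝ) ≤ n := by exact_mod_cast hn
  obtain ⟨τ, hτ, hτ4, hk⟩ := h.kelvin_close hn (by linarith) 1 one_pos
  set u0 := ((R + 1 + R) ^ 2 + 1) ^ (-(((n : ℝ) - 2) / 2)) with hu0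
  have hu0p : 0 < u0 := by positivity
  set C1 := u0 / 2 + n * (R + 1 + R) with hC1
  have hC1p : 0 < C1 := by positivity
  set Cv := 2 * (4 * R) ^ (n - 2) + coreG n R + A with hCv
  have hG0 : 0 < coreG n R := by unfold coreG coreA2; positivity
  have hCv0 : 0 < Cv := by positivity
  set Cp := Cv ^ ((n : ℝ) / (n - 2)) with hCp
  have hgr : 0 < coreGrad n R := by unfold coreGrad coreA2; positivity
  refine ⟨τ, hτ, ?_⟩
  filter_upwards [hk, h.κ_lim.eventually (ge_mem_nhds one_pos), h.conv (R + 1) (u0 / 2)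
    (by positivity), h.pde, h.low 0, h.bdry,
    h.Γ_lim.eventually_gt_atTop (8 * (R + 1)), h.T_lim.eventually_gt_atTop (R + 1),
    h.Γ_lim.eventually_gt_atTop (4 * A * (R + 1) / u0),
    h.T_lim.eventually_gt_atTop (12 * (R + 1) ^ 2 * C1 / u0),
    h.T_lim.eventually_gt_atTop (4 * (Λ * Cp + Λ * coreGrad n R) / u0)]
    with i hk hκ hconv hpde hlow hbdry hΓ hT hΓ2 hT2 hT3 l hl hlR y hly hyb hyT hZ
  have he := h.norm_e i
  have hΓ0 : 0 < Γ i := by linarith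
  have hT0 : 0 < T i := by linarith
  obtain ⟨hl1, hRl, hlR1, hm1, hm2⟩ := radius_bounds (by linarith) hl (hlR.trans hτ4)
  have hr0 : 0 < ‖y‖ := by linarith
  have hy0 : y ≠ 0 := norm_pos_iff.1 hr0
  obtain ⟨ρ, hρ0, hρ2, -, -, -, hW⟩ := hk l hl hlR y hly.le
  obtain ⟨hzl, hzb, hzT⟩ := reflected_mem (j := j) hl (by linarith : l < Γ i / 8)
    (by linarith : l < T i) hly.le
  obtain ⟨g2, hg2⟩ := hpde _ hzb hzT
  obtain ⟨g3, L3, hg3, hg3n, -⟩ := hasLap_barG hn he hR hRC hRA hl1 hm1 hm2 hly.le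
  have hg4 := hasLap_bar3 l hy0
  obtain ⟨d, hd, hder⟩ := hbdry y hyb hyT
  have hsum := (hg2.kelvin l hl hy0).add
    ((hg3.const_mul (κ i)).add (hg4.const_mul (A * (Γ i ^ (n - 2))⁻¹)))
  have hsum' : HasLap (fun z => kelvin l (V i) z + (‖z‖ ^ 2 - l ^ 2) *
      cmpG n R (e i) (κ i) (A * (Γ i ^ (n - 2))⁻¹) l z) y _ _ := hsum.congr (by
    filter_upwards [eventually_ne_nhds hy0] with z hz
    rw [sub_sq_mul_cmpG hl hz])
  have hder2 := hder.sub (hsum'.hasDerivAt_line j).hasDerivWithinAt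
  have hz := hconv _ (hzl.trans hlR1)
  have hbz := bubble_ge (n := n) hn (by linarith : 0 ≤ R) he (hzl.trans hlR1)
  have hfz : u0 / 2 ≤ V i ((l ^ 2 / ‖y‖ ^ 2) • y) := by
    have := (abs_le.1 hz.1).1
    linarith
  have hg2n : ‖g2‖ ≤ C1 := by
    rw [← hg2.norm_fderiv]
    have h1 := norm_fderiv_bubble_le (n := n) hn (by linarith : 0 ≤ R) he (hzl.trans hlR1)
    have h2 := norm_le_norm_add_norm_sub' (fderiv ℝ (V i) ((l ^ 2 / ‖y‖ ^ 2) • y))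
      (fderiv ℝ (bubble n R (e i)) ((l ^ 2 / ‖y‖ ^ 2) • y))
    linarith [hz.2]
  have hkel := kelvin_gradient_bottom (j := j) hn hl1 hT0 hyT hfz hu0p hg2n (by
    rw [div_lt_iff₀ hu0p] at hT2
    calc 12 * l ^ 2 * C1 ≤ 12 * (R + 1) ^ 2 * C1 := by gcongr
      _ ≤ _ := by linarith)
  -- the solution itself is small at this point
  have hV : V i y ≤ Cv * (‖y‖ ^ (n - 2))⁻¹ := by
    have h1 := cmp_le hn he (by linarith) hl1 hm1 hm2 hly.le (by linarith : ‖y‖ ≤ Γ i)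
      hρ2 hκ hA
    rw [sphereDiff, hW] at hZ
    linarith
  have hV0 := (hlow y hyb.le hyT.ge).1
  have hd2 : d ≤ Λ * (Cp * (‖y‖ ^ n)⁻¹) := by
    refine hd.trans ?_
    rw [← inv_pow_rpow hn hr0, hCp, ← Real.mul_rpow hCv0.le (by positivity)]
    have : 0 ≤ (n : ℝ) / (n - 2) := div_nonneg (by linarith) (by linarith)
    gcongr
  have hd3 : -(κ i * g3 j) ≤ Λ * coreGrad n R * (‖y‖ ^ n)⁻¹ := by
    have h1 := (abs_le.1 ((abs_coord_le_norm g3 j).trans hg3n)).1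
    have h2 : κ i * ‖y‖ ≤ Λ := by
      refine le_trans ?_ (h.κΓ_le i)
      have := h.κ_nonneg i
      gcongr
      linarith
    calc -(κ i * g3 j) = κ i * (-g3 j) := by ring
      _ ≤ κ i * (coreGrad n R * (‖y‖ * (‖y‖ ^ n)⁻¹)) := by
          have := h.κ_nonneg i
          gcongr
          linarith
      _ = κ i * ‖y‖ * (coreGrad n R * (‖y‖ ^ n)⁻¹) := by ring
      _ ≤ Λ * (coreGrad n R * (‖y‖ ^ n)⁻¹) := by gcongr
      _ = _ := by ring
  have hd4 : A * (Γ i ^ (n - 2))⁻¹ * (l / ‖y‖ ^ 3 * T i) ≤ T i * (u0 / 4) * (‖y‖ ^ n)⁻¹ := by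
    rw [div_lt_iff₀ hu0p] at hΓ2
    have e1 : ‖y‖ ^ n = ‖y‖ ^ (n - 3) * ‖y‖ ^ 3 := by rw [← pow_add]; congr 1; omega
    have e2 : Γ i ^ (n - 2) = Γ i ^ (n - 3) * Γ i := by rw [← pow_succ]; congr 1; omega
    have h1 : ‖y‖ ^ (n - 3) ≤ Γ i ^ (n - 3) := by gcongr; linarith
    rw [e1, e2]
    calc A * (Γ i ^ (n - 3) * Γ i)⁻¹ * (l / ‖y‖ ^ 3 * T i)
        ≤ A * (‖y‖ ^ (n - 3) * Γ i)⁻¹ * ((R + 1) / ‖y‖ ^ 3 * T i) := by gcongr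
      _ = (4 * A * (R + 1)) / Γ i * (T i / 4 * (‖y‖ ^ (n - 3) * ‖y‖ ^ 3)⁻¹) := by field_simp
      _ ≤ u0 * (T i / 4 * (‖y‖ ^ (n - 3) * ‖y‖ ^ 3)⁻¹) := by
          gcongr
          rw [div_le_iff₀ hΓ0]; linarith
      _ = _ := by ring
  set gk : Euc n := (l ^ 2 / ‖y‖ ^ 2) ^ (((n : ℝ) - 2) / 2) •
      ((l ^ 2 / ‖y‖ ^ 2) • g2 - (2 * l ^ 2 / (‖y‖ ^ 2) ^ 2 * inner ℝ y g2) • y -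
        (((n : ℝ) - 2) / ‖y‖ ^ 2 * V i ((l ^ 2 / ‖y‖ ^ 2) • y)) • y)
  have hneg : d - (gk + (κ i • g3 + (A * (Γ i ^ (n - 2))⁻¹) • (l / ‖y‖ ^ 3) • y)) j < 0 := by
    simp only [PiLp.add_apply, PiLp.smul_apply, smul_eq_mul, hyT]
    rw [div_lt_iff₀ hu0p] at hT3
    have h1 : 0 < (‖y‖ ^ n)⁻¹ := by positivity
    have h2 := mul_lt_mul_of_pos_right hT3 h1
    linarith only [hd2, hd3, hd4, hkel, h2]
  refine Eventually.frequently ?_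
  have h3 := ((hasDerivWithinAt_iff_tendsto_slope' self_notMem_Ioi).1
    (hder2.mono Ioi_subset_Ici_self)).eventually (gt_mem_nhds hneg)
  filter_upwards [h3, self_mem_nhdsWithin] with t ht ht0
  simp only [slope_def_field, Pi.sub_apply, zero_smul, add_zero, sub_zero] at ht
  rw [div_lt_iff₀ ht0, zero_mul] at ht
  rw [sphereDiff] at hZ ⊢
  linarith only [ht, hZ]

end

section

variable {n : ℕ} {j : Fin n} {R Λ : ℝ} {e : ℕ → Euc n} {κ Γ T : ℕ → ℝ} {V 𝒦 : ℕ → Euc n → ℝ}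

lemma norm_sq_rpow_neg (hn : 4 ≤ n) (z : Euc n) :
    (‖z‖ ^ 2) ^ (-(((n : ℝ) - 2) / 2)) = (‖z‖ ^ (n - 2))⁻¹ := by
  rw [Real.rpow_neg (by positivity), ← Real.rpow_natCast ‖z‖ 2, ← Real.rpow_mul (norm_nonneg z),
    show ((2 : ℕ) : ℝ) * (((n : ℝ) - 2) / 2) = ((n - 2 : ℕ) : ℝ) by
      rw [Nat.cast_sub (by omega)]; push_cast; ring, Real.rpow_natCast]

/-- The fundamental solution is harmonic. -/
lemma hasLap_inv_pow (hn : 4 ≤ n) {y : Euc n} (hy : y ≠ 0) :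
    HasLap (fun z => (‖z‖ ^ (n - 2))⁻¹) y (-(((n : ℝ) - 2) * (‖y‖ ^ n)⁻¹) • y) 0 := by
  have hs : 0 < ‖y‖ ^ 2 := by positivity
  have hr : 0 < ‖y‖ := norm_pos_iff.2 hy
  have h1 := (HasLap.norm_sq y).rpow (-(((n : ℝ) - 2) / 2)) hs
  simp only [norm_sq_rpow_neg hn] at h1
  rw [Real.rpow_sub_one hs.ne', Real.rpow_sub hs, Real.rpow_two, norm_sq_rpow_neg hn] at h1
  have hn2 : ‖(2 : ℝ) • y‖ ^ 2 = 4 * ‖y‖ ^ 2 := by rw [norm_smul, mul_pow]; norm_num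
  rw [hn2] at h1
  convert h1 using 1
  · rw [smul_smul]
    congr 1
    rw [show ‖y‖ ^ n = ‖y‖ ^ (n - 2) * ‖y‖ ^ 2 by rw [← pow_add]; congr 1; omega]
    field_simp
  · field_simp
    ring

/-- Away from the blow-up point, the solution dominates a multiple of the fundamental solution. -/
lemma BlowUp.far (h : BlowUp n j R Λ e κ Γ T V 𝒦) (hn : 4 ≤ n) (hR : 2 ≤ R) (hΛ : 0 < Λ) {A a : ℝ}
    (hA : 0 ≤ A) (ha0 : 0 < a) (ha1 : a < 1) :
    ∀ᶠ ρ in atTop, ∀ᶠ i in atTop, ∀ y ∈ annulusAbove j ρ (Γ i / 8) (T i),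
      a * (‖y‖ ^ (n - 2))⁻¹ + A * (Γ i ^ (n - 2))⁻¹ ≤ V i y := by
  have hn' : (4 : ℝ) ≤ n := by exact_mod_cast hn
  set a' := (1 + a) / 2 with ha'
  have hlim : Tendsto (fun ρ : ℝ => ((1 + R * ρ⁻¹) ^ 2 + (ρ⁻¹) ^ 2) ^ (-(((n : ℝ) - 2) / 2))) atTop
      (𝓝 1) := by
    have h1 := tendsto_inv_atTop_zero (𝕜 := ℝ)
    have h2 : Tendsto (fun ρ : ℝ => (1 + R * ρ⁻¹) ^ 2 + (ρ⁻¹) ^ 2) atTop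
        (𝓝 ((1 + R * 0) ^ 2 + 0 ^ 2)) :=
      (((h1.const_mul R).const_add 1).pow 2).add (h1.pow 2)
    rw [show (1 + R * 0) ^ 2 + 0 ^ 2 = (1 : ℝ) by ring] at h2
    simpa using h2.rpow_const (p := -(((n : ℝ) - 2) / 2)) (Or.inl one_ne_zero)
  set Cp := (a + A) ^ ((n : ℝ) / (n - 2)) with hCp
  filter_upwards [hlim.eventually (lt_mem_nhds (by linarith : a' < 1)), eventually_ge_atTop 1]
    with ρ hρ hρ1
  have hρ0 : 0 < ρ := by linarith
  have hbρ : a' * (ρ ^ (n - 2))⁻¹ ≤ ((ρ + R) ^ 2 + 1) ^ (-(((n : ℝ) - 2) / 2)) := by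
    have e1 : (ρ + R) ^ 2 + 1 = ρ ^ 2 * ((1 + R * ρ⁻¹) ^ 2 + (ρ⁻¹) ^ 2) := by field_simp
    have e2 := norm_sq_rpow_neg hn (EuclideanSpace.single j ρ)
    rw [PiLp.norm_single, Real.norm_of_nonneg hρ0.le] at e2
    rw [e1, Real.mul_rpow (by positivity) (by positivity), e2, mul_comm]
    gcongr
  have hη : 0 < (a' - a) * (ρ ^ (n - 2))⁻¹ / 2 := by
    have : 0 < a' - a := by linarith
    positivity
  have hγ : Tendsto (fun i => A * (Γ i ^ (n - 2))⁻¹) atTop (𝓝 0) := by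
    simpa using ((tendsto_inv_atTop_zero.comp
      ((tendsto_pow_atTop (by omega : n - 2 ≠ 0)).comp h.Γ_lim)).const_mul A)
  filter_upwards [h.conv ρ _ hη, hγ.eventually (gt_mem_nhds hη), h.cont, h.pde, h.bdry, h.K_pos,
    h.low (8 ^ (n - 2) * a + A), h.Γ_lim.eventually_gt_atTop 1, h.T_lim.eventually_gt_atTop 0,
    h.T_lim.eventually_gt_atTop (Λ * Cp / a)] with
    i hconv hγi hcont hpde hbdry hK hlow hΓ hT0 hT
  have hΓ0 : 0 < Γ i := by linarith
  have hγ0 : 0 < (Γ i ^ (n - 2))⁻¹ := by positivity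
  suffices hs : ∀ y ∈ annulusAbove j ρ (Γ i / 8) (T i),
      0 ≤ V i y - (a * (‖y‖ ^ (n - 2))⁻¹ + A * (Γ i ^ (n - 2))⁻¹) from
    fun y hy => sub_nonneg.1 (hs y hy)
  refine nonneg_on_annulusAbove ?_ ?_ ?_ ?_ ?_
  · refine (hcont.mono fun y hy => ⟨hy.2.1, hy.2.2⟩).sub (ContinuousOn.add ?_ continuousOn_const)
    refine continuousOn_const.mul (ContinuousOn.inv₀ (by fun_prop) fun y hy => ?_)
    have : 0 < ‖y‖ := hρ0.trans_le hy.1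
    positivity
  · intro y hy hyρ
    have h1 := (abs_le.1 (hconv y hyρ.le).1).1
    have h2 := bubble_ge hn (by linarith : 0 ≤ R) (h.norm_e i) hyρ.le
    rw [hyρ]
    linarith only [h1, h2, hγi, hbρ]
  · intro y hy hyb
    have h1 := (hlow y hy.2.1 hy.2.2).2
    have h3 : (‖y‖ ^ (n - 2))⁻¹ = 8 ^ (n - 2) * (Γ i ^ (n - 2))⁻¹ := by
      rw [hyb, div_pow]; field_simp
    rw [h3]
    linarith only [h1]
  · intro y hy1 hy2 hy3 _
    obtain ⟨g, hg⟩ := hpde y hy2 hy3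
    have hy0 : y ≠ 0 := norm_pos_iff.1 (by linarith)
    refine ⟨_, _, hg.sub (((hasLap_inv_pow hn hy0).const_mul a).add
      (HasLap.const (A * (Γ i ^ (n - 2))⁻¹) y)), ?_⟩
    have h1 := hK y hy2.le hy3.le
    have h2 := Real.rpow_pos_of_pos (hlow y hy2.le hy3.le).1 (((n : ℝ) + 2) / (n - 2))
    have := mul_pos h1 h2
    linarith
  · intro y hy1 hy2 hy3 hZ
    obtain ⟨d, hd, hder⟩ := hbdry y hy2 hy3
    have hr0 : 0 < ‖y‖ := by linarith
    have hy0 : y ≠ 0 := norm_pos_iff.1 hr0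
    have hder2 := hder.sub ((((hasLap_inv_pow hn hy0).const_mul a).add
      (HasLap.const (A * (Γ i ^ (n - 2))⁻¹) y)).hasDerivAt_line j).hasDerivWithinAt
    have hV0 := (hlow y hy2.le hy3.ge).1
    have hV : V i y ≤ (a + A) * (‖y‖ ^ (n - 2))⁻¹ := by
      have h1 : A * (Γ i ^ (n - 2))⁻¹ ≤ A * (‖y‖ ^ (n - 2))⁻¹ := by
        gcongr; linarith
      linarith
    have hd2 : d ≤ Λ * (Cp * (‖y‖ ^ n)⁻¹) := by
      refine hd.trans ?_
      rw [← inv_pow_rpow hn hr0, hCp, ← Real.mul_rpow (by positivity) (by positivity)]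
      have : 0 ≤ (n : ℝ) / (n - 2) := div_nonneg (by linarith) (by linarith)
      gcongr
    have hneg : d - (a • -(((n : ℝ) - 2) * (‖y‖ ^ n)⁻¹) • y + 0 : Euc n) j < 0 := by
      simp only [PiLp.add_apply, PiLp.smul_apply, smul_eq_mul, hy3, PiLp.zero_apply]
      rw [div_lt_iff₀ ha0] at hT
      have h1 : 0 < (‖y‖ ^ n)⁻¹ := by positivity
      have h2 := mul_lt_mul_of_pos_right hT h1
      have h3 : 1 * (T i * a * (‖y‖ ^ n)⁻¹) ≤ ((n : ℝ) - 2) * (T i * a * (‖y‖ ^ n)⁻¹) := by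
        gcongr; linarith
      linarith only [hd2, h2, h3]
    refine Eventually.frequently ?_
    have h3 := ((hasDerivWithinAt_iff_tendsto_slope' self_notMem_Ioi).1
      (hder2.mono Ioi_subset_Ici_self)).eventually (gt_mem_nhds hneg)
    filter_upwards [h3, self_mem_nhdsWithin] with t ht ht0
    simp only [slope_def_field, Pi.sub_apply, zero_smul, add_zero, sub_zero] at ht
    rw [div_lt_iff₀ ht0, zero_mul] at ht
    linarith only [ht]

lemma rpow_neg_sub_ge {α D w : ℝ} (hα : 1 ≤ α) (hD : 0 < D) (hw : 0 ≤ w) :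
    (D + w) ^ (-α) * (w / D) ≤ D ^ (-α) - (D + w) ^ (-α) := by
  have h1 : 1 + w / D ≤ (1 + w / D) ^ α :=
    Real.self_le_rpow_of_one_le (by have : 0 ≤ w / D := by positivity
                                    linarith) hα
  have h2 : D ^ (-α) = (D + w) ^ (-α) * (1 + w / D) ^ α := by
    rw [show D + w = D * (1 + w / D) by field_simp, Real.mul_rpow hD.le (by positivity), mul_assoc,
      ← Real.rpow_add (by positivity)]
    simp
  have h3 : 0 < (D + w) ^ (-α) := by positivity
  have h4 := mul_le_mul_of_nonneg_left h1 h3.le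
  rw [h2]
  linarith only [h4]

end

section

variable {n : ℕ} {j : Fin n} {R Λ : ℝ} {e : ℕ → Euc n} {κ Γ T : ℕ → ℝ} {V 𝒦 : ℕ → Euc n → ℝ}

lemma kelvin_sub {l : ℝ} (f g : Euc n → ℝ) (y : Euc n) :
    kelvin l (fun z => f z - g z) y = kelvin l f y - kelvin l g y := by
  simp only [kelvin]; ring

/-- The Kelvin transform of a bubble with respect to a sphere other than its critical sphere. -/
lemma kelvin_bubble_eq {l τ : ℝ} (hl : 0 < l) (hlτ : l ^ 2 = 1 + R ^ 2 - τ) {e y : Euc n}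
    (he : ‖e‖ = 1) (hy : y ≠ 0) :
    kelvin l (bubble n R e) y =
      (barD (√(1 + R ^ 2)) R e y + τ / l ^ 2 * (‖y‖ ^ 2 - l ^ 2)) ^ (-(((n : ℝ) - 2) / 2)) := by
  have h := (kelvin_bubble (n := n) (l' := √(1 + R ^ 2)) (R := R) (e := e) hl hy (by
    rw [barD_sqrt R he]; positivity)).2
  rw [show bubble n R e = fun z => barD (√(1 + R ^ 2)) R e z ^ (-(((n : ℝ) - 2) / 2)) from rfl, h]
  congr 1
  rw [barD, barD, sqrt_one_add_sq]
  have e1 : 1 + R ^ 2 = l ^ 2 + τ := by linarith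
  rw [e1]
  field_simp
  ring

lemma abs_kelvin_le (hn : 4 ≤ n) {l η : ℝ} (hl : 0 < l) {f : Euc n → ℝ} {y : Euc n} (hy : y ≠ 0)
    (hf : |f ((l ^ 2 / ‖y‖ ^ 2) • y)| ≤ η) :
    |kelvin l f y| ≤ l ^ (n - 2) * η * (‖y‖ ^ (n - 2))⁻¹ := by
  have hr : 0 < ‖y‖ := norm_pos_iff.2 hy
  rw [kelvin, div_sq_rpow hn hl.le hr, abs_mul, abs_of_pos (by positivity)]
  calc _ ≤ l ^ (n - 2) * (‖y‖ ^ (n - 2))⁻¹ * η := by gcongr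
    _ = _ := by ring

/-- If `d` is small in `C¹`, then it differs little from its Kelvin transform. -/
lemma sub_kelvin_le (hn : 4 ≤ n) {l ρ η : ℝ} (hl : 1 ≤ l) {d : Euc n → ℝ} {y : Euc n} (hy : l < ‖y‖)
    (hyρ : ‖y‖ ≤ ρ) (hd : ∀ z, ‖z‖ ≤ ρ → DifferentiableAt ℝ d z ∧ |d z| ≤ η ∧ ‖fderiv ℝ d z‖ ≤ η) :
    |d y - kelvin l d y| ≤ ((n : ℝ) + ρ) * η * (‖y‖ ^ 2 - l ^ 2) := by
  have hn' : (4 : ℝ) ≤ n := by exact_mod_cast hn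
  have hr : 0 < ‖y‖ := by linarith
  have hs : ∀ s ∈ Icc (l ^ 2 / ‖y‖ ^ 2) 1, 0 ≤ s ∧ ‖s • y‖ ≤ ρ := by
    intro s hs
    have h0 : 0 ≤ s := le_trans (by positivity) hs.1
    refine ⟨h0, ?_⟩
    rw [norm_smul, Real.norm_of_nonneg h0]
    nlinarith only [hs.2, hr, hyρ]
  obtain ⟨s, hs1, hs2⟩ := sub_kelvin_eq (by linarith : 0 < l) hy fun s h => (hd _ (hs s h).2).1
  obtain ⟨h0, hsρ⟩ := hs s (Ioo_subset_Icc_self hs1)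
  obtain ⟨-, h1, h2⟩ := hd _ hsρ
  have hη : 0 ≤ η := (abs_nonneg _).trans h1
  have hlog0 : 0 ≤ Real.log (‖y‖ / l) := Real.log_nonneg
    (by rw [le_div_iff₀ (by linarith)]; linarith)
  have hlog : 2 * Real.log (‖y‖ / l) ≤ ‖y‖ ^ 2 - l ^ 2 := by
    have h3 := Real.log_le_sub_one_of_pos (by positivity : 0 < ‖y‖ / l)
    have h4 : ‖y‖ / l - 1 ≤ ‖y‖ - l := by
      rw [div_sub_one (by linarith), div_le_iff₀ (by linarith)]; nlinarith
    nlinarith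
  have hq : 0 ≤ ‖y‖ ^ 2 - l ^ 2 := le_trans (by positivity) hlog
  have hpow : s ^ (((n : ℝ) - 2) / 2) ≤ 1 := Real.rpow_le_one h0 hs1.2.le (by linarith)
  have hpow0 : 0 ≤ s ^ (((n : ℝ) - 2) / 2) := Real.rpow_nonneg h0 _
  have hin : |((n : ℝ) - 2) / 2 * d (s • y) + fderiv ℝ d (s • y) (s • y)| ≤ (n + ρ) * η := by
    refine (abs_add_le _ _).trans ?_
    rw [abs_mul, abs_of_nonneg (by linarith : 0 ≤ ((n : ℝ) - 2) / 2)]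
    have h5 : |fderiv ℝ d (s • y) (s • y)| ≤ η * ρ :=
      ((fderiv ℝ d (s • y)).le_opNorm (s • y)).trans (by gcongr)
    have h6 : ((n : ℝ) - 2) / 2 * |d (s • y)| ≤ n * η := by
      gcongr
      linarith
    linarith
  rw [hs2, abs_mul, abs_mul (s ^ _), abs_of_nonneg (mul_nonneg zero_le_two hlog0),
    abs_of_nonneg hpow0]
  calc _ ≤ (‖y‖ ^ 2 - l ^ 2) * (1 * ((n + ρ) * η)) := by gcongr
    _ = _ := by ring

/-- In a bounded region, the sphere of radius slightly less than critical is a valid start. -/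
lemma BlowUp.near (h : BlowUp n j R Λ e κ Γ T V 𝒦) (hn : 4 ≤ n) (hR : 2 ≤ R) {A τ l : ℝ}
    (hA : 0 ≤ A) (hτ : 0 < τ) (hτ4 : τ ≤ 1 / 4) (hl : 0 < l) (hlτ : l ^ 2 = 1 + R ^ 2 - τ) (ρ : ℝ) :
    ∀ᶠ i in atTop, ∀ y, l ≤ ‖y‖ → ‖y‖ ≤ ρ →
      0 ≤ sphereDiff (V i) (cmpG n R (e i) (κ i) (A * (Γ i ^ (n - 2))⁻¹)) l y := by
  have hn' : (4 : ℝ) ≤ n := by exact_mod_cast hn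
  obtain ⟨hl1, hRl, hlR1, hm1, hm2⟩ := radius_bounds (by linarith) hl (by
    rw [hlτ, abs_le]; constructor <;> linarith : |l ^ 2 - (1 + R ^ 2)| ≤ 1 / 4)
  rcases lt_or_ge ρ l with hρ | hρ
  · exact Eventually.of_forall fun i y h1 h2 => by linarith
  have hρ0 : 0 < ρ := by linarith
  have hG0 : 0 < coreG n R := by unfold coreG coreA2; positivity
  set Dm := (ρ + R) ^ 2 + 1 + τ / l ^ 2 * ρ ^ 2 with hDm
  set c0 := Dm ^ (-(((n : ℝ) - 2) / 2)) * (τ / l ^ 2 / Dm) with hc0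
  have hDm0 : 0 < Dm := by positivity
  have hc0p : 0 < c0 := by positivity
  have hγ : Tendsto (fun i => κ i * coreG n R + A * (Γ i ^ (n - 2))⁻¹) atTop (𝓝 0) := by
    simpa using (h.κ_lim.mul_const (coreG n R)).add ((tendsto_inv_atTop_zero.comp
      ((tendsto_pow_atTop (by omega : n - 2 ≠ 0)).comp h.Γ_lim)).const_mul A)
  filter_upwards [h.conv ρ (c0 / 2 / (n + ρ)) (by positivity), h.diff,
    hγ.eventually (ge_mem_nhds (half_pos hc0p)),
    h.Γ_lim.eventually_gt_atTop (8 * ρ), h.T_lim.eventually_gt_atTop ρ]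
    with i hconv hdiff hγi hΓ hT y hly hyρ
  have he := h.norm_e i
  have hΓ0 : 0 < Γ i := by linarith
  have hr0 : 0 < ‖y‖ := by linarith
  have hy0 : y ≠ 0 := norm_pos_iff.1 hr0
  rcases hly.eq_or_lt with hly' | hly'
  · rw [sphereDiff_eq_zero hl _ _ hly'.symm]
  have hd := sub_kelvin_le (d := fun z => V i z - bubble n R (e i) z) hn hl1 hly' hyρ
    (η := c0 / 2 / (n + ρ)) (fun z hz => by
      have hc := hconv z hz
      have hVd : DifferentiableAt ℝ (V i) z := (hdiff z (by linarith) (by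
        have := (abs_le.1 (abs_coord_le_norm z j)).1
        linarith)).differentiableAt two_ne_zero
      obtain ⟨L, hL⟩ := hasLap_bubble n R he z
      have hbd := hL.hasFDerivAt.differentiableAt
      refine ⟨hVd.sub hbd, hc.1, ?_⟩
      rw [fderiv_fun_sub hVd hbd]
      exact hc.2)
  rw [kelvin_sub, kelvin_bubble_eq hl hlτ he hy0, mul_div_cancel₀ _ (by positivity)] at hd
  set D := barD (√(1 + R ^ 2)) R (e i) y with hD
  have hD1 : 1 ≤ D := by rw [hD, barD_sqrt R he]; linarith [sq_nonneg ‖y - R • e i‖]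
  have hD2 : D ≤ (ρ + R) ^ 2 + 1 := barD_sqrt_le (by linarith) he hyρ
  have hq : 0 < ‖y‖ ^ 2 - l ^ 2 := by
    have : l ^ 2 < ‖y‖ ^ 2 := by gcongr
    linarith
  set w := τ / l ^ 2 * (‖y‖ ^ 2 - l ^ 2) with hw
  have hw0 : 0 < w := by positivity
  have hDw : D + w ≤ Dm := by
    have : w ≤ τ / l ^ 2 * ρ ^ 2 := by
      rw [hw]
      gcongr
      have : ‖y‖ ^ 2 ≤ ρ ^ 2 := by gcongr
      linarith [sq_nonneg l]
    linarith
  have hmain := rpow_neg_sub_ge (α := ((n : ℝ) - 2) / 2) (by linarith) (by linarith : 0 < D) hw0.le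
  have hmain2 : c0 * (‖y‖ ^ 2 - l ^ 2) ≤ (D + w) ^ (-(((n : ℝ) - 2) / 2)) * (w / D) := by
    have h1 : Dm ^ (-(((n : ℝ) - 2) / 2)) ≤ (D + w) ^ (-(((n : ℝ) - 2) / 2)) :=
      Real.rpow_le_rpow_of_nonpos (by linarith) hDw (by linarith)
    have h2 : w / Dm ≤ w / D := by gcongr; linarith
    calc c0 * (‖y‖ ^ 2 - l ^ 2) = Dm ^ (-(((n : ℝ) - 2) / 2)) * (w / Dm) := by
          rw [hc0, hw]; ring
      _ ≤ _ := by gcongr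
  have hcmp : cmpG n R (e i) (κ i) (A * (Γ i ^ (n - 2))⁻¹) l y ≤ c0 / 2 := by
    have hG := (barG_bounds hn he (by linarith) hl1 hm1 hm2 hly).2
    have h1 : (‖y‖ ^ n)⁻¹ ≤ 1 := inv_le_one_of_one_le₀ (one_le_pow₀ (by linarith))
    have h2 : coreG n R * (‖y‖ ^ n)⁻¹ ≤ coreG n R * 1 := by gcongr
    have h3 : A * (Γ i ^ (n - 2))⁻¹ / (‖y‖ * (‖y‖ + l)) ≤ A * (Γ i ^ (n - 2))⁻¹ :=
      div_le_self (by positivity) (by nlinarith)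
    have h4 : κ i * barG n l R (e i) y ≤ κ i * coreG n R := by
      have := h.κ_nonneg i
      gcongr
      linarith
    rw [cmpG]
    linarith
  have h1 := (abs_le.1 hd).1
  have h2 := mul_le_mul_of_nonneg_left hcmp hq.le
  rw [bubble, ← hD] at h1
  rw [sphereDiff]
  linarith only [h1, h2, hmain, hmain2]

/-- The sphere of radius slightly less than critical is a valid start. -/
lemma BlowUp.start (h : BlowUp n j R Λ e κ Γ T V 𝒦) (hn : 4 ≤ n) (hR : 2 ≤ R) (hΛ : 0 < Λ)
    {A τ l : ℝ} (hA : 0 ≤ A) (hτ : 0 < τ) (hτ4 : τ ≤ 1 / 4) (hl : 0 < l)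
    (hlτ : l ^ 2 = 1 + R ^ 2 - τ) :
    ∀ᶠ i in atTop, ∀ y ∈ annulusAbove j l (Γ i / 8) (T i),
      0 ≤ sphereDiff (V i) (cmpG n R (e i) (κ i) (A * (Γ i ^ (n - 2))⁻¹)) l y := by
  have hn' : (4 : ℝ) ≤ n := by exact_mod_cast hn
  obtain ⟨hl1, hRl, hlR1, hm1, hm2⟩ := radius_bounds (by linarith) hl (by
    rw [hlτ, abs_le]; constructor <;> linarith : |l ^ 2 - (1 + R ^ 2)| ≤ 1 / 4)
  have hG0 : 0 < coreG n R := by unfold coreG coreA2; positivity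
  have hτl : 0 < τ / l ^ 2 := by positivity
  set b := (1 + τ / l ^ 2 / 2) ^ (-(((n : ℝ) - 2) / 2)) with hb
  have hb0 : 0 < b := by positivity
  have hb1 : b < 1 := Real.rpow_lt_one_of_one_lt_of_neg (by linarith) (by linarith)
  set a := (1 + b) / 2 with ha
  obtain ⟨ρ, hfar, hρl, hρ⟩ := ((h.far hn hR hΛ hA (by positivity : 0 < a)
    (by linarith)).and ((eventually_ge_atTop l).and
      (eventually_ge_atTop (2 * R / (τ / l ^ 2 / 2))))).exists
  have hρ0 : 0 < ρ := by linarith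
  set η := (a - b) / 2 / l ^ (n - 2) with hη
  have hab : 0 < a - b := by linarith
  have hκ : Tendsto (fun i => κ i * coreG n R) atTop (𝓝 0) := by
    simpa using h.κ_lim.mul_const (coreG n R)
  filter_upwards [hfar, h.near hn hR hA hτ hτ4 hl hlτ ρ, h.conv l η (by positivity),
    hκ.eventually (ge_mem_nhds (half_pos hab)),
    h.Γ_lim.eventually_gt_atTop (8 * l), h.T_lim.eventually_gt_atTop l]
    with i hfar hnear hconv hκi hΓ hT y hy
  rcases le_or_gt ‖y‖ ρ with hyρ | hyρ
  · exact hnear y hy.1 hyρ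
  have he := h.norm_e i
  have hr0 : 0 < ‖y‖ := by linarith
  have hy0 : y ≠ 0 := norm_pos_iff.1 hr0
  have hΓ0 : 0 < Γ i := by linarith
  obtain ⟨hzl, -, -⟩ := reflected_mem (j := j) hl (by linarith : l < Γ i / 8) hT hy.1
  have hV := hfar y ⟨hyρ.le, hy.2.1, hy.2.2⟩
  have hk := abs_kelvin_le (f := fun z => V i z - bubble n R (e i) z) hn hl hy0 (hconv _ hzl).1
  rw [kelvin_sub, kelvin_bubble_eq hl hlτ he hy0,
    mul_div_cancel₀ _ (by positivity)] at hk
  have hD : ‖y‖ ^ 2 * (1 + τ / l ^ 2 / 2) ≤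
      barD (√(1 + R ^ 2)) R (e i) y + τ / l ^ 2 * (‖y‖ ^ 2 - l ^ 2) := by
    have h1 := (abs_le.1 (abs_inner_le_norm_of_unit he y)).2
    rw [div_le_iff₀ (by positivity)] at hρ
    rw [barD, sqrt_one_add_sq]
    have h2 : 2 * R * inner ℝ (e i) y ≤ τ / l ^ 2 / 2 * ‖y‖ ^ 2 := by
      calc 2 * R * inner ℝ (e i) y ≤ 2 * R * ‖y‖ := by gcongr
        _ ≤ ρ * (τ / l ^ 2 / 2) * ‖y‖ := by gcongr
        _ ≤ ‖y‖ * (τ / l ^ 2 / 2) * ‖y‖ := by gcongr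
        _ = _ := by ring
    have h3 : τ / l ^ 2 * l ^ 2 = τ := by field_simp
    nlinarith only [h2, h3, hτ4, sq_nonneg R]
  have hD2 := Real.rpow_le_rpow_of_nonpos (by positivity) hD
    (by linarith : -(((n : ℝ) - 2) / 2) ≤ 0)
  rw [Real.mul_rpow (by positivity) (by positivity), norm_sq_rpow_neg hn] at hD2
  have hG := barG_bounds hn he (by linarith) hl1 hm1 hm2 hy.1
  have hr : 0 < (‖y‖ ^ (n - 2))⁻¹ := by positivity
  have hGG : κ i * ((‖y‖ ^ 2 - l ^ 2) * barG n l R (e i) y) ≤ (a - b) / 2 * (‖y‖ ^ (n - 2))⁻¹ := by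
    have hκ0 := h.κ_nonneg i
    calc _ ≤ κ i * (‖y‖ ^ 2 * (coreG n R * (‖y‖ ^ n)⁻¹)) := by
          gcongr
          · exact hG.1
          · linarith only [sq_nonneg l]
          · exact hG.2
      _ = κ i * coreG n R * (‖y‖ ^ (n - 2))⁻¹ := by
          rw [show ‖y‖ ^ n = ‖y‖ ^ (n - 2) * ‖y‖ ^ 2 by rw [← pow_add]; congr 1; omega]
          field_simp
      _ ≤ _ := by gcongr
  have hs : A * (Γ i ^ (n - 2))⁻¹ * (1 - l / ‖y‖) ≤ A * (Γ i ^ (n - 2))⁻¹ := by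
    have h1 : 0 ≤ l / ‖y‖ := by positivity
    have h2 : 0 ≤ A * (Γ i ^ (n - 2))⁻¹ := by positivity
    nlinarith only [h1, h2]
  have h1 := (abs_le.1 hk).1
  rw [sphereDiff, sub_sq_mul_cmpG hl hy0]
  have h2 := (abs_le.1 hk).2
  linarith only [hV, hs, hGG, hD2, h2]

end

section

variable {n : ℕ} {j : Fin n} {R Λ : ℝ} {e : ℕ → Euc n} {κ Γ T : ℕ → ℝ} {V 𝒦 : ℕ → Euc n → ℝ}

/-- For spheres slightly larger than the critical one, the moving sphere inequality fails. -/
lemma BlowUp.exists_lt_kelvin (h : BlowUp n j R Λ e κ Γ T V 𝒦) (hn : 4 ≤ n) {τ l : ℝ}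
    (hτ : 0 < τ) (hτ4 : τ ≤ 1 / 4) (hl : 0 < l) (hlτ : l ^ 2 = 1 + R ^ 2 + τ) :
    ∀ᶠ i in atTop, ‖(2 * l) • e i‖ = 2 * l ∧
      V i ((2 * l) • e i) < kelvin l (V i) ((2 * l) • e i) := by
  have hn' : (4 : ℝ) ≤ n := by exact_mod_cast hn
  have hD1 : 1 ≤ (2 * l - R) ^ 2 + 1 := by linarith [sq_nonneg (2 * l - R)]
  set D := (2 * l - R) ^ 2 + 1 with hD
  have hD0 : 0 < D - 3 * τ := by linarith
  have hw : 0 < 3 * τ / (D - 3 * τ) := by positivity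
  set c := D ^ (-(((n : ℝ) - 2) / 2)) * (3 * τ / (D - 3 * τ)) with hc
  have hc0 : 0 < c := by positivity
  have hmain := rpow_neg_sub_ge (α := ((n : ℝ) - 2) / 2) (by linarith) hD0
    (by linarith : 0 ≤ 3 * τ)
  rw [sub_add_cancel, ← hc] at hmain
  filter_upwards [h.conv (2 * l) (c / 3) (by positivity)] with i hconv
  have he := h.norm_e i
  have hy : ‖(2 * l) • e i‖ = 2 * l := by
    rw [norm_smul, he, Real.norm_of_nonneg (by linarith), mul_one]
  have hy0 : (2 * l) • e i ≠ 0 := norm_pos_iff.1 (by rw [hy]; linarith)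
  refine ⟨hy, ?_⟩
  have hz : ‖(l ^ 2 / ‖(2 * l) • e i‖ ^ 2) • (2 * l) • e i‖ ≤ 2 * l := by
    rw [norm_inv_smul hy0, hy, div_le_iff₀ (by linarith)]
    nlinarith only [hl]
  have hk := abs_kelvin_le (f := fun z => V i z - bubble n R (e i) z) hn hl hy0 (hconv _ hz).1
  have hDy : barD (√(1 + R ^ 2)) R (e i) ((2 * l) • e i) = D := by
    rw [barD_sqrt R he, ← sub_smul, norm_smul, he, mul_one, Real.norm_eq_abs, sq_abs]
  have hb : bubble n R (e i) ((2 * l) • e i) = D ^ (-(((n : ℝ) - 2) / 2)) := by rw [bubble, hDy]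
  have hpow : l ^ (n - 2) * (c / 3) * ((2 * l) ^ (n - 2))⁻¹ ≤ c / 3 := by
    have h1 : l ^ (n - 2) ≤ (2 * l) ^ (n - 2) := by gcongr; linarith
    rw [mul_comm (l ^ (n - 2)), mul_assoc, ← div_eq_mul_inv]
    exact mul_le_of_le_one_right (by positivity) (by rw [div_le_one (by positivity)]; exact h1)
  rw [kelvin_sub, kelvin_bubble_eq (τ := -τ) hl (by linarith) he hy0, hDy, hy,
    show D + -τ / l ^ 2 * ((2 * l) ^ 2 - l ^ 2) = D - 3 * τ by field_simp; ring] at hk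
  have h1 := (abs_le.1 (hk.trans hpow)).1
  have h2 := (abs_le.1 (hconv _ hy.le).1).2
  rw [hb] at h2
  linarith only [h1, h2, hmain, hc0]

/-- No such blow-up sequence exists. -/
theorem BlowUp.false (h : BlowUp n j R Λ e κ Γ T V 𝒦) (hn : 4 ≤ n) (hR : 2 ≤ R)
    (hRC : 192 * coreC n ≤ R ^ 2) (hRA : 128 * 2 ^ n * coreA2 n * coreC n ≤ R ^ 2)
    (hΛ : 0 < Λ) : False := by
  obtain ⟨A, hA, τ₁, hτ₁, hlap⟩ := h.interior hn hR hRC hRA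
  obtain ⟨τ₂, hτ₂, hout⟩ := h.outer hn hR hA.le
  obtain ⟨τ₃, hτ₃, hbot⟩ := h.bottom hn hR hRC hRA hΛ hA.le
  obtain ⟨τ, hτ, h1, h2, h3, h4⟩ : ∃ τ > 0, τ ≤ τ₁ ∧ τ ≤ τ₂ ∧ τ ≤ τ₃ ∧ τ ≤ 1 / 4 :=
    ⟨min (min τ₁ τ₂) (min τ₃ (1 / 4)), by positivity, by simp, by simp, by simp, by simp⟩
  set a₀ := √(1 + R ^ 2 - τ) with ha₀
  set a₁ := √(1 + R ^ 2 + τ) with ha₁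
  have hsq₀ : a₀ ^ 2 = 1 + R ^ 2 - τ := Real.sq_sqrt (by nlinarith only [hR, h4])
  have hsq₁ : a₁ ^ 2 = 1 + R ^ 2 + τ := Real.sq_sqrt (by positivity)
  have ha₀p : 0 < a₀ := Real.sqrt_pos.2 (by nlinarith only [hR, h4])
  have ha₁p : 0 < a₁ := Real.sqrt_pos.2 (by positivity)
  have ha : a₀ ≤ a₁ := Real.sqrt_le_sqrt (by linarith)
  obtain ⟨ha₀1, -, -, hm0, -⟩ := radius_bounds (R := R) (l := a₀) (by linarith) ha₀p (by
    rw [hsq₀, abs_le]; constructor <;> linarith)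
  have hlτ : ∀ l ∈ Icc a₀ a₁, 0 < l ∧ |l ^ 2 - (1 + R ^ 2)| ≤ τ := fun l hl => by
    have b0 : 0 < l := ha₀p.trans_le hl.1
    have b1 : a₀ ^ 2 ≤ l ^ 2 := by gcongr; exact hl.1
    have b2 : l ^ 2 ≤ a₁ ^ 2 := by gcongr; exact hl.2
    exact ⟨b0, by rw [abs_le]; constructor <;> linarith⟩
  obtain ⟨i, hlap, hout, hbot, hstart, hfail, hcont, hdiff, hΓ, hT⟩ := (hlap.and (hout.and (hbot.and
    ((h.start hn hR hΛ hA.le hτ h4 ha₀p hsq₀).and ((h.exists_lt_kelvin hn hτ h4 ha₁p hsq₁).and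
    (h.cont.and (h.diff.and ((h.Γ_lim.eventually_gt_atTop (16 * a₁)).and
    (h.T_lim.eventually_gt_atTop (2 * a₁)))))))))).exists
  have hΓ0 : 0 < Γ i := by linarith
  have hκ := h.κ_nonneg i
  have hG0 : ∀ l ∈ Icc a₀ a₁, ∀ y, l ≤ ‖y‖ →
      0 ≤ cmpG n R (e i) (κ i) (A * (Γ i ^ (n - 2))⁻¹) l y := fun l hl y hly => by
    obtain ⟨hl0, hlτ⟩ := hlτ l hl
    obtain ⟨b1, -, -, b2, b3⟩ := radius_bounds (R := R) (by linarith) hl0 (hlτ.trans h4)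
    have b4 := (barG_bounds hn (h.norm_e i) (by linarith) b1 b2 b3 hly).1
    rw [cmpG]
    positivity
  have key := sphereDiff_nonneg_of_start (j := j) (b := Γ i / 8) (T := T i) (V := V i)
    (G := cmpG n R (e i) (κ i) (A * (Γ i ^ (n - 2))⁻¹)) hn ha₀p ha (by linarith) (by linarith)
    hcont hdiff ?_ hG0
    (fun l hl => hlap l (hlτ l hl).1 ((hlτ l hl).2.trans h1))
    (fun l hl => hbot l (hlτ l hl).1 ((hlτ l hl).2.trans h3))
    (fun l hl => hout l (hlτ l hl).1 ((hlτ l hl).2.trans h2)) hstart ((2 * a₁) • e i) ⟨?_, ?_, ?_⟩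
  · have b1 := hG0 a₁ ⟨ha, le_rfl⟩ ((2 * a₁) • e i) (by rw [hfail.1]; linarith)
    have b2 : 0 ≤ ‖(2 * a₁) • e i‖ ^ 2 - a₁ ^ 2 := by
      rw [hfail.1]; nlinarith only [sq_nonneg a₁]
    have b3 := mul_nonneg b2 b1
    rw [sphereDiff] at key
    linarith only [key, b3, hfail.2]
  · unfold cmpG
    refine ContinuousOn.add (continuousOn_const.mul ((continuousOn_barG ha₀1 (h.norm_e i) hm0).mono
      (prod_mono_right (subset_univ _)))) (continuousOn_const.div (by fun_prop) fun p hp => ?_)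
    have b1 : a₀ ≤ p.1 := hp.1.1
    have b2 : a₀ ≤ ‖p.2‖ := hp.2
    have b3 : 0 < p.1 := by linarith
    have b4 : 0 < ‖p.2‖ := by linarith
    positivity
  · rw [hfail.1]; linarith
  · rw [hfail.1]; linarith
  · have := (abs_le.1 (abs_coord_le_norm ((2 * a₁) • e i) j)).1
    rw [hfail.1] at this
    linarith

end

lemma HasLap.comp_affine {n : ℕ} {f : Euc n → ℝ} {x y w g : Euc n} {a L : ℝ} (b : ℝ)
    (h : HasLap f (x + a • (y - w)) g L) :
    HasLap (fun z => b * f (x + a • (z - w))) y ((b * a) • g) (b * a ^ 2 * L) := by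
  obtain ⟨F, H, h1, h2, h3, h4⟩ := h
  have hA : ∀ z, HasFDerivAt (fun z : Euc n => x + a • (z - w))
      (a • ContinuousLinearMap.id ℝ (Euc n)) z := fun z =>
    (((hasFDerivAt_id z).sub_const w).const_smul a).const_add x
  refine ⟨fun z => (b * a) • F (x + a • (z - w)), (b * a) • (H ∘L (a • ContinuousLinearMap.id ℝ _)),
    ?_, by simp only [h2], (h3.comp y (hA y)).const_smul (b * a), ?_⟩
  · filter_upwards [(hA y).continuousAt.eventually h1] with z hz
    refine ((hz.comp z (hA z)).const_mul b).congr_fderiv ?_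
    ext v
    simp [mul_assoc]
  · rw [← h4]
    simp [mul_assoc, pow_two]

section

variable {n : ℕ} {h0 : 0 < n}

/-- A solution of the system is classical in the interior. -/
lemma IsYamabeSol.contDiffAt {K c u : Euc n → ℝ} (h : IsYamabeSol n h0 K c u) {z : Euc n}
    (hz : z ∈ halfBall n h0 1) : ContDiffAt ℝ 2 u z :=
  h.1.contDiffAt (mem_of_superset ((isOpen_halfBall 1).mem_nhds hz) subset_closure)

lemma IsYamabeSol.hasLap {K c u : Euc n → ℝ} (h : IsYamabeSol n h0 K c u) {z : Euc n}
    (hz : z ∈ halfBall n h0 1) :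
    ∃ g, HasLap u z g (-(K z * u z ^ (((n : ℝ) + 2) / (n - 2)))) := by
  have hd := h.contDiffAt hz
  obtain ⟨g, L, hL⟩ := HasLap.of_contDiffAt hd
  have h1 := h.2.2.1 z hz
  have h2 : lapWithin n (closure (halfBall n h0 1)) u z = L := by
    rw [hL.lap_eq_sum, lapWithin,
      iteratedFDerivWithin_eq_iteratedFDeriv (uniqueDiffOn_closure_halfBall one_pos) hd
        (subset_closure hz)]
    simp [iteratedFDeriv_two_apply]
  rw [h2] at h1
  exact ⟨g, by convert hL using 1; linarith⟩

lemma IsYamabeSol.hasDerivWithinAt {K c u : Euc n → ℝ} (h : IsYamabeSol n h0 K c u) {z : Euc n}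
    (hz : z ∈ flatBdry n h0 1) :
    HasDerivWithinAt (fun t : ℝ => u (z + t • EuclideanSpace.single (lastIdx n h0) 1))
      (c z * u z ^ ((n : ℝ) / (n - 2))) (Ici 0) 0 := by
  have hz1 : ‖z‖ < 1 := by simpa using hz.1
  have hz0 : z (lastIdx n h0) = 0 := hz.2
  have hzc : z ∈ closure (halfBall n h0 1) := mem_closure_halfBall hz1 hz0.ge
  have hmem : ∀ t ∈ Ico 0 (1 - ‖z‖),
      z + t • EuclideanSpace.single (lastIdx n h0) (1 : ℝ) ∈ closure (halfBall n h0 1) := by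
    intro t ht
    refine mem_closure_halfBall ?_ ?_
    · refine (norm_add_le _ _).trans_lt ?_
      have : t < 1 - ‖z‖ := ht.2
      rw [norm_smul, PiLp.norm_single, norm_one, mul_one, Real.norm_of_nonneg ht.1]
      linarith
    · simp [hz0, ht.1]
  have hf := ((h.1 z hzc).differentiableWithinAt two_ne_zero).hasFDerivWithinAt
  rw [← h.2.2.2 z hz, normalDerivWithin]
  have hline : HasDerivWithinAt (fun t : ℝ => z + t • EuclideanSpace.single (lastIdx n h0) (1 : ℝ))
      (EuclideanSpace.single (lastIdx n h0) (1 : ℝ)) (Ico 0 (1 - ‖z‖)) 0 := by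
    simpa using (((hasDerivAt_id (0 : ℝ)).smul_const
      (EuclideanSpace.single (lastIdx n h0) (1 : ℝ))).const_add z).hasDerivWithinAt
  refine (HasFDerivWithinAt.comp_hasDerivWithinAt (0 : ℝ) (t := closure (halfBall n h0 1))
    (by simpa using hf) hline hmem).mono_of_mem_nhdsWithin ?_
  exact Ico_mem_nhdsGE (by linarith)

end

/-- A continuous linear functional as multiple of the inner product with a unit vector. -/
lemma exists_unit_gradient {n : ℕ} (hn : 0 < n) (φ : Euc n →L[ℝ] ℝ) :
    ∃ e : Euc n, ‖e‖ = 1 ∧ ∀ y, φ y = ‖φ‖ * inner ℝ e y := by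
  rcases eq_or_ne φ 0 with rfl | hφ
  · exact ⟨EuclideanSpace.single ⟨0, hn⟩ 1, by simp, by simp⟩
  · set g := (InnerProductSpace.toDual ℝ (Euc n)).symm φ with hg
    have hgn : ‖g‖ = ‖φ‖ := LinearIsometryEquiv.norm_map _ _
    have hp : 0 < ‖φ‖ := norm_pos_iff.2 hφ
    refine ⟨‖φ‖⁻¹ • g, ?_, fun y => ?_⟩
    · rw [norm_smul, hgn, norm_inv, norm_norm, inv_mul_cancel₀ hp.ne']
    · rw [inner_smul_left, hg, InnerProductSpace.toDual_symm_apply]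
      simp only [conj_trivial]
      field_simp

section

variable {n : ℕ} {h0 : 0 < n} {C₀ Λ : ℝ} {K : Euc n → ℝ}

lemma CondK1.differentiableOn (hn : 4 ≤ n) (h : CondK1 n h0 C₀ K) :
    DifferentiableOn ℝ K (closure (halfBall n h0 1)) ∧
      DifferentiableOn ℝ (fderivWithin ℝ K (closure (halfBall n h0 1)))
        (closure (halfBall n h0 1)) := by
  have h2 : ContDiffOn ℝ 2 K (closure (halfBall n h0 1)) :=
    h.1.of_le (by exact_mod_cast (by omega : 2 ≤ n - 2))
  exact ⟨h2.differentiableOn two_ne_zero, (h2.fderivWithin (uniqueDiffOn_closure_halfBall one_pos)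
    (m := 1) (by norm_num)).differentiableOn one_ne_zero⟩

lemma CondK1.second_le (hn : 4 ≤ n) (h : CondK1 n h0 C₀ K) :
    ∀ x ∈ closure (halfBall n h0 1),
      ‖fderivWithin ℝ (fderivWithin ℝ K (closure (halfBall n h0 1)))
          (closure (halfBall n h0 1)) x‖ ≤
        C₀ * ‖fderivWithin ℝ K (closure (halfBall n h0 1)) x‖ ^
          ((((n - 3 : ℕ) : ℝ) - 1) / ((n - 3 : ℕ) : ℝ)) := by
  intro x hx
  have hu := uniqueDiffOn_closure_halfBall (n := n) (h0 := h0) one_pos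
  have h2 := h.2 x hx 2 (by norm_num) (by omega)
  rw [norm_iteratedFDerivWithin_one _ (hu x hx)] at h2
  rw [norm_fderivWithin_two hu hx]
  convert h2 using 3
  rw [Nat.cast_sub (by omega)]
  push_cast
  ring

lemma CondK2.gradient_le (hn : 4 ≤ n) (h : CondK2 n h0 Λ K) {x : Euc n}
    (hx : x ∈ closure (halfBall n h0 1)) :
    ‖fderivWithin ℝ K (closure (halfBall n h0 1)) x‖ ≤ Λ := by
  have h1 := (h x hx).2 1 le_rfl (by omega)
  rwa [norm_iteratedFDerivWithin_one _ (uniqueDiffOn_closure_halfBall one_pos x hx)] at h1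

end

section Rescaling

variable {n : ℕ} {h0 : 0 < n}

lemma rescale_coord {Γ : ℝ} (hΓ : 0 < Γ) (j : Fin n) (x w y : Euc n) :
    (x + Γ⁻¹ • (y - w)) j = Γ⁻¹ * ((Γ * x j - w j) + y j) := by
  simp only [PiLp.add_apply, PiLp.smul_apply, PiLp.sub_apply, smul_eq_mul]
  field_simp
  ring

lemma norm_rescale_lt {R Γ : ℝ} {x e y : Euc n} (hR : 0 ≤ R) (hΓ : 0 < Γ) (hRΓ : 24 * R ≤ Γ)
    (hx : ‖x‖ < 1 / 2) (he : ‖e‖ = 1) (hy : ‖y‖ ≤ Γ / 8) : ‖x + Γ⁻¹ • (y - R • e)‖ < 2 / 3 := by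
  have h1 : ‖Γ⁻¹ • (y - R • e)‖ ≤ 1 / 6 := by
    rw [norm_smul, norm_inv, Real.norm_of_nonneg hΓ.le, inv_mul_le_iff₀ hΓ]
    refine (norm_sub_le _ _).trans ?_
    rw [norm_smul, he, Real.norm_of_nonneg hR]
    linarith
  linarith [norm_add_le x (Γ⁻¹ • (y - R • e))]

/-- The gradient bound implies the oscillation estimate for the rescaled curvatures. -/
lemma exists_osc_rescaled {C₀ R ε : ℝ} (hn : 4 ≤ n) (hC : 0 < C₀) (hR : 0 ≤ R) (hε : 0 < ε) :
    ∃ C : ℝ, 0 < C ∧ ∀ (K : Euc n → ℝ) (x e : Euc n) (Γ l : ℝ) (y : Euc n),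
      CondK1 n h0 C₀ K → x ∈ closure (halfBall n h0 1) → ‖e‖ = 1 →
      (∀ y, fderivWithin ℝ K (closure (halfBall n h0 1)) x y =
        ‖fderivWithin ℝ K (closure (halfBall n h0 1)) x‖ * inner ℝ e y) →
      0 < Γ → 1 ≤ l → l ≤ ‖y‖ →
      x + Γ⁻¹ • ((l ^ 2 / ‖y‖ ^ 2) • y - R • e) ∈ closure (halfBall n h0 1) →
      x + Γ⁻¹ • (y - R • e) ∈ closure (halfBall n h0 1) →
      K (x + Γ⁻¹ • ((l ^ 2 / ‖y‖ ^ 2) • y - R • e)) - K (x + Γ⁻¹ • (y - R • e)) ≤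
        ‖fderivWithin ℝ K (closure (halfBall n h0 1)) x‖ / Γ *
            ((‖y‖ ^ 2 - l ^ 2) / ‖y‖ ^ 2 * (-inner ℝ e y + ε * ‖y‖)) +
          C * (Γ ^ (n - 2))⁻¹ * ((‖y‖ ^ 2 - l ^ 2) * ‖y‖ ^ (n - 4)) := by
  obtain ⟨N, rfl⟩ : ∃ N, n = N + 4 := ⟨n - 4, by omega⟩
  obtain ⟨C, hC0, hosc⟩ := exists_gradient_osc_bound (E := Euc (N + 4)) (N + 1) (by omega) hC hε
  refine ⟨C * (R + 1) ^ (N + 1), by positivity, ?_⟩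
  intro K x e Γ l y hK hx he hφ hΓ hl hly hp hq
  set Ω := closure (halfBall (N + 4) h0 1)
  set φ := fderivWithin ℝ K Ω x
  have hr0 : 0 < ‖y‖ := by linarith
  have hy0 : y ≠ 0 := norm_pos_iff.1 hr0
  have hdist : ∀ z : Euc (N + 4), ‖z‖ ≤ ‖y‖ →
      ‖x + Γ⁻¹ • (z - R • e) - x‖ ≤ Γ⁻¹ * ((R + 1) * ‖y‖) := by
    intro z hz
    rw [add_sub_cancel_left, norm_smul, norm_inv, Real.norm_of_nonneg hΓ.le]
    refine mul_le_mul_of_nonneg_left ?_ (by positivity)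
    refine (norm_sub_le _ _).trans ?_
    rw [norm_smul, he, Real.norm_of_nonneg hR]
    have : R * 1 ≤ R * ‖y‖ := by gcongr; linarith
    linarith
  have hzn : ‖(l ^ 2 / ‖y‖ ^ 2) • y‖ ≤ ‖y‖ := by
    rw [norm_inv_smul hy0, div_le_iff₀ hr0, pow_two]
    gcongr
  have hsub := sub_le_of_gradient_osc (convex_closure_halfBall (h0 := h0) 1)
    (hK.differentiableOn hn).1 hp hq (hdist _ hzn) (hdist y le_rfl)
    (c := ε * ‖φ‖ + C * (Γ⁻¹ * ((R + 1) * ‖y‖)) ^ (N + 1)) (fun z hz hzb => by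
      refine (hosc Ω K (convex_closure_halfBall 1) (hK.differentiableOn hn).2
        (hK.second_le hn) x hx z hz).trans ?_
      gcongr)
  have hpq : x + Γ⁻¹ • ((l ^ 2 / ‖y‖ ^ 2) • y - R • e) - (x + Γ⁻¹ • (y - R • e)) =
      (-(Γ⁻¹ * ((‖y‖ ^ 2 - l ^ 2) / ‖y‖ ^ 2))) • y := by
    have : l ^ 2 / ‖y‖ ^ 2 = 1 - (‖y‖ ^ 2 - l ^ 2) / ‖y‖ ^ 2 := by field_simp; ring
    rw [this]
    module
  have hs0 : 0 ≤ ‖y‖ ^ 2 - l ^ 2 := sub_nonneg.2 (by gcongr)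
  rw [hpq, norm_smul, norm_neg, Real.norm_of_nonneg (by positivity), hφ, inner_smul_right] at hsub
  have h1 := (abs_le.1 hsub).2
  rw [sub_le_iff_le_add] at h1
  refine h1.trans (le_of_eq ?_)
  have e1 : N + 4 - 2 = N + 2 := by omega
  have e2 : N + 4 - 4 = N := by omega
  rw [e1, e2, mul_pow, mul_pow, inv_pow]
  field_simp
  ring

end Rescaling

/-- Locally uniform convergence to the standard bubble, after a translation. -/
lemma TendstoC2LocOn.conv_translate {n : ℕ} {R : ℝ} (hR : 0 ≤ R) {v : ℕ → Euc n → ℝ} {U : Euc n → ℝ}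
    (hU : ∀ y : Euc n, U y = (1 + ‖y‖ ^ 2) ^ (-(((n : ℝ) - 2) / 2)))
    (h : TendstoC2LocOn n v U univ) {e : ℕ → Euc n} (he : ∀ i, ‖e i‖ = 1) {ρ η : ℝ} (hη : 0 < η) :
    ∀ᶠ i in atTop, ∀ y, ‖y‖ ≤ ρ →
      |v i (y - R • e i) - bubble n R (e i) y| ≤ η ∧
        ‖fderiv ℝ (fun z => v i (z - R • e i)) y - fderiv ℝ (bubble n R (e i)) y‖ ≤ η := by
  obtain ⟨h1, h2, -⟩ := h (closedBall 0 (ρ + R)) (isCompact_closedBall _ _) (subset_univ _)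
  have hb : ∀ i, bubble n R (e i) = fun z => U (z - R • e i) := by
    intro i
    funext z
    rw [hU, bubble, barD_sqrt R (he i), add_comm]
  filter_upwards [Metric.tendstoUniformlyOn_iff.1 h1 η hη, Metric.tendstoUniformlyOn_iff.1 h2 η hη]
    with i h1 h2 y hy
  have hmem : y - R • e i ∈ closedBall (0 : Euc n) (ρ + R) := by
    rw [mem_closedBall_zero_iff]
    refine (norm_sub_le _ _).trans ?_
    rw [norm_smul, he, Real.norm_of_nonneg hR]
    linarith
  have h1 := h1 _ hmem
  have h2 := h2 _ hmem
  rw [dist_comm, Real.dist_eq] at h1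
  rw [dist_comm, dist_eq_norm, fderivWithin_univ, fderivWithin_univ] at h2
  rw [hb, fderiv_comp_sub, fderiv_comp_sub]
  exact ⟨h1.le, h2.le⟩

lemma rpow_rescale {n : ℕ} (hn : 4 ≤ n) {M Γ a : ℝ} (hM : 0 < M)
    (hΓ : Γ = M ^ ((2 : ℝ) / (n - 2))) (ha : 0 < a) (k : ℕ) :
    M⁻¹ * Γ⁻¹ ^ k * a ^ (((n : ℝ) - 2 + 2 * k) / (n - 2)) =
      (M⁻¹ * a) ^ (((n : ℝ) - 2 + 2 * k) / (n - 2)) := by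
  have hn' : (4 : ℝ) ≤ n := by exact_mod_cast hn
  have hn2 : (n : ℝ) - 2 ≠ 0 := by linarith
  rw [Real.mul_rpow (by positivity) ha.le]
  congr 1
  rw [hΓ, ← Real.rpow_neg_one M, ← Real.rpow_neg hM.le, ← Real.rpow_mul_natCast hM.le,
    ← Real.rpow_mul hM.le, ← Real.rpow_add hM]
  congr 1
  field_simp
  ring

lemma rescale_pow_eq {n : ℕ} (hn : 4 ≤ n) {M Γ : ℝ} (hM : 0 < M)
    (hΓ : Γ = M ^ ((2 : ℝ) / (n - 2))) : Γ ^ (n - 2) = M ^ 2 := by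
  have hn' : (4 : ℝ) ≤ n := by exact_mod_cast hn
  have hn2 : (n : ℝ) - 2 ≠ 0 := by linarith
  rw [hΓ, ← Real.rpow_mul_natCast hM.le, Nat.cast_sub (by omega), ← Real.rpow_natCast M 2]
  congr 1
  push_cast
  field_simp

section

variable {n : ℕ} {h0 : 0 < n}

/-- The rescaled solution satisfies the boundary condition with a bounded coefficient. -/
lemma IsYamabeSol.rescaled_bdry {K c u : Euc n → ℝ} {Λ M Γ : ℝ} (hn : 4 ≤ n)
    (h : IsYamabeSol n h0 K c u) (hM : 0 < M) (hΓ : Γ = M ^ ((2 : ℝ) / (n - 2)))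
    {x w y : Euc n} (hz : x + Γ⁻¹ • (y - w) ∈ flatBdry n h0 1)
    (hc : |c (x + Γ⁻¹ • (y - w))| ≤ Λ) (hu : 0 < u (x + Γ⁻¹ • (y - w))) :
    ∃ d, d ≤ Λ * (M⁻¹ * u (x + Γ⁻¹ • (y - w))) ^ ((n : ℝ) / (n - 2)) ∧
      HasDerivWithinAt (fun t : ℝ =>
        M⁻¹ * u (x + Γ⁻¹ • (y + t • EuclideanSpace.single (lastIdx n h0) 1 - w))) d (Ici 0) 0 := by
  have hΓ0 : 0 < Γ := hΓ ▸ Real.rpow_pos_of_pos hM _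
  have hd := h.hasDerivWithinAt hz
  set z := x + Γ⁻¹ • (y - w) with hzdef
  have hlin : HasDerivWithinAt (fun t : ℝ => Γ⁻¹ * t) Γ⁻¹ (Ici 0) 0 := by
    simpa using ((hasDerivAt_id (0 : ℝ)).const_mul Γ⁻¹).hasDerivWithinAt
  have hcomp := (HasDerivWithinAt.comp (0 : ℝ) (h := fun t : ℝ => Γ⁻¹ * t)
    (by simpa using hd) hlin (fun t ht => by
      have : (0 : ℝ) ≤ t := ht
      exact mul_nonneg (by positivity) this)).const_mul M⁻¹
  refine ⟨M⁻¹ * (c z * u z ^ ((n : ℝ) / (n - 2)) * Γ⁻¹), ?_, ?_⟩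
  · have e1 := rpow_rescale hn hM hΓ hu 1
    have e2 : ((n : ℝ) - 2 + 2 * (1 : ℕ)) / (n - 2) = (n : ℝ) / (n - 2) := by
      push_cast; ring
    rw [e2, pow_one] at e1
    have e3 : M⁻¹ * (c z * u z ^ ((n : ℝ) / (n - 2)) * Γ⁻¹) =
        c z * (M⁻¹ * Γ⁻¹ * u z ^ ((n : ℝ) / (n - 2))) := by ring
    rw [e3, e1]
    gcongr
    exact (le_abs_self _).trans hc
  · refine hcomp.congr_of_eventuallyEq (Eventually.of_forall fun t => ?_) ?_
    · show M⁻¹ * u _ = M⁻¹ * u _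
      congr 2
      rw [hzdef]
      module
    · simp [hzdef]

lemma IsYamabeSol.rescaled_hasLap {K c u : Euc n → ℝ} {M Γ : ℝ} (hn : 4 ≤ n)
    (h : IsYamabeSol n h0 K c u) (hM : 0 < M) (hΓ : Γ = M ^ ((2 : ℝ) / (n - 2)))
    {x w y : Euc n} (hz : x + Γ⁻¹ • (y - w) ∈ halfBall n h0 1) :
    ∃ g, HasLap (fun y => M⁻¹ * u (x + Γ⁻¹ • (y - w))) y g (-(K (x + Γ⁻¹ • (y - w)) *
      (M⁻¹ * u (x + Γ⁻¹ • (y - w))) ^ (((n : ℝ) + 2) / (n - 2)))) := by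
  obtain ⟨g, hg⟩ := h.hasLap hz
  refine ⟨(M⁻¹ * Γ⁻¹) • g, ?_⟩
  convert hg.comp_affine M⁻¹ using 1
  have e1 := rpow_rescale hn hM hΓ (h.2.1 _ (subset_closure hz)) 2
  have e2 : ((n : ℝ) - 2 + 2 * (2 : ℕ)) / (n - 2) = ((n : ℝ) + 2) / (n - 2) := by
    push_cast; ring
  rw [e2] at e1
  rw [← e1]
  ring

lemma CondK2.sub_le {Λ : ℝ} {K : Euc n → ℝ} (hn : 4 ≤ n) (h : CondK2 n h0 Λ K)
    (hK : DifferentiableOn ℝ K (closure (halfBall n h0 1))) {x z : Euc n}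
    (hx : x ∈ closure (halfBall n h0 1)) (hz : z ∈ closure (halfBall n h0 1)) :
    |K z - K x| ≤ Λ * ‖z - x‖ :=
  (convex_closure_halfBall 1).norm_image_sub_le_of_norm_fderivWithin_le hK
    (fun _ hy => h.gradient_le hn hy) hx hz

lemma rescaled_low {u : Euc n → ℝ} {M Γ Q : ℝ} {i : ℕ} (hn : 4 ≤ n)
    (hpos : ∀ x ∈ closure (halfBall n h0 1), 0 < u x) (hM : 0 < M)
    (hΓ : Γ = M ^ ((2 : ℝ) / (n - 2))) (hQ : Q ≤ i)
    (hblow : (i : ℝ) < M * sInf (u '' closure (halfBall n h0 (2 / 3)))) {z : Euc n}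
    (hz : z ∈ closure (halfBall n h0 (2 / 3))) :
    Q * (Γ ^ (n - 2))⁻¹ ≤ M⁻¹ * u z := by
  have hsub : closure (halfBall n h0 (2 / 3)) ⊆ closure (halfBall n h0 1) :=
    closure_mono (inter_subset_inter_left _ (ball_subset_ball (by norm_num)))
  have h1 : sInf (u '' closure (halfBall n h0 (2 / 3))) ≤ u z :=
    csInf_le ⟨0, by rintro _ ⟨y, hy, rfl⟩; exact (hpos y (hsub hy)).le⟩ (mem_image_of_mem u hz)
  have h2 : Q ≤ M * u z := (hQ.trans hblow.le).trans (by gcongr)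
  rw [rescale_pow_eq hn hM hΓ]
  calc Q * (M ^ 2)⁻¹ ≤ M * u z * (M ^ 2)⁻¹ := by gcongr
    _ = M⁻¹ * u z := by field_simp

end

/-- in the blow-up framework with `T_i → ∞`, the gradient of `K_i`
at the blow-up points vanishes at the rate `Γ_i^{3-n}`. -/
theorem gradK_vanishes_fast_Ti_unbounded (n : ℕ) (hn : 4 ≤ n) (h0 : 0 < n)
    (C₀ Λ : ℝ) (hC₀ : 0 < C₀) (hΛ : 0 < Λ)
    (K : ℕ → Euc n → ℝ) (c : ℕ → Euc n → ℝ) (u : ℕ → Euc n → ℝ)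
    (x : ℕ → Euc n) (σ : ℕ → ℝ) (M Γ : ℕ → ℝ) (v : ℕ → Euc n → ℝ) (U : Euc n → ℝ)
    (hK1 : ∀ i, CondK1 n h0 C₀ (K i))
    (hK2 : ∀ i, CondK2 n h0 Λ (K i))
    (hK3 : ∀ i, CondK3 n h0 (K i))
    (hKx : Filter.Tendsto (fun i => K i (x i)) Filter.atTop (nhds ((n : ℝ) * ((n : ℝ) - 2))))
    (hc : ∀ i, ∀ z ∈ flatBdry n h0 1, |c i z| ≤ Λ)
    (hsol : ∀ i, IsYamabeSol n h0 (K i) (c i) (u i))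
    (hx : ∀ i, x i ∈ closure (upperHalf n h0) ∩ Metric.ball (0 : Euc n) (1/2))
    (hM : ∀ i, M i = u i (x i))
    (hΓ : ∀ i, Γ i = M i ^ ((2 : ℝ) / ((n : ℝ) - 2)))
    (hmax : ∀ i, sSup (u i '' closure (halfBall n h0 (1/3))) ≤ M i)
    (hσ0 : Filter.Tendsto σ Filter.atTop (nhds 0))
    (hloc : ∀ i, ∀ z ∈ Metric.ball (x i) (σ i) ∩ upperHalf n h0, u i z ≤ M i)
    (hσGamma : Filter.Tendsto (fun i => Γ i * σ i) Filter.atTop Filter.atTop)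
    (hblow : ∀ i : ℕ, (i : ℝ) < M i * sInf (u i '' closure (halfBall n h0 (2/3))))
    (hT : Filter.Tendsto (fun i => x i (lastIdx n h0) * Γ i) Filter.atTop Filter.atTop)
    (hv : ∀ i y, v i y = u i (x i + (Γ i)⁻¹ • y) / M i)
    (hU : ∀ y : Euc n, U y = (1 + ‖y‖ ^ 2) ^ (-(((n : ℝ) - 2) / 2)))
    (hconv : TendstoC2LocOn n v U Set.univ) :
    ∃ C : ℝ, 0 < C ∧
      ∀ i, ‖iteratedFDerivWithin ℝ 1 (K i) (closure (halfBall n h0 1)) (x i)‖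
          * Γ i ^ ((n : ℝ) - 3) ≤ C := by
  exfalso
  have hn' : (4 : ℝ) ≤ n := by exact_mod_cast hn
  set j := lastIdx n h0
  set Ω := closure (halfBall n h0 1)
  obtain ⟨R, hR2, hRC, hRA⟩ := exists_core_radius n
  have hR : 0 ≤ R := by linarith
  have hxn : ∀ i, ‖x i‖ < 1 / 2 := fun i => by simpa using (hx i).2
  have hxj : ∀ i, 0 ≤ x i j := fun i =>
    closure_minimal (s := upperHalf n h0) (t := {y | 0 ≤ y j}) (fun z (hz : 0 < z j) => hz.le)
      (isClosed_le continuous_const (by fun_prop : Continuous fun y : Euc n => y j)) (hx i).1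
  have hxΩ : ∀ i, x i ∈ Ω := fun i => mem_closure_halfBall (by linarith [hxn i]) (hxj i)
  have hM0 : ∀ i, 0 < M i := fun i => hM i ▸ (hsol i).2.1 _ (hxΩ i)
  have hΓ0 : ∀ i, 0 < Γ i := fun i => hΓ i ▸ Real.rpow_pos_of_pos (hM0 i) _
  have hxj1 : ∀ i, x i j ≤ 1 := fun i =>
    (le_abs_self _).trans ((abs_coord_le_norm _ j).trans (by linarith [hxn i]))
  have hΓlim : Tendsto Γ atTop atTop :=
    tendsto_atTop_mono (fun i => by nlinarith only [hxj1 i, (hΓ0 i).le]) hT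
  have hφ := fun i => exists_unit_gradient h0 (fderivWithin ℝ (K i) Ω (x i))
  choose e he hφe using hφ
  set δ : ℕ → ℝ := fun i => ‖fderivWithin ℝ (K i) Ω (x i)‖
  have hδ : ∀ i, δ i ≤ Λ := fun i => (hK2 i).gradient_le hn (hxΩ i)
  have hej : ∀ i, |R * e i j| ≤ R := fun i => by
    rw [abs_mul, abs_of_nonneg hR]
    have := (abs_coord_le_norm (e i) j).trans_eq (he i)
    nlinarith only [this, hR]
  set T : ℕ → ℝ := fun i => Γ i * x i j - R * e i j with hTdef
  have hTlim : Tendsto T atTop atTop := by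
    refine tendsto_atTop_mono (fun i => ?_) (tendsto_atTop_add_const_right _ (-R) hT)
    have := (abs_le.1 (hej i)).2
    simp only [hTdef]
    linarith only [this]
  set P : ℕ → Euc n → Euc n := fun i y => x i + (Γ i)⁻¹ • (y - R • e i) with hP
  have hPj : ∀ i y, P i y j = (Γ i)⁻¹ * (T i + y j) := fun i y => by
    simp only [hP, hTdef]
    rw [rescale_coord (hΓ0 i)]
    simp
  have hbig : ∀ᶠ i in atTop, 24 * R ≤ Γ i := hΓlim.eventually_ge_atTop _
  have hPn : ∀ᶠ i in atTop, ∀ y, ‖y‖ ≤ Γ i / 8 → ‖P i y‖ < 2 / 3 := by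
    filter_upwards [hbig] with i hi y hy
    exact norm_rescale_lt hR (hΓ0 i) hi (hxn i) (he i) hy
  have hPj0 : ∀ i y, -T i ≤ y j → 0 ≤ P i y j := fun i y hy => by
    rw [hPj]
    exact mul_nonneg (inv_nonneg.2 (hΓ0 i).le) (by linarith)
  have hP23 : ∀ᶠ i in atTop, ∀ y, ‖y‖ ≤ Γ i / 8 → -T i ≤ y j →
      P i y ∈ closure (halfBall n h0 (2 / 3)) := by
    filter_upwards [hPn] with i hi y hy hyT
    exact mem_closure_halfBall (hi y hy) (hPj0 i y hyT)
  have hPΩ : ∀ᶠ i in atTop, ∀ y, ‖y‖ ≤ Γ i / 8 → -T i ≤ y j → P i y ∈ Ω := by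
    filter_upwards [hPn] with i hi y hy hyT
    exact mem_closure_halfBall (by linarith [hi y hy]) (hPj0 i y hyT)
  have hPint : ∀ᶠ i in atTop, ∀ y, ‖y‖ < Γ i / 8 → -T i < y j → P i y ∈ halfBall n h0 1 := by
    filter_upwards [hPn] with i hi y hy hyT
    refine ⟨by simpa using (hi y hy.le).trans (by norm_num), ?_⟩
    show 0 < P i y j
    rw [hPj]
    exact mul_pos (inv_pos.2 (hΓ0 i)) (by linarith)
  have hcontP : ∀ i, Continuous (P i) := fun i => by fun_prop
  have hblowUp : BlowUp n j R Λ e (fun i => δ i / Γ i) Γ T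
      (fun i y => (M i)⁻¹ * u i (P i y)) (fun i y => K i (P i y)) :=
    { norm_e := he
      κ_nonneg := fun i => div_nonneg (norm_nonneg _) (hΓ0 i).le
      κ_lim := by
        refine squeeze_zero (fun i => div_nonneg (norm_nonneg _) (hΓ0 i).le)
          (fun i => div_le_div_of_nonneg_right (hδ i) (hΓ0 i).le) (hΓlim.const_div_atTop Λ)
      κΓ_le := fun i => by rw [div_mul_cancel₀ _ (hΓ0 i).ne']; exact hδ i
      Γ_lim := hΓlim
      T_lim := hTlim
      cont := by
        filter_upwards [hPΩ] with i hi
        exact ((hsol i).1.continuousOn.comp (hcontP i).continuousOn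
          fun y hy => hi y hy.1 hy.2).const_mul _
      diff := by
        filter_upwards [hPint] with i hi y hy hyT
        refine contDiffAt_const.mul (((hsol i).contDiffAt (hi y hy hyT)).comp y ?_)
        simp only [hP]
        fun_prop
      low := fun Q => by
        filter_upwards [hPΩ, hP23, tendsto_natCast_atTop_atTop.eventually_ge_atTop Q]
          with i hi hi' hQ y hy hyT
        exact ⟨mul_pos (inv_pos.2 (hM0 i)) ((hsol i).2.1 _ (hi y hy hyT)),
          rescaled_low hn (hsol i).2.1 (hM0 i) (hΓ i) hQ (hblow i) (hi' y hy hyT)⟩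
      pde := by
        filter_upwards [hPint] with i hi y hy hyT
        exact (hsol i).rescaled_hasLap hn (hM0 i) (hΓ i) (hi y hy hyT)
      bdry := by
        filter_upwards [hPn, hPΩ] with i hi hi' y hy hyT
        have hz : P i y ∈ flatBdry n h0 1 := by
          refine ⟨by simpa using (hi y hy.le).trans (by norm_num), ?_⟩
          show P i y j = 0
          rw [hPj, hyT]
          simp
        exact (hsol i).rescaled_bdry hn (hM0 i) (hΓ i) hz (hc i _ hz)
          ((hsol i).2.1 _ (hi' y hy.le hyT.ge))
      conv := fun ρ η hη => by
        have hV : ∀ i, (fun y => (M i)⁻¹ * u i (P i y)) = fun y => v i (y - R • e i) := by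
          intro i
          funext y
          rw [hv, div_eq_inv_mul]
        filter_upwards [hconv.conv_translate hR hU he (ρ := ρ) hη] with i hi
        rw [hV]
        intro y hy
        rw [congrFun (hV i) y]
        exact hi y hy
      K_pos := by
        filter_upwards [hPΩ] with i hi y hy hyT
        exact (by positivity : 0 < 1 / Λ).trans_le ((hK2 i) _ (hi y hy hyT)).1
      K_lim := fun ρ ε hε => by
        have hn2 : 0 < (n : ℝ) * (n - 2) * ε := by
          have : 0 < (n : ℝ) - 2 := by linarith
          positivity
        filter_upwards [hPΩ, hTlim.eventually_ge_atTop ρ, hΓlim.eventually_ge_atTop (8 * ρ),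
          hKx.eventually (lt_mem_nhds (by linarith : (n : ℝ) * (n - 2) - n * (n - 2) * ε / 2 <
            n * (n - 2))), hΓlim.eventually_ge_atTop (Λ * (ρ + R) / (n * (n - 2) * ε / 2))]
          with i hi h1 h2 h3 h4 y hy
        have hyT : -T i ≤ y j := by
          linarith [(abs_le.1 (abs_coord_le_norm y j)).1]
        have h5 := (abs_le.1 ((hK2 i).sub_le hn ((hK1 i).differentiableOn hn).1 (hxΩ i)
          (hi y (by linarith) hyT))).1
        have h6 : ‖P i y - x i‖ ≤ (Γ i)⁻¹ * (ρ + R) := by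
          simp only [hP]
          rw [add_sub_cancel_left, norm_smul, norm_inv, Real.norm_of_nonneg (hΓ0 i).le]
          refine mul_le_mul_of_nonneg_left ((norm_sub_le _ _).trans ?_) (inv_nonneg.2 (hΓ0 i).le)
          rw [norm_smul, he, Real.norm_of_nonneg hR]
          linarith
        have h7 : Λ * ‖P i y - x i‖ ≤ n * (n - 2) * ε / 2 := by
          rw [div_le_iff₀ (by positivity)] at h4
          calc Λ * ‖P i y - x i‖ ≤ Λ * ((Γ i)⁻¹ * (ρ + R)) := by gcongr
            _ = Λ * (ρ + R) / Γ i := by ring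
            _ ≤ _ := by rw [div_le_iff₀ (hΓ0 i)]; linarith
        linarith
      osc := fun ε hε => by
        obtain ⟨C, hC, hosc⟩ := exists_osc_rescaled (n := n) (h0 := h0) hn hC₀ hR hε
        refine ⟨C, hC, ?_⟩
        filter_upwards [hPΩ, hTlim.eventually_ge_atTop 0] with i hi hT0 l y hl _ hly hyΓ hyT
        have hr0 : 0 < ‖y‖ := by linarith
        have hf1 : l ^ 2 / ‖y‖ ^ 2 ≤ 1 := by
          rw [div_le_one (by positivity)]
          gcongr
        refine hosc (K i) (x i) (e i) (Γ i) l y (hK1 i) (hxΩ i) (he i) (hφe i) (hΓ0 i) hl hly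
          (hi _ ?_ ?_) (hi y hyΓ hyT)
        · refine le_trans ?_ hyΓ
          rw [norm_smul, Real.norm_of_nonneg (by positivity)]
          exact mul_le_of_le_one_left hr0.le hf1
        · have hf0 : 0 ≤ l ^ 2 / ‖y‖ ^ 2 := by positivity
          simp only [PiLp.smul_apply, smul_eq_mul]
          nlinarith only [hf0, hf1, hT0, hyT] }
  exact hblowUp.false hn hR2 hRC hRA hΛ
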